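/- Let Λ be a finite dimensional algebra over a field K and let (T,F) be a functorially finite torsion pair in mod Λ. Then: (1) (T,F) is Gorenstein (i.e., the basic Ext-projective generator of T is Gorenstein projective) if and only if the basic Ext-injective cogenerator of F is Gorenstein injective; (2) (T,F) is trivial (i.e., the basic Ext-projective generator of T is projective) if and only if every Ext-injective object in F is injective. -/

import Mathlib

/-!  Common definitions: Gorenstein projective/injective modules, transpose,
Auslander–Reiten translation, τ-rigid and τ-tilting modules and pairs,
torsion pairs, etc., over a finite dimensional algebra.
Throughout, "mod Λ" is modelled by the category of finitely generated
(left) modules over a finite dimensional `K`-algebra `R`, and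
"mod Λᵒᵖ" by finitely generated `Rᵐᵒᵖ`-modules. -/

universe u

open Function MulOpposite

namespace GPTau

section Ring

variable (R : Type u) [Ring R]

/-- A submodule `N ≤ M` is superfluous (small) if `N ⊔ N' = ⊤` implies `N' = ⊤`. -/
def IsSuperfluous {M : Type u} [AddCommGroup M] [Module R M] (N : Submodule R M) : Prop :=
  ∀ N' : Submodule R M, N ⊔ N' = ⊤ → N' = ⊤

/-- `M` is Gorenstein projective: there is a doubly infinite exact sequence of
finitely generated projective modules which stays exact under `Hom(-, R)` and
such that `M ≅ Im (P₋₁ → P₀)`. -/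
def IsGP (M : Type u) [AddCommGroup M] [Module R M] : Prop :=
  ∃ (P : ℤ → Type u) (_ : ∀ n, AddCommGroup (P n)) (_ : ∀ n, Module R (P n))
    (d : ∀ n : ℤ, P n →ₗ[R] P (n + 1)),
    (∀ n, Module.Finite R (P n)) ∧
    (∀ n, Module.Projective R (P n)) ∧
    (∀ n, Function.Exact (d n) (d (n + 1))) ∧
    (∀ n, Function.Exact
      (fun g : P (n + 1 + 1) →ₗ[R] R => g.comp (d (n + 1)))
      (fun g : P (n + 1) →ₗ[R] R => g.comp (d n))) ∧
    Nonempty (M ≃ₗ[R] LinearMap.range (d (-1)))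

/-- A linear map factors through a (finitely generated) projective module. -/
def FactorsThroughProj {A B : Type u} [AddCommGroup A] [Module R A]
    [AddCommGroup B] [Module R B] (f : A →ₗ[R] B) : Prop :=
  ∃ (Q : Type u) (_ : AddCommGroup Q) (_ : Module R Q),
    Module.Projective R Q ∧ ∃ (a : A →ₗ[R] Q) (b : Q →ₗ[R] B), b.comp a = f

/-- Two maps are equal in the stable category (mod projectives). -/
def StEq {A B : Type u} [AddCommGroup A] [Module R A] [AddCommGroup B] [Module R B]
    (f g : A →ₗ[R] B) : Prop :=
  FactorsThroughProj R (f - g)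

/-- An indecomposable module. -/
def IsIndec (M : Type u) [AddCommGroup M] [Module R M] : Prop :=
  Nontrivial M ∧ ∀ N₁ N₂ : Submodule R M, IsCompl N₁ N₂ → N₁ = ⊥ ∨ N₂ = ⊥

/-- `|M| = k` : `M` decomposes into indecomposable direct summands having
exactly `k` isomorphism classes. -/
def NumIndec (M : Type u) [AddCommGroup M] [Module R M] (k : ℕ) : Prop :=
  ∃ (n : ℕ) (N : Fin n → Submodule R M),
    DirectSum.IsInternal N ∧ (∀ i, IsIndec R (N i)) ∧
    ∃ c : Fin n → Fin k, Surjective c ∧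
      ∀ i j, (c i = c j ↔ Nonempty ((N i) ≃ₗ[R] (N j)))

/-- A basic module: it is a direct sum of pairwise nonisomorphic indecomposables. -/
def IsBasic (M : Type u) [AddCommGroup M] [Module R M] : Prop :=
  ∃ (n : ℕ) (N : Fin n → Submodule R M),
    DirectSum.IsInternal N ∧ (∀ i, IsIndec R (N i)) ∧
    ∀ i j, i ≠ j → ¬ Nonempty ((N i) ≃ₗ[R] (N j))

/-- `M` has no nonzero projective direct summand. -/
def NoProjSummand (M : Type u) [AddCommGroup M] [Module R M] : Prop :=
  ∀ N₁ N₂ : Submodule R M, IsCompl N₁ N₂ → Module.Projective R N₁ → N₁ = ⊥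

/-- `X` is a direct summand of `T`. -/
def IsDirectSummand (X T : Type u) [AddCommGroup X] [Module R X]
    [AddCommGroup T] [Module R T] : Prop :=
  ∃ (i : X →ₗ[R] T) (p : T →ₗ[R] X), p.comp i = LinearMap.id

/-- `Ext¹(X, Y) = 0`: every short exact sequence `0 → Y → E → X → 0` splits. -/
def Ext1Vanishes (X Y : Type u) [AddCommGroup X] [Module R X]
    [AddCommGroup Y] [Module R Y] : Prop :=
  ∀ (E : Type u) [AddCommGroup E] [Module R E] (i : Y →ₗ[R] E) (p : E →ₗ[R] X),
    Injective i → Surjective p → Function.Exact i p →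
    ∃ s : X →ₗ[R] E, p.comp s = LinearMap.id

/-- `X ∈ Fac G`: `X` is a quotient of a finite direct sum of copies of `G`. -/
def FacOf (G X : Type u) [AddCommGroup G] [Module R G] [AddCommGroup X] [Module R X] : Prop :=
  ∃ (n : ℕ) (p : (Fin n → G) →ₗ[R] X), Surjective p

/-- `X ∈ Sub C`: `X` embeds into a finite direct sum of copies of `C`. -/
def SubOf (C X : Type u) [AddCommGroup C] [Module R C] [AddCommGroup X] [Module R X] : Prop :=
  ∃ (n : ℕ) (i : X →ₗ[R] (Fin n → C)), Injective i

/-- `X ∈ add G`: `X` is a direct summand of a finite direct sum of copies of `G`. -/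
def InAdd (G X : Type u) [AddCommGroup G] [Module R G] [AddCommGroup X] [Module R X] : Prop :=
  ∃ (n : ℕ) (i : X →ₗ[R] (Fin n → G)) (p : (Fin n → G) →ₗ[R] X), p.comp i = LinearMap.id

/-- The Jacobson radical of `R` (as a left ideal). -/
def JacobsonRad : Ideal R := (⊥ : Ideal R).jacobson

/-- The Jacobson radical squares to zero. -/
def RadSquareZero : Prop :=
  ∀ x y : R, x ∈ JacobsonRad R → y ∈ JacobsonRad R → x * y = 0

/-- A uniserial module: its submodules form a chain. -/
def IsUniserial (M : Type u) [AddCommGroup M] [Module R M] : Prop :=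
  ∀ N₁ N₂ : Submodule R M, N₁ ≤ N₂ ∨ N₂ ≤ N₁

/-- `R` has finite global dimension: there is `n` such that every finitely
generated module has a projective resolution vanishing in degrees `> n`. -/
def FiniteGlobalDimension : Prop :=
  ∃ n : ℕ, ∀ (M : Type u) [AddCommGroup M] [Module R M], Module.Finite R M →
    ∃ (P : ℕ → Type u) (_ : ∀ i, AddCommGroup (P i)) (_ : ∀ i, Module R (P i))
      (d : ∀ i : ℕ, P (i + 1) →ₗ[R] P i) (ε : P 0 →ₗ[R] M),
      (∀ i, Module.Projective R (P i)) ∧ Surjective ε ∧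
      Function.Exact (d 0) ε ∧ (∀ i, Function.Exact (d (i + 1)) (d i)) ∧
      (∀ i, n < i → Subsingleton (P i))

/-- The injective dimension of `R` as a module over itself is at most 1. -/
def SelfInjDimLE1 : Prop :=
  ∃ (I₀ I₁ : Type u) (_ : AddCommGroup I₀) (_ : Module R I₀)
    (_ : AddCommGroup I₁) (_ : Module R I₁),
    Module.Finite R I₀ ∧ Module.Finite R I₁ ∧
    Module.Injective R I₀ ∧ Module.Injective R I₁ ∧
    ∃ (i : R →ₗ[R] I₀) (p : I₀ →ₗ[R] I₁),
      Injective i ∧ Surjective p ∧ Function.Exact i p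

end Ring

section Algebra

variable (R : Type u) [Ring R] (K : Type u) [Field K] [Algebra K R]

/-- For an algebra over a field, the scalars of the base field commute with the
ring action on any compatible module. -/
instance (priority := 100) smulCommClass_of_tower (M : Type u) [AddCommGroup M]
    [Module R M] [Module K M] [IsScalarTower K R M] : SMulCommClass R K M :=
  ⟨fun r k m => by
    rw [← algebraMap_smul R k m, ← mul_smul, ← Algebra.commutes, mul_smul, algebraMap_smul]⟩

end Algebra

section OpDual

variable (R : Type u) [Ring R] (K : Type u) [Field K] [Algebra K R]
variable (M : Type u) [AddCommGroup M] [Module Rᵐᵒᵖ M] [Module K M]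
  [IsScalarTower K Rᵐᵒᵖ M]

/-- The `K`-dual of a (finitely generated) `Rᵐᵒᵖ`-module, as an `R`-module:
this is the duality `D : mod Λᵒᵖ → mod Λ`. -/
def OpDual (R : Type u) [Ring R] (K : Type u) [Field K] [Algebra K R]
    (M : Type u) [AddCommGroup M] [Module Rᵐᵒᵖ M] [Module K M]
    [IsScalarTower K Rᵐᵒᵖ M] : Type u := M →ₗ[K] K

instance : AddCommGroup (OpDual R K M) := inferInstanceAs (AddCommGroup (M →ₗ[K] K))

instance : Module K (OpDual R K M) := inferInstanceAs (Module K (M →ₗ[K] K))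

/-- Scalar action `x ↦ op r • x` as a `K`-linear map. -/
def opSmulHom (r : R) : M →ₗ[K] M where
  toFun x := op r • x
  map_add' x y := smul_add _ x y
  map_smul' k x := smul_comm (op r) k x

/-- Reinterpret an element of the dual as a linear functional. -/
def OpDual.toL (f : OpDual R K M) : M →ₗ[K] K := f

lemma OpDual.toL_injective :
    Function.Injective (OpDual.toL R K M) := fun _ _ h => h

instance : SMul R (OpDual R K M) :=
  ⟨fun r f => ((OpDual.toL R K M f).comp (opSmulHom R K M r) : M →ₗ[K] K)⟩

lemma OpDual.smul_toL (r : R) (f : OpDual R K M) (x : M) :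
    OpDual.toL R K M (r • f) x = OpDual.toL R K M f (op r • x) := rfl

lemma OpDual.toL_add (f g : OpDual R K M) :
    OpDual.toL R K M (f + g) = OpDual.toL R K M f + OpDual.toL R K M g := rfl

lemma OpDual.toL_zero : OpDual.toL R K M 0 = 0 := rfl

instance : Module R (OpDual R K M) where
  one_smul f := OpDual.toL_injective R K M <| LinearMap.ext fun x => by
    rw [OpDual.smul_toL, op_one, one_smul]
  mul_smul r s f := OpDual.toL_injective R K M <| LinearMap.ext fun x => by
    rw [OpDual.smul_toL, OpDual.smul_toL, OpDual.smul_toL, op_mul, mul_smul]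
  smul_zero r := OpDual.toL_injective R K M <| LinearMap.ext fun x => by
    rw [OpDual.smul_toL, OpDual.toL_zero]; simp
  smul_add r f g := OpDual.toL_injective R K M <| LinearMap.ext fun x => by
    rw [OpDual.smul_toL, OpDual.toL_add]
    simp only [LinearMap.add_apply, OpDual.toL_add]
    rw [OpDual.smul_toL, OpDual.smul_toL]
  add_smul r s f := OpDual.toL_injective R K M <| LinearMap.ext fun x => by
    rw [OpDual.smul_toL]
    simp only [OpDual.toL_add, LinearMap.add_apply]
    rw [OpDual.smul_toL, OpDual.smul_toL, op_add, add_smul, map_add]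
  zero_smul f := OpDual.toL_injective R K M <| LinearMap.ext fun x => by
    rw [OpDual.smul_toL, OpDual.toL_zero, op_zero, zero_smul, map_zero]; rfl

instance : IsScalarTower K R (OpDual R K M) :=
  ⟨fun k r f => OpDual.toL_injective R K M <| LinearMap.ext fun x => by
    have h1 : OpDual.toL R K M ((k • r) • f) x = OpDual.toL R K M f (op (k • r) • x) := rfl
    have h2 : OpDual.toL R K M (k • (r • f)) x = k • OpDual.toL R K M f (op r • x) := rfl
    rw [h1, h2, op_smul, smul_assoc, map_smul]⟩

end OpDual

section LDual

variable (R : Type u) [Ring R] (K : Type u) [Field K] [Algebra K R]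
variable (M : Type u) [AddCommGroup M] [Module R M] [Module K M]
  [IsScalarTower K R M]

/-- The `K`-dual of a (finitely generated) `R`-module, as an `Rᵐᵒᵖ`-module:
this is the duality `D : mod Λ → mod Λᵒᵖ`. -/
def LDual (R : Type u) [Ring R] (K : Type u) [Field K] [Algebra K R]
    (M : Type u) [AddCommGroup M] [Module R M] [Module K M]
    [IsScalarTower K R M] : Type u := M →ₗ[K] K

instance : AddCommGroup (LDual R K M) := inferInstanceAs (AddCommGroup (M →ₗ[K] K))

instance : Module K (LDual R K M) := inferInstanceAs (Module K (M →ₗ[K] K))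

/-- Scalar action `x ↦ r • x` as a `K`-linear map. -/
def lSmulHom (r : R) : M →ₗ[K] M where
  toFun x := r • x
  map_add' x y := smul_add _ x y
  map_smul' k x := smul_comm r k x

/-- Reinterpret an element of the dual as a linear functional. -/
def LDual.toL (f : LDual R K M) : M →ₗ[K] K := f

lemma LDual.toL_injective : Function.Injective (LDual.toL R K M) := fun _ _ h => h

instance : SMul Rᵐᵒᵖ (LDual R K M) :=
  ⟨fun s f => ((LDual.toL R K M f).comp (lSmulHom R K M (unop s)) : M →ₗ[K] K)⟩

lemma LDual.smul_toL (s : Rᵐᵒᵖ) (f : LDual R K M) (x : M) :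
    LDual.toL R K M (s • f) x = LDual.toL R K M f (unop s • x) := rfl

lemma LDual.toL_add (f g : LDual R K M) :
    LDual.toL R K M (f + g) = LDual.toL R K M f + LDual.toL R K M g := rfl

lemma LDual.toL_zero : LDual.toL R K M 0 = 0 := rfl

instance : Module Rᵐᵒᵖ (LDual R K M) where
  one_smul f := LDual.toL_injective R K M <| LinearMap.ext fun x => by
    rw [LDual.smul_toL, unop_one, one_smul]
  mul_smul s t f := LDual.toL_injective R K M <| LinearMap.ext fun x => by
    rw [LDual.smul_toL, LDual.smul_toL, LDual.smul_toL, unop_mul, mul_smul]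
  smul_zero s := LDual.toL_injective R K M <| LinearMap.ext fun x => by
    rw [LDual.smul_toL, LDual.toL_zero]; simp
  smul_add s f g := LDual.toL_injective R K M <| LinearMap.ext fun x => by
    rw [LDual.smul_toL, LDual.toL_add]
    simp only [LinearMap.add_apply, LDual.toL_add]
    rw [LDual.smul_toL, LDual.smul_toL]
  add_smul s t f := LDual.toL_injective R K M <| LinearMap.ext fun x => by
    rw [LDual.smul_toL]
    simp only [LDual.toL_add, LinearMap.add_apply]
    rw [LDual.smul_toL, LDual.smul_toL, unop_add, add_smul, map_add]
  zero_smul f := LDual.toL_injective R K M <| LinearMap.ext fun x => by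
    rw [LDual.smul_toL, LDual.toL_zero, unop_zero, zero_smul, map_zero]; rfl

instance : IsScalarTower K Rᵐᵒᵖ (LDual R K M) :=
  ⟨fun k s f => LDual.toL_injective R K M <| LinearMap.ext fun x => by
    have h1 : LDual.toL R K M ((k • s) • f) x = LDual.toL R K M f (unop (k • s) • x) := rfl
    have h2 : LDual.toL R K M (k • (s • f)) x = k • LDual.toL R K M f (unop s • x) := rfl
    rw [h1, h2, unop_smul, smul_assoc, map_smul]⟩

end LDual

section GI

variable (R : Type u) [Ring R] (K : Type u) [Field K] [Algebra K R]

/-- `M` is Gorenstein injective: there is a doubly infinite exact sequence of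
finitely generated injective modules which stays exact under `Hom(DΛ, -)` and
such that `M ≅ Im (I₋₁ → I₀)`. Here `DΛ = OpDual R K R` is the `K`-dual of the
regular module. -/
def IsGI (M : Type u) [AddCommGroup M] [Module R M] : Prop :=
  ∃ (I : ℤ → Type u) (_ : ∀ n, AddCommGroup (I n)) (_ : ∀ n, Module R (I n))
    (d : ∀ n : ℤ, I n →ₗ[R] I (n + 1)),
    (∀ n, Module.Finite R (I n)) ∧
    (∀ n, Module.Injective R (I n)) ∧
    (∀ n, Function.Exact (d n) (d (n + 1))) ∧
    (∀ n, Function.Exact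
      (fun g : OpDual R K R →ₗ[R] I n => (d n).comp g)
      (fun g : OpDual R K R →ₗ[R] I (n + 1) => (d (n + 1)).comp g)) ∧
    Nonempty (M ≃ₗ[R] LinearMap.range (d (-1)))

end GI



section MinPres

variable (R : Type u) [Ring R]

/-- A minimal projective presentation `P₁ → P₀ → M → 0`. -/
structure MinPres (M : Type u) [AddCommGroup M] [Module R M] : Type (u + 1) where
  P₁ : Type u
  P₀ : Type u
  [acg₁ : AddCommGroup P₁]
  [acg₀ : AddCommGroup P₀]
  [mod₁ : Module R P₁]
  [mod₀ : Module R P₀]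
  fin₁ : Module.Finite R P₁
  fin₀ : Module.Finite R P₀
  proj₁ : Module.Projective R P₁
  proj₀ : Module.Projective R P₀
  d : P₁ →ₗ[R] P₀
  p : P₀ →ₗ[R] M
  surj : Function.Surjective p
  exact : Function.Exact d p
  min₀ : IsSuperfluous R (LinearMap.ker p)
  min₁ : IsSuperfluous R (LinearMap.ker d)

attribute [instance] MinPres.acg₁ MinPres.acg₀ MinPres.mod₁ MinPres.mod₀

variable {R}
variable {M : Type u} [AddCommGroup M] [Module R M] (pr : MinPres R M)

/-- The map `Hom(P₀, R) → Hom(P₁, R)` dual to `d`, as a map of `Rᵐᵒᵖ`-modules. -/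
def MinPres.dualMap : (pr.P₀ →ₗ[R] R) →ₗ[Rᵐᵒᵖ] (pr.P₁ →ₗ[R] R) where
  toFun g := g.comp pr.d
  map_add' g h := by ext x; simp
  map_smul' s g := by ext x; simp

/-- The transpose `Tr M = Coker (Hom(P₀, R) → Hom(P₁, R))`, an `Rᵐᵒᵖ`-module. -/
def MinPres.Tr : Type u := (pr.P₁ →ₗ[R] R) ⧸ LinearMap.range pr.dualMap

instance : AddCommGroup pr.Tr :=
  inferInstanceAs (AddCommGroup ((pr.P₁ →ₗ[R] R) ⧸ LinearMap.range pr.dualMap))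

instance : Module Rᵐᵒᵖ pr.Tr :=
  inferInstanceAs (Module Rᵐᵒᵖ ((pr.P₁ →ₗ[R] R) ⧸ LinearMap.range pr.dualMap))

/-- The canonical projection onto the transpose. -/
def MinPres.toTr (h : pr.P₁ →ₗ[R] R) : pr.Tr :=
  Submodule.Quotient.mk (p := LinearMap.range pr.dualMap) h

section TauDef

variable (K : Type u) [Field K] [Algebra K R]

instance : Module K pr.Tr :=
  inferInstanceAs (Module K ((pr.P₁ →ₗ[R] R) ⧸ LinearMap.range pr.dualMap))

instance : IsScalarTower K Rᵐᵒᵖ pr.Tr :=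
  inferInstanceAs
    (IsScalarTower K Rᵐᵒᵖ ((pr.P₁ →ₗ[R] R) ⧸ LinearMap.range pr.dualMap))

/-- The Auslander–Reiten translate `τM = D (Tr M)`, an `R`-module. -/
def MinPres.tau : Type u := OpDual R K pr.Tr

instance : AddCommGroup (pr.tau K) := inferInstanceAs (AddCommGroup (OpDual R K pr.Tr))

instance : Module R (pr.tau K) := inferInstanceAs (Module R (OpDual R K pr.Tr))

instance : Module K (pr.tau K) := inferInstanceAs (Module K (OpDual R K pr.Tr))

instance : IsScalarTower K R (pr.tau K) :=
  inferInstanceAs (IsScalarTower K R (OpDual R K pr.Tr))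

end TauDef

end MinPres

section Tau

variable (R : Type u) [Ring R] (K : Type u) [Field K] [Algebra K R]

/-- `M` is τ-rigid: `Hom(M, τM) = 0`. -/
def IsTauRigid (M : Type u) [AddCommGroup M] [Module R M] : Prop :=
  ∀ pr : MinPres R M, ∀ f : M →ₗ[R] pr.tau K, f = 0

/-- `N ∈ ⊥(τM)`, i.e. `Hom(N, τM) = 0`. -/
def InPerpTau (M : Type u) [AddCommGroup M] [Module R M]
    (N : Type u) [AddCommGroup N] [Module R N] : Prop :=
  ∀ pr : MinPres R M, ∀ f : N →ₗ[R] pr.tau K, f = 0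

/-- `M` is a τ-tilting module: τ-rigid with `|M| = |R|`. -/
def IsTauTilting (M : Type u) [AddCommGroup M] [Module R M] : Prop :=
  IsTauRigid R K M ∧ ∃ m l : ℕ, NumIndec R M m ∧ NumIndec R R l ∧ m = l

/-- `M` is τ⁻¹-rigid: `Hom(τ⁻¹M, M) = 0`, where `τ⁻¹M = Tr (D M)`.
A homomorphism `τ⁻¹M → M` is an additive map compatible with the identification
`R ≅ Rᵐᵒᵖᵐᵒᵖ` of scalars. -/
def IsTauInvRigid (M : Type u) [AddCommGroup M] [Module R M] [Module K M]
    [IsScalarTower K R M] : Prop :=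
  ∀ pr : MinPres Rᵐᵒᵖ (LDual R K M), ∀ f : pr.Tr →+ M,
    (∀ (r : R) (x : pr.Tr), f (op (op r) • x) = r • f x) → f = 0

/-- `M` is a τ⁻¹-tilting module. -/
def IsTauInvTilting (M : Type u) [AddCommGroup M] [Module R M] [Module K M]
    [IsScalarTower K R M] : Prop :=
  IsTauInvRigid R K M ∧ ∃ m l : ℕ, NumIndec R M m ∧ NumIndec R R l ∧ m = l

end Tau

section Pairs

variable (K : Type u) [Field K] (R : Type u) [Ring R] [Algebra K R]

/-- A pair `(M, P)` of finitely generated modules (with compatible `K`-structure). -/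
structure ModPair : Type (u + 1) where
  M : Type u
  [acgM : AddCommGroup M]
  [modM : Module R M]
  [modKM : Module K M]
  [towM : IsScalarTower K R M]
  finM : Module.Finite R M
  P : Type u
  [acgP : AddCommGroup P]
  [modP : Module R P]
  [modKP : Module K P]
  [towP : IsScalarTower K R P]
  finP : Module.Finite R P

attribute [instance] ModPair.acgM ModPair.modM ModPair.modKM ModPair.towM
attribute [instance] ModPair.acgP ModPair.modP ModPair.modKP ModPair.towP

variable {K R}

/-- Isomorphism of pairs. -/
def ModPair.Iso (x y : ModPair K R) : Prop :=
  Nonempty (x.M ≃ₗ[R] y.M) ∧ Nonempty (x.P ≃ₗ[R] y.P)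

variable (K R)

/-- The setoid of pairs satisfying a property `Q`, up to isomorphism. -/
def pairSetoid (Q : ModPair K R → Prop) : Setoid {x : ModPair K R // Q x} where
  r a b := ModPair.Iso a.1 b.1
  iseqv := by
    constructor
    · exact fun a => ⟨⟨LinearEquiv.refl R a.1.M⟩, ⟨LinearEquiv.refl R a.1.P⟩⟩
    · rintro a b ⟨⟨e⟩, ⟨e'⟩⟩; exact ⟨⟨e.symm⟩, ⟨e'.symm⟩⟩
    · rintro a b c ⟨⟨e⟩, ⟨e'⟩⟩ ⟨⟨f⟩, ⟨f'⟩⟩; exact ⟨⟨e.trans f⟩, ⟨e'.trans f'⟩⟩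

/-- `(M, P)` is a τ-rigid pair: `M` is τ-rigid, `P` is projective and `Hom(P, M) = 0`. -/
def IsTauRigidPair (x : ModPair K R) : Prop :=
  IsTauRigid R K x.M ∧ Module.Projective R x.P ∧ ∀ f : x.P →ₗ[R] x.M, f = 0

/-- A Gorenstein projective τ-rigid pair. -/
def IsGPTauRigidPair (x : ModPair K R) : Prop :=
  IsTauRigidPair K R x ∧ IsGP R x.M

/-- A support τ-tilting pair: a τ-rigid pair with `|M| + |P| = |R|`. -/
def IsSuppTauTiltingPair (x : ModPair K R) : Prop :=
  IsTauRigidPair K R x ∧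
    ∃ m p l : ℕ, NumIndec R x.M m ∧ NumIndec R x.P p ∧ NumIndec R R l ∧ m + p = l

/-- A Gorenstein projective support τ-tilting pair. -/
def IsGPSuppTauTiltingPair (x : ModPair K R) : Prop :=
  IsSuppTauTiltingPair K R x ∧ IsGP R x.M

/-- `(I, N)` is a τ⁻¹-rigid pair; here `x.M = N` is the module and `x.P = I` is
injective, with `Hom(N, I) = 0`. -/
def IsTauInvRigidPair (x : ModPair K R) : Prop :=
  IsTauInvRigid R K x.M ∧ Module.Injective R x.P ∧ ∀ f : x.M →ₗ[R] x.P, f = 0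

/-- A Gorenstein injective τ⁻¹-rigid pair. -/
def IsGITauInvRigidPair (x : ModPair K R) : Prop :=
  IsTauInvRigidPair K R x ∧ IsGI R K x.M

/-- A support τ⁻¹-tilting pair: a τ⁻¹-rigid pair with `|N| + |I| = |R|`. -/
def IsSuppTauInvTiltingPair (x : ModPair K R) : Prop :=
  IsTauInvRigidPair K R x ∧
    ∃ m p l : ℕ, NumIndec R x.M m ∧ NumIndec R x.P p ∧ NumIndec R R l ∧ m + p = l

/-- A Gorenstein injective support τ⁻¹-tilting pair. -/
def IsGISuppTauInvTiltingPair (x : ModPair K R) : Prop :=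
  IsSuppTauInvTiltingPair K R x ∧ IsGI R K x.M

/-- A basic pair. -/
def IsBasicPair (x : ModPair K R) : Prop := IsBasic R x.M ∧ IsBasic R x.P

/-- `y` is (a representative of) the dagger `(M, P)† = (Tr M_np ⊕ P*, M_p*)` of `x`,
where `M = M_p ⊕ M_np` with `M_p` a maximal projective direct summand. -/
def IsDaggerOf (x : ModPair K R) (y : ModPair K Rᵐᵒᵖ) : Prop :=
  ∃ Mp Mnp : Submodule R x.M, IsCompl Mp Mnp ∧ Module.Projective R Mp ∧
    NoProjSummand R Mnp ∧
    ∃ pr : MinPres R Mnp,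
      Nonempty (y.M ≃ₗ[Rᵐᵒᵖ] (pr.Tr × (x.P →ₗ[R] R))) ∧
      Nonempty (y.P ≃ₗ[Rᵐᵒᵖ] (Mp →ₗ[R] R))

/-- `y` is (a representative of) `D((M, P)†)`, the Gorenstein injective pair
`(D(M_p*), D(Tr M_np ⊕ P*))` associated to `x`; in our convention `y.M` is the
τ⁻¹-rigid module `D(Tr M_np ⊕ P*)` and `y.P` is the injective module `D(M_p*)`. -/
def IsDDaggerOf (x : ModPair K R) (y : ModPair K R) : Prop :=
  ∃ z : ModPair K Rᵐᵒᵖ, IsDaggerOf K R x z ∧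
    Nonempty (y.M ≃ₗ[R] OpDual R K z.M) ∧ Nonempty (y.P ≃ₗ[R] OpDual R K z.P)

end Pairs

section Support

variable (R : Type u) [Ring R] (K : Type u) [Field K] [Algebra K R]

/-- `φ : R →+* S` realizes `S` as the quotient of `R` by the two-sided ideal
generated by `e` (universal property). -/
def IsQuotientByIdem (e : R) (S : Type u) [Ring S] (φ : R →+* S) : Prop :=
  Function.Surjective φ ∧ φ e = 0 ∧
    ∀ (S' : Type u) (_ : Ring S') (ψ : R →+* S'), ψ e = 0 → ∃ χ : S →+* S', χ.comp φ = ψ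

/-- `M` is a support τ-tilting module: `M` is a τ-tilting module over `Λ/(e)` for
some idempotent `e`. -/
def IsSuppTauTilting (M : Type u) [AddCommGroup M] [Module R M] : Prop :=
  ∃ e : R, IsIdempotentElem e ∧
    ∃ (S : Type u) (_ : Ring S) (_ : Algebra K S) (φ : R →+* S),
      (∀ k : K, φ (algebraMap K R k) = algebraMap K S k) ∧
      IsQuotientByIdem R e S φ ∧
      ∃ _ : Module S M, (∀ (r : R) (m : M), φ r • m = r • m) ∧ IsTauTilting S K M

/-- `M` is a support τ⁻¹-tilting module: `M` is a τ⁻¹-tilting module over `Λ/(e)`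
for some idempotent `e`. -/
def IsSuppTauInvTilting (M : Type u) [AddCommGroup M] [Module R M] [Module K M] : Prop :=
  ∃ e : R, IsIdempotentElem e ∧
    ∃ (S : Type u) (_ : Ring S) (_ : Algebra K S) (φ : R →+* S),
      (∀ k : K, φ (algebraMap K R k) = algebraMap K S k) ∧
      IsQuotientByIdem R e S φ ∧
      ∃ _ : Module S M, (∀ (r : R) (m : M), φ r • m = r • m) ∧
        ∃ _ : IsScalarTower K S M, IsTauInvTilting S K M

end Support

section Torsion

variable (R : Type u) [Ring R]

/-- A class of modules is closed under isomorphism. -/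
def RespectsIso (T : ModuleCat.{u} R → Prop) : Prop :=
  ∀ X Y : ModuleCat.{u} R, Nonempty (X ≃ₗ[R] Y) → T X → T Y

/-- `(T, F)` is a torsion pair in the category of finitely generated `R`-modules. -/
def IsTorsionPair (T F : ModuleCat.{u} R → Prop) : Prop :=
  RespectsIso R T ∧ RespectsIso R F ∧
  (∀ X, T X → Module.Finite R X) ∧ (∀ X, F X → Module.Finite R X) ∧
  (∀ X Y : ModuleCat.{u} R, T X → F Y → ∀ f : X →ₗ[R] Y, f = 0) ∧
  (∀ X : ModuleCat.{u} R, Module.Finite R X →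
    ∃ t : Submodule R X, T (ModuleCat.of R t) ∧ F (ModuleCat.of R (X ⧸ t)))

/-- `T` is covariantly finite: every finitely generated module admits a left
`T`-approximation. -/
def CovariantlyFinite (T : ModuleCat.{u} R → Prop) : Prop :=
  ∀ X : ModuleCat.{u} R, Module.Finite R X →
    ∃ (M : ModuleCat.{u} R) (f : X →ₗ[R] M), T M ∧
      ∀ (M' : ModuleCat.{u} R) (g : X →ₗ[R] M'), T M' → ∃ h : M →ₗ[R] M', h.comp f = g

/-- `T` is contravariantly finite: every finitely generated module admits a right
`T`-approximation. -/
def ContravariantlyFinite (T : ModuleCat.{u} R → Prop) : Prop :=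
  ∀ X : ModuleCat.{u} R, Module.Finite R X →
    ∃ (M : ModuleCat.{u} R) (f : M →ₗ[R] X), T M ∧
      ∀ (M' : ModuleCat.{u} R) (g : M' →ₗ[R] X), T M' → ∃ h : M' →ₗ[R] M, f.comp h = g

/-- A functorially finite class. -/
def FunctoriallyFinite (T : ModuleCat.{u} R → Prop) : Prop :=
  CovariantlyFinite R T ∧ ContravariantlyFinite R T

/-- `G` is the basic Ext-projective generator of the torsion class `T`:
`G ∈ T` is basic, Ext-projective in `T`, `T = Fac G`, and every Ext-projective
module in `T` lies in `add G`. -/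
def IsBasicExtProjGen (T : ModuleCat.{u} R → Prop) (G : ModuleCat.{u} R) : Prop :=
  T G ∧ IsBasic R G ∧ (∀ X : ModuleCat.{u} R, T X → Ext1Vanishes R G X) ∧
  (∀ X : ModuleCat.{u} R, T X ↔ (Module.Finite R X ∧ FacOf R G X)) ∧
  (∀ X : ModuleCat.{u} R, T X → (∀ Y : ModuleCat.{u} R, T Y → Ext1Vanishes R X Y) →
    InAdd R G X)

/-- `C` is the basic Ext-injective cogenerator of the torsion-free class `F`:
`C ∈ F` is basic, Ext-injective in `F`, `F = Sub C`, and every Ext-injective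
module in `F` lies in `add C`. -/
def IsBasicExtInjCogen (F : ModuleCat.{u} R → Prop) (C : ModuleCat.{u} R) : Prop :=
  F C ∧ IsBasic R C ∧ (∀ X : ModuleCat.{u} R, F X → Ext1Vanishes R X C) ∧
  (∀ X : ModuleCat.{u} R, F X ↔ (Module.Finite R X ∧ SubOf R C X)) ∧
  (∀ X : ModuleCat.{u} R, F X → (∀ Y : ModuleCat.{u} R, F Y → Ext1Vanishes R Y X) →
    InAdd R C X)

variable (K : Type u) [Field K] [Algebra K R]

/-- A (functorially finite) Gorenstein torsion pair: the basic Ext-projective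
generator of `T` is Gorenstein projective. -/
def IsGorensteinTP (T F : ModuleCat.{u} R → Prop) : Prop :=
  IsTorsionPair R T F ∧ FunctoriallyFinite R T ∧
    ∀ G : ModuleCat.{u} R, IsBasicExtProjGen R T G → IsGP R G

/-- A trivial torsion pair: the basic Ext-projective generator of `T` is projective. -/
def IsTrivialTP (T F : ModuleCat.{u} R → Prop) : Prop :=
  IsTorsionPair R T F ∧ FunctoriallyFinite R T ∧
    ∀ G : ModuleCat.{u} R, IsBasicExtProjGen R T G → Module.Projective R G

end Torsion

section Misc

variable (R : Type u) [Ring R] (K : Type u) [Field K] [Algebra K R]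

/-- A projective cover `π : P → M`. -/
structure ProjCover (M : Type u) [AddCommGroup M] [Module R M] : Type (u + 1) where
  P : Type u
  [acg : AddCommGroup P]
  [mod : Module R P]
  fin : Module.Finite R P
  proj : Module.Projective R P
  π : P →ₗ[R] M
  surj : Function.Surjective π
  min : IsSuperfluous R (LinearMap.ker π)

attribute [instance] ProjCover.acg ProjCover.mod

/-- The canonical evaluation map `M → M** = Hom_{Rᵐᵒᵖ}(Hom_R(M, R), Rᵐᵒᵖ)`. -/
def bidualEval (M : Type u) [AddCommGroup M] [Module R M] (m : M) :
    (M →ₗ[R] R) →ₗ[Rᵐᵒᵖ] Rᵐᵒᵖ where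
  toFun f := op (f m)
  map_add' f g := by simp
  map_smul' s f := rfl

/-- `R` is CM-τ-tilting finite: up to isomorphism there are only finitely many
indecomposable Gorenstein projective τ-rigid modules. -/
def CMTauTiltingFinite : Prop :=
  ∃ (n : ℕ) (V : Fin n → ModuleCat.{u} R),
    ∀ (M : Type u) [AddCommGroup M] [Module R M], Module.Finite R M →
      IsIndec R M → IsGP R M → IsTauRigid R K M → ∃ i, Nonempty (M ≃ₗ[R] V i)

/-- `R` is CM-finite: up to isomorphism there are only finitely many
indecomposable Gorenstein projective modules. -/
def CMFinite : Prop :=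
  ∃ (n : ℕ) (V : Fin n → ModuleCat.{u} R),
    ∀ (M : Type u) [AddCommGroup M] [Module R M], Module.Finite R M →
      IsIndec R M → IsGP R M → ∃ i, Nonempty (M ≃ₗ[R] V i)

/-- `T` is the Bongartz completion of the τ-rigid module `M`: the basic
Ext-projective generator of `⊥(τM)`, with `⊥(τM) = Fac T`. -/
def IsBongartzCompletion (M : Type u) [AddCommGroup M] [Module R M]
    (T : Type u) [AddCommGroup T] [Module R T] : Prop :=
  Module.Finite R T ∧ IsBasic R T ∧ InPerpTau R K M T ∧
  (∀ (X : Type u) [AddCommGroup X] [Module R X], Module.Finite R X →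
    InPerpTau R K M X → Ext1Vanishes R T X) ∧
  (∀ (X : Type u) [AddCommGroup X] [Module R X], Module.Finite R X →
    (InPerpTau R K M X ↔ FacOf R T X))

end Misc

section ExtOne

variable {R : Type u} [Ring R]

lemma exists_section_iff_exists_retraction {X Y E : Type u} [AddCommGroup X] [Module R X]
    [AddCommGroup Y] [Module R Y] [AddCommGroup E] [Module R E] {i : Y →ₗ[R] E} {p : E →ₗ[R] X}
    (hi : Injective i) (hp : Surjective p) (h : Function.Exact i p) :
    (∃ s : X →ₗ[R] E, p.comp s = LinearMap.id) ↔ ∃ r : E →ₗ[R] Y, r.comp i = LinearMap.id := by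
  have key : (Injective i ∧ ∃ s : X →ₗ[R] E, p.comp s = LinearMap.id) ↔
      (Surjective p ∧ ∃ r : E →ₗ[R] Y, r.comp i = LinearMap.id) := h.split_tfae'.out 0 1
  exact ⟨fun hs => (key.1 ⟨hi, hs⟩).2, fun hr => (key.2 ⟨hp, hr⟩).2⟩

/-- Vanishing of `Ext¹(X, Y)` allows lifting of maps out of `X` along maps with kernel `Y`. -/
lemma Ext1Vanishes.lift {X Y E Z : Type u} [AddCommGroup X] [Module R X]
    [AddCommGroup Y] [Module R Y] [AddCommGroup E] [Module R E] [AddCommGroup Z] [Module R Z]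
    (h : Ext1Vanishes R X Y) (i : Y →ₗ[R] E) (p : E →ₗ[R] Z) (hi : Injective i)
    (hip : Function.Exact i p) (g : X →ₗ[R] Z) (hg : ∀ x, ∃ e, p e = g x) :
    ∃ s : X →ₗ[R] E, p.comp s = g := by
  let W : Submodule R (E × X) := LinearMap.eqLocus (p.comp (LinearMap.fst R E X))
    (g.comp (LinearMap.snd R E X))
  have hW : ∀ w : W, p w.1.1 = g w.1.2 := fun w => w.2
  let i' : Y →ₗ[R] W := (LinearMap.inl R E X ∘ₗ i).codRestrict W fun y => by
    change p (i y) = g 0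
    rw [map_zero]; exact (hip _).2 ⟨y, rfl⟩
  let p' : W →ₗ[R] X := LinearMap.snd R E X ∘ₗ W.subtype
  obtain ⟨s, hs⟩ := h W i' p' (fun a b hab => hi (congrArg (fun w : W => w.1.1) hab))
    (fun x => by
      obtain ⟨e, he⟩ := hg x
      exact ⟨⟨(e, x), he⟩, rfl⟩)
    (fun w => by
      constructor
      · intro hw
        have h0 : w.1.2 = 0 := hw
        have h1 : p w.1.1 = 0 := by rw [hW w, h0, map_zero]
        obtain ⟨y, hy⟩ := (hip _).1 h1
        exact ⟨y, Subtype.ext (Prod.ext hy h0.symm)⟩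
      · rintro ⟨y, rfl⟩
        rfl)
  refine ⟨LinearMap.fst R E X ∘ₗ W.subtype ∘ₗ s, LinearMap.ext fun x => ?_⟩
  have := LinearMap.congr_fun hs x
  change p (s x).1.1 = g x
  rw [hW]
  exact congrArg g this

/-- Vanishing of `Ext¹(X, Y)` allows extension of maps into `Y` along maps with cokernel `X`. -/
lemma Ext1Vanishes.extend {X Y A B : Type u} [AddCommGroup X] [Module R X]
    [AddCommGroup Y] [Module R Y] [AddCommGroup A] [Module R A] [AddCommGroup B] [Module R B]
    (h : Ext1Vanishes R X Y) (i : A →ₗ[R] B) (p : B →ₗ[R] X) (hi : Injective i)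
    (hp : Surjective p) (hip : Function.Exact i p) (f : A →ₗ[R] Y) :
    ∃ g : B →ₗ[R] Y, g.comp i = f := by
  let N : Submodule R (Y × B) := LinearMap.range ((-f).prod i)
  let j : Y →ₗ[R] (Y × B) ⧸ N := N.mkQ ∘ₗ LinearMap.inl R Y B
  let q : ((Y × B) ⧸ N) →ₗ[R] X := N.liftQ (p ∘ₗ LinearMap.snd R Y B) (by
    rintro _ ⟨a, rfl⟩
    exact (hip _).2 ⟨a, rfl⟩)
  have hj : Injective j := by
    rw [← LinearMap.ker_eq_bot, LinearMap.ker_eq_bot']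
    intro y hy
    obtain ⟨a, ha⟩ := (Submodule.Quotient.mk_eq_zero N).1 hy
    have h2 : i a = 0 := congrArg Prod.snd ha
    have h1 : -f a = y := congrArg Prod.fst ha
    rw [← h1, hi (h2.trans (map_zero i).symm), map_zero, neg_zero]
  have hq : Surjective q := fun x => by
    obtain ⟨b, rfl⟩ := hp x
    exact ⟨N.mkQ (0, b), rfl⟩
  have hjq : Function.Exact j q := by
    intro w
    constructor
    · obtain ⟨⟨y, b⟩, rfl⟩ := N.mkQ_surjective w
      intro hw
      obtain ⟨a, rfl⟩ := (hip b).1 hw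
      refine ⟨y + f a, ?_⟩
      refine (Submodule.Quotient.eq N).2 ⟨-a, Prod.ext ?_ ?_⟩
      · simp
      · simp
    · rintro ⟨y, rfl⟩
      exact map_zero p
  obtain ⟨r, hr⟩ := (exists_section_iff_exists_retraction hj hq hjq).1 (h _ j q hj hq hjq)
  refine ⟨r ∘ₗ N.mkQ ∘ₗ LinearMap.inr R Y B, LinearMap.ext fun a => ?_⟩
  have h1 : N.mkQ (0, i a) = N.mkQ (f a, 0) :=
    (Submodule.Quotient.eq N).2 ⟨a, Prod.ext (by simp) (by simp)⟩
  change r (N.mkQ (0, i a)) = f a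
  rw [h1]
  exact LinearMap.congr_fun hr (f a)

lemma InAdd.refl (G : Type u) [AddCommGroup G] [Module R G] : InAdd R G G :=
  ⟨1, LinearMap.pi fun _ => LinearMap.id, LinearMap.proj 0, rfl⟩

/-- Modules which are retracts of `Fin n → G`, given by families of maps. -/
lemma InAdd.of_sum {G X : Type u} [AddCommGroup G] [Module R G] [AddCommGroup X] [Module R X]
    {ι : Type} [Fintype ι] (a : ι → X →ₗ[R] G) (b : ι → G →ₗ[R] X)
    (h : ∀ x, ∑ k, b k (a k x) = x) : InAdd R G X := by
  classical
  let e := Fintype.equivFin ι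
  refine ⟨Fintype.card ι, LinearMap.pi fun k => a (e.symm k),
    ∑ k, b (e.symm k) ∘ₗ LinearMap.proj k, LinearMap.ext fun x => ?_⟩
  simp only [LinearMap.comp_apply, LinearMap.sum_apply, LinearMap.proj_apply,
    LinearMap.pi_apply, LinearMap.id_apply]
  rw [← h x, e.symm.sum_comp (fun k => b k (a k _)), h, h]

lemma InAdd.exists_sum {G X : Type u} [AddCommGroup G] [Module R G]
    [AddCommGroup X] [Module R X] (h : InAdd R G X) :
    ∃ (n : ℕ) (a : Fin n → X →ₗ[R] G) (b : Fin n → G →ₗ[R] X), ∀ x, ∑ k, b k (a k x) = x := by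
  classical
  obtain ⟨n, i, p, hip⟩ := h
  refine ⟨n, fun k => LinearMap.proj k ∘ₗ i, fun k => p ∘ₗ LinearMap.single R (fun _ => G) k, fun x => ?_⟩
  have := LinearMap.congr_fun hip x
  simp only [LinearMap.comp_apply, LinearMap.id_apply] at this
  conv_rhs => rw [← this]
  simp only [LinearMap.comp_apply, LinearMap.proj_apply, LinearMap.single_apply]
  rw [← map_sum, Finset.univ_sum_single]

lemma InAdd.trans {G X Y : Type u} [AddCommGroup G] [Module R G] [AddCommGroup X] [Module R X]
    [AddCommGroup Y] [Module R Y] (h₁ : InAdd R G X) (h₂ : InAdd R X Y) : InAdd R G Y := by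
  obtain ⟨n, a, b, h⟩ := h₁.exists_sum
  obtain ⟨m, a', b', h'⟩ := h₂.exists_sum
  refine InAdd.of_sum (ι := Fin m × Fin n) (fun k => a k.2 ∘ₗ a' k.1) (fun k => b' k.1 ∘ₗ b k.2)
    fun x => ?_
  rw [Fintype.sum_prod_type]
  simp only [LinearMap.comp_apply, ← map_sum, h, h']

lemma InAdd.of_retract {G X : Type u} [AddCommGroup G] [Module R G] [AddCommGroup X]
    [Module R X] (i : X →ₗ[R] G) (p : G →ₗ[R] X) (h : ∀ x, p (i x) = x) : InAdd R G X :=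
  InAdd.of_sum (ι := Unit) (fun _ => i) (fun _ => p) (by simpa using h)

lemma InAdd.finite {G X : Type u} [AddCommGroup G] [Module R G] [AddCommGroup X]
    [Module R X] (h : InAdd R G X) [Module.Finite R G] : Module.Finite R X := by
  obtain ⟨n, i, p, hip⟩ := h
  exact Module.Finite.of_surjective p fun x => ⟨i x, LinearMap.congr_fun hip x⟩

lemma InAdd.projective {G X : Type u} [AddCommGroup G] [Module R G] [AddCommGroup X]
    [Module R X] (h : InAdd R G X) [Module.Projective R G] : Module.Projective R X := by
  obtain ⟨n, i, p, hip⟩ := h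
  have : Module.Projective R (Fin n → G) :=
    Module.Projective.of_equiv (DFinsupp.linearEquivFunOnFintype (R := R) (M := fun _ : Fin n => G))
  exact Module.Projective.of_split i p hip

lemma injective_of_retract {G X : Type u} [AddCommGroup G] [Module R G] [AddCommGroup X]
    [Module R X] [hG : Module.Injective R G] (i : X →ₗ[R] G) (p : G →ₗ[R] X)
    (h : ∀ x, p (i x) = x) : Module.Injective R X :=
  ⟨fun A B _ _ _ _ f hf g => by
    obtain ⟨q, hq⟩ := hG.out f hf (i ∘ₗ g)
    exact ⟨p ∘ₗ q, fun x => by rw [LinearMap.comp_apply, hq, LinearMap.comp_apply, h]⟩⟩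

lemma InAdd.injective {G X : Type u} [AddCommGroup G] [Module R G] [AddCommGroup X]
    [Module R X] (h : InAdd R G X) [hG : Module.Injective R G] : Module.Injective R X := by
  obtain ⟨n, i, p, hip⟩ := h
  have : Module.Injective R (Fin n → G) := ⟨fun A B _ _ _ _ f hf g => by
    choose q hq using fun k => hG.out f hf (LinearMap.proj k ∘ₗ g)
    exact ⟨LinearMap.pi q, fun x => funext fun k => hq k x⟩⟩
  exact injective_of_retract i p (LinearMap.congr_fun hip)

lemma InAdd.ext1Vanishes_left {G X Y : Type u} [AddCommGroup G] [Module R G] [AddCommGroup X]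
    [Module R X] [AddCommGroup Y] [Module R Y] (h : InAdd R G X) (hG : Ext1Vanishes R G Y) :
    Ext1Vanishes R X Y := by
  obtain ⟨n, a, b, h⟩ := h.exists_sum
  intro E _ _ i p hi hp hip
  choose s hs using fun k => hG.lift i p hi hip (b k) (fun x => hp _)
  refine ⟨∑ k, s k ∘ₗ a k, LinearMap.ext fun x => ?_⟩
  simp only [LinearMap.comp_apply, LinearMap.sum_apply, map_sum, LinearMap.id_apply]
  rw [← h x]
  refine Finset.sum_congr rfl fun k _ => ?_
  rw [h]
  exact LinearMap.congr_fun (hs k) _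

/-- Extensions split as soon as the kernel is a retract. -/
lemma Ext1Vanishes.of_retraction {X Y : Type u} [AddCommGroup X]
    [Module R X] [AddCommGroup Y] [Module R Y]
    (h : ∀ (E : Type u) [AddCommGroup E] [Module R E] (i : Y →ₗ[R] E) (p : E →ₗ[R] X),
      Injective i → Surjective p → Function.Exact i p → ∃ r : E →ₗ[R] Y, r.comp i = LinearMap.id) :
    Ext1Vanishes R X Y := by
  intro E _ _ i p hi hp hip
  exact (exists_section_iff_exists_retraction hi hp hip).2 (h E i p hi hp hip)

lemma InAdd.ext1Vanishes_right {G X Y : Type u} [AddCommGroup G] [Module R G] [AddCommGroup X]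
    [Module R X] [AddCommGroup Y] [Module R Y] (h : InAdd R G Y) (hG : Ext1Vanishes R X G) :
    Ext1Vanishes R X Y := by
  obtain ⟨n, a, b, h⟩ := h.exists_sum
  refine .of_retraction fun E _ _ i p hi hp hip => ?_
  choose s hs using fun k => hG.extend i p hi hp hip (a k)
  refine ⟨∑ k, b k ∘ₗ s k, LinearMap.ext fun x => ?_⟩
  simp only [LinearMap.comp_apply, LinearMap.sum_apply, LinearMap.id_apply]
  conv_rhs => rw [← h x]
  exact Finset.sum_congr rfl fun k _ => congrArg _ (LinearMap.congr_fun (hs k) x)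

end ExtOne

section Factor

variable {R : Type u} [Ring R] {A B C : Type u} [AddCommGroup A] [Module R A]
  [AddCommGroup B] [Module R B] [AddCommGroup C] [Module R C]

lemma exists_factor_of_surjective (f : A →ₗ[R] B) (hf : Surjective f) (g : A →ₗ[R] C)
    (h : ∀ a, f a = 0 → g a = 0) : ∃ k : B →ₗ[R] C, ∀ a, k (f a) = g a :=
  ⟨(LinearMap.ker f).liftQ g (fun a ha => h a ha) ∘ₗ (f.quotKerEquivOfSurjective hf).symm.toLinearMap,
    fun a => by
      have : (f.quotKerEquivOfSurjective hf).symm (f a) = (LinearMap.ker f).mkQ a :=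
        (LinearEquiv.symm_apply_eq _).2 rfl
      rw [LinearMap.comp_apply, LinearEquiv.coe_coe, this]
      rfl⟩

lemma exists_factor_of_injective (i : B →ₗ[R] C) (hi : Injective i) (g : A →ₗ[R] C)
    (h : ∀ a, ∃ b, i b = g a) : ∃ k : A →ₗ[R] B, ∀ a, i (k a) = g a :=
  ⟨(LinearEquiv.ofInjective i hi).symm.toLinearMap ∘ₗ g.codRestrict (LinearMap.range i) h,
    fun a => congrArg Subtype.val ((LinearEquiv.ofInjective i hi).apply_symm_apply
      (g.codRestrict (LinearMap.range i) h a))⟩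

end Factor

section TorsionPair

variable {R : Type u} [Ring R] {T F : ModuleCat.{u} R → Prop}

lemma IsTorsionPair.torsion_iff (h : IsTorsionPair R T F) (X : Type u) [AddCommGroup X]
    [Module R X] : T (ModuleCat.of R X) ↔ Module.Finite R X ∧
      ∀ (Y : Type u) [AddCommGroup Y] [Module R Y], F (ModuleCat.of R Y) →
        ∀ f : X →ₗ[R] Y, f = 0 := by
  obtain ⟨hT, hF, hTf, hFf, hom, ex⟩ := h
  constructor
  · intro hX
    exact ⟨hTf _ hX, fun Y _ _ hY f => hom (ModuleCat.of R X) (ModuleCat.of R Y) hX hY f⟩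
  · rintro ⟨hX, h0⟩
    obtain ⟨t, ht, ht'⟩ := ex (ModuleCat.of R X) hX
    have : t = ⊤ := by
      have := h0 _ ht' t.mkQ
      rw [eq_top_iff]
      intro x _
      exact (Submodule.Quotient.mk_eq_zero t).1 (LinearMap.congr_fun this x)
    subst this
    exact hT _ _ ⟨Submodule.topEquiv⟩ ht

lemma IsTorsionPair.torsionFree_iff (h : IsTorsionPair R T F) (X : Type u) [AddCommGroup X]
    [Module R X] : F (ModuleCat.of R X) ↔ Module.Finite R X ∧
      ∀ (Y : Type u) [AddCommGroup Y] [Module R Y], T (ModuleCat.of R Y) →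
        ∀ f : Y →ₗ[R] X, f = 0 := by
  obtain ⟨hT, hF, hTf, hFf, hom, ex⟩ := h
  constructor
  · intro hX
    exact ⟨hFf _ hX, fun Y _ _ hY f => hom (ModuleCat.of R Y) (ModuleCat.of R X) hY hX f⟩
  · rintro ⟨hX, h0⟩
    obtain ⟨t, ht, ht'⟩ := ex (ModuleCat.of R X) hX
    have : t = ⊥ := by
      have := h0 _ ht t.subtype
      rw [eq_bot_iff]
      intro x hx
      exact LinearMap.congr_fun this ⟨x, hx⟩
    subst this
    exact hF _ _ ⟨Submodule.quotEquivOfEqBot ⊥ rfl⟩ ht'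

lemma IsTorsionPair.hom_eq_zero (h : IsTorsionPair R T F) {X Y : Type u} [AddCommGroup X]
    [Module R X] [AddCommGroup Y] [Module R Y] (hX : T (ModuleCat.of R X))
    (hY : F (ModuleCat.of R Y)) (f : X →ₗ[R] Y) (x : X) : f x = 0 :=
  LinearMap.congr_fun (((h.torsion_iff X).1 hX).2 Y hY f) x

lemma IsTorsionPair.torsion_of_surjective (h : IsTorsionPair R T F) {X Y : Type u}
    [AddCommGroup X] [Module R X] [AddCommGroup Y] [Module R Y] (hX : T (ModuleCat.of R X))
    (p : X →ₗ[R] Y) (hp : Surjective p) : T (ModuleCat.of R Y) := by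
  have := ((h.torsion_iff X).1 hX).1
  refine (h.torsion_iff Y).2 ⟨Module.Finite.of_surjective p hp, fun Z _ _ hZ f => ?_⟩
  refine LinearMap.ext fun y => ?_
  obtain ⟨x, rfl⟩ := hp y
  exact h.hom_eq_zero hX hZ (f ∘ₗ p) x

lemma IsTorsionPair.torsionFree_of_injective [IsNoetherianRing R] (h : IsTorsionPair R T F)
    {X Y : Type u} [AddCommGroup X] [Module R X] [AddCommGroup Y] [Module R Y]
    (hX : F (ModuleCat.of R X)) (i : Y →ₗ[R] X) (hi : Injective i) : F (ModuleCat.of R Y) := by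
  have := ((h.torsionFree_iff X).1 hX).1
  refine (h.torsionFree_iff Y).2 ⟨Module.Finite.of_injective i hi, fun Z _ _ hZ f => ?_⟩
  exact LinearMap.ext fun z => hi ((h.hom_eq_zero hZ hX (i ∘ₗ f) z).trans (map_zero i).symm)

lemma IsTorsionPair.torsion_of_exact (h : IsTorsionPair R T F) {X Y E : Type u}
    [AddCommGroup X] [Module R X] [AddCommGroup Y] [Module R Y] [AddCommGroup E] [Module R E]
    (hY : T (ModuleCat.of R Y)) (hX : T (ModuleCat.of R X)) (i : Y →ₗ[R] E) (p : E →ₗ[R] X)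
    (hp : Surjective p) (hip : Function.Exact i p) : T (ModuleCat.of R E) := by
  have h1 := ((h.torsion_iff X).1 hX).1
  have h2 := ((h.torsion_iff Y).1 hY).1
  refine (h.torsion_iff E).2 ⟨?_, fun Z _ _ hZ f => ?_⟩
  · have : Module.Finite R (LinearMap.ker p) := by
      rw [LinearMap.exact_iff.1 hip]; infer_instance
    have : Module.Finite R (E ⧸ LinearMap.ker p) :=
      Module.Finite.equiv (p.quotKerEquivOfSurjective hp).symm
    exact Module.Finite.of_submodule_quotient (LinearMap.ker p)
  · obtain ⟨k, hk⟩ := exists_factor_of_surjective p hp f (fun e he => by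
      obtain ⟨y, rfl⟩ := (hip e).1 he
      exact h.hom_eq_zero hY hZ (f ∘ₗ i) y)
    exact LinearMap.ext fun e => by rw [← hk, h.hom_eq_zero hX hZ k]; rfl

lemma IsTorsionPair.torsion_prod (h : IsTorsionPair R T F) {X Y : Type u}
    [AddCommGroup X] [Module R X] [AddCommGroup Y] [Module R Y]
    (hX : T (ModuleCat.of R X)) (hY : T (ModuleCat.of R Y)) : T (ModuleCat.of R (X × Y)) :=
  h.torsion_of_exact hX hY (LinearMap.inl R X Y) (LinearMap.snd R X Y) Prod.snd_surjective
    Function.Exact.inl_snd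

lemma IsTorsionPair.torsion_pi (h : IsTorsionPair R T F) {X : Type u}
    [AddCommGroup X] [Module R X] (hX : T (ModuleCat.of R X)) (n : ℕ) :
    T (ModuleCat.of R (Fin n → X)) := by
  have h1 := ((h.torsion_iff X).1 hX).1
  refine (h.torsion_iff _).2 ⟨inferInstance, fun Z _ _ hZ f => LinearMap.pi_ext' fun k => ?_⟩
  exact LinearMap.ext fun x =>
    h.hom_eq_zero hX hZ (f ∘ₗ LinearMap.single R (fun _ : Fin n => X) k) x

lemma IsTorsionPair.torsionFree_pi (h : IsTorsionPair R T F) {X : Type u}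
    [AddCommGroup X] [Module R X] (hX : F (ModuleCat.of R X)) (n : ℕ) :
    F (ModuleCat.of R (Fin n → X)) := by
  have h1 := ((h.torsionFree_iff X).1 hX).1
  refine (h.torsionFree_iff _).2 ⟨inferInstance, fun Z _ _ hZ f => ?_⟩
  exact LinearMap.ext fun z => funext fun k => h.hom_eq_zero hZ hX (LinearMap.proj k ∘ₗ f) z

lemma IsTorsionPair.torsionFree_prod (h : IsTorsionPair R T F) {X Y : Type u}
    [AddCommGroup X] [Module R X] [AddCommGroup Y] [Module R Y]
    (hX : F (ModuleCat.of R X)) (hY : F (ModuleCat.of R Y)) : F (ModuleCat.of R (X × Y)) := by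
  have h1 := ((h.torsionFree_iff X).1 hX).1
  have h2 := ((h.torsionFree_iff Y).1 hY).1
  refine (h.torsionFree_iff _).2 ⟨inferInstance, fun Z _ _ hZ f => LinearMap.ext fun z => ?_⟩
  exact Prod.ext (h.hom_eq_zero hZ hX (LinearMap.fst R X Y ∘ₗ f) z)
    (h.hom_eq_zero hZ hY (LinearMap.snd R X Y ∘ₗ f) z)

/-- A left approximation of `R` of minimal length is Ext-projective. -/
lemma IsTorsionPair.exists_extProjective_approximation [IsArtinianRing R] [IsNoetherianRing R]
    (h : IsTorsionPair R T F) (hcov : CovariantlyFinite R T) :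
    ∃ (M : ModuleCat.{u} R) (f : R →ₗ[R] M), T M ∧
      (∀ (Y : Type u) [AddCommGroup Y] [Module R Y], T (ModuleCat.of R Y) →
        ∀ g : R →ₗ[R] Y, ∃ k : M →ₗ[R] Y, k.comp f = g) ∧
      (∀ (Y : Type u) [AddCommGroup Y] [Module R Y], T (ModuleCat.of R Y) →
        Ext1Vanishes R M Y) := by
  let P : ModuleCat.{u} R → Prop := fun M => ∃ f : R →ₗ[R] M, T M ∧
      (∀ (Y : Type u) [AddCommGroup Y] [Module R Y], T (ModuleCat.of R Y) →
        ∀ g : R →ₗ[R] Y, ∃ k : M →ₗ[R] Y, k.comp f = g)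
  have hP : ∃ M, P M := by
    obtain ⟨M, f, hM, hf⟩ := hcov (ModuleCat.of R R) (inferInstanceAs (Module.Finite R R))
    exact ⟨M, f, hM, fun Y _ _ hY g => hf (ModuleCat.of R Y) g hY⟩
  obtain ⟨M, ⟨f, hM, hf⟩, hmin⟩ := exists_minimalFor_of_wellFoundedLT P
    (fun M => Module.length R M) hP
  have hfin : Module.Finite R M := ((h.torsion_iff M).1 hM).1
  refine ⟨M, f, hM, hf, fun Y _ _ hY E _ _ i p hi hp hip => ?_⟩
  obtain ⟨e, he⟩ := hp (f 1)
  obtain ⟨k, hk⟩ := hf E (h.torsion_of_exact hY hM i p hp hip) (LinearMap.toSpanSingleton R E e)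
  have hkf : ∀ r, p (k (f r)) = f r := fun r => by
    have := LinearMap.congr_fun hk r
    rw [LinearMap.comp_apply] at this
    rw [this, LinearMap.toSpanSingleton_apply, map_smul, he, ← map_smul, smul_eq_mul, mul_one]
  let a : M →ₗ[R] M := p ∘ₗ k
  have hsurj : Surjective a := by
    by_contra hne
    have hlt : Module.length R (LinearMap.range a) < Module.length R M :=
      Submodule.length_lt (fun htop => hne (LinearMap.range_eq_top.1 htop))
    refine absurd (hmin (j := ModuleCat.of R (LinearMap.range a)) ?_ hlt.le) (not_le.2 hlt)
    refine ⟨f.codRestrict _ fun r => ⟨f r, hkf r⟩,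
      h.torsion_of_surjective hM a.rangeRestrict a.surjective_rangeRestrict, fun Z _ _ hZ g => ?_⟩
    obtain ⟨g', hg'⟩ := hf Z hZ g
    exact ⟨g' ∘ₗ Submodule.subtype _, hg'⟩
  have hinj : Injective a := IsNoetherian.injective_of_surjective_endomorphism a hsurj
  let e' := LinearEquiv.ofBijective a ⟨hinj, hsurj⟩
  exact ⟨k ∘ₗ e'.symm.toLinearMap, LinearMap.ext fun m => e'.apply_symm_apply m⟩

/-- The cokernel of an Ext-projective left approximation of `R` is Ext-projective. -/
lemma ext1Vanishes_cokernel {M N Y : Type u} [AddCommGroup M] [Module R M] [AddCommGroup N]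
    [Module R N] [AddCommGroup Y] [Module R Y] (f : R →ₗ[R] M) (q : M →ₗ[R] N)
    (hq : Surjective q) (hfq : Function.Exact f q)
    (happ : ∀ g : R →ₗ[R] Y, ∃ k : M →ₗ[R] Y, k.comp f = g) (hM : Ext1Vanishes R M Y) :
    Ext1Vanishes R N Y := by
  intro E _ _ i p hi hp hip
  obtain ⟨s, hs⟩ := hM.lift i p hi hip q (fun x => hp _)
  have hs' : ∀ m, p (s m) = q m := LinearMap.congr_fun hs
  obtain ⟨u, hu⟩ := exists_factor_of_injective i hi (s ∘ₗ f) (fun r => (hip _).1 (by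
    rw [LinearMap.comp_apply, hs']; exact (hfq _).2 ⟨r, rfl⟩))
  obtain ⟨k, hk⟩ := happ u
  obtain ⟨t, ht⟩ := exists_factor_of_surjective q hq (s - i ∘ₗ k) (fun m hm => by
    obtain ⟨r, rfl⟩ := (hfq m).1 hm
    have := LinearMap.congr_fun hk r
    rw [LinearMap.comp_apply] at this
    rw [LinearMap.sub_apply, LinearMap.comp_apply, this, hu, LinearMap.comp_apply, sub_self])
  refine ⟨t, LinearMap.ext fun n => ?_⟩
  obtain ⟨m, rfl⟩ := hq n
  rw [LinearMap.comp_apply, ht, LinearMap.sub_apply, map_sub, hs', LinearMap.comp_apply,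
    hip.apply_apply_eq_zero, sub_zero, LinearMap.id_apply]

end TorsionPair

section HomFinite

variable {R : Type u} [Ring R] (K : Type u) [Field K] [Algebra K R]

/-- Every module over a `K`-algebra has a compatible `K`-structure. -/
lemma isScalarTower_compHom (M : Type u) [AddCommGroup M] [Module R M] :
    letI := Module.compHom M (algebraMap K R)
    IsScalarTower K R M :=
  let _ := Module.compHom M (algebraMap K R)
  IsScalarTower.of_algebraMap_smul fun _ _ => rfl

lemma finite_hom [FiniteDimensional K R] (M X : Type u) [AddCommGroup M] [Module R M]
    [AddCommGroup X] [Module R X] [Module K M] [IsScalarTower K R M] [Module K X]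
    [IsScalarTower K R X] [Module.Finite R M] [Module.Finite R X] :
    FiniteDimensional K (M →ₗ[R] X) := by
  have h1 : FiniteDimensional K M := Module.Finite.trans R M
  have h2 : FiniteDimensional K X := Module.Finite.trans R X
  exact Module.Finite.of_injective (LinearMap.restrictScalarsₗ K R M X K)
    (LinearMap.restrictScalars_injective K)

lemma exists_finite_generating_maps [FiniteDimensional K R] (M X : Type u)
    [AddCommGroup M] [Module R M] [AddCommGroup X] [Module R X]
    [Module.Finite R M] [Module.Finite R X] :
    ∃ (m : ℕ) (φ : Fin m → M →ₗ[R] X),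
      (∀ u : M →ₗ[R] X, ∃ c : Fin m → M →ₗ[R] M, ∀ x, u x = ∑ k, φ k (c k x)) ∧
      (∀ u : M →ₗ[R] X, ∃ c : Fin m → X →ₗ[R] X, ∀ x, u x = ∑ k, c k (φ k x)) := by
  let _ := Module.compHom M (algebraMap K R)
  let _ := Module.compHom X (algebraMap K R)
  have := isScalarTower_compHom (R := R) K M
  have := isScalarTower_compHom (R := R) K X
  have hf : FiniteDimensional K (M →ₗ[R] X) := finite_hom K M X
  obtain ⟨m, φ, hφ⟩ := Module.Finite.exists_fin (R := K) (M := M →ₗ[R] X)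
  have key : ∀ u : M →ₗ[R] X, ∃ c : Fin m → K, ∑ k, c k • φ k = u := fun u =>
    (Submodule.mem_span_range_iff_exists_fun K).1 (hφ ▸ Submodule.mem_top)
  refine ⟨m, φ, fun u => ?_, fun u => ?_⟩
  · obtain ⟨c, rfl⟩ := key u
    refine ⟨fun k => c k • LinearMap.id, fun x => ?_⟩
    simp only [LinearMap.sum_apply, LinearMap.smul_apply, LinearMap.id_apply]
    refine Finset.sum_congr rfl fun k _ => ?_
    rw [← algebraMap_smul R (c k) x, map_smul, algebraMap_smul]
  · obtain ⟨c, rfl⟩ := key u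
    exact ⟨fun k => c k • LinearMap.id, fun x => by simp [LinearMap.sum_apply]⟩

end HomFinite

section Generators

variable {R : Type u} [Ring R] {T F : ModuleCat.{u} R → Prop}

/-- Every torsion module `X` is a quotient of a power of `T₀ × T₁` with torsion kernel, where
`R → T₀ → T₁ → 0` comes from an Ext-projective left approximation. -/
lemma IsTorsionPair.exists_torsion_presentation (K : Type u) [Field K] [Algebra K R]
    [FiniteDimensional K R] [IsNoetherianRing R] (h : IsTorsionPair R T F)
    {T₀ T₁ X : Type u} [AddCommGroup T₀] [Module R T₀]
    [AddCommGroup T₁] [Module R T₁] [AddCommGroup X] [Module R X]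
    (f : R →ₗ[R] T₀) (q : T₀ →ₗ[R] T₁) (hq : Surjective q) (hfq : Function.Exact f q)
    (hT₀ : T (ModuleCat.of R T₀)) (hT₁ : T (ModuleCat.of R T₁))
    (happ : ∀ (Y : Type u) [AddCommGroup Y] [Module R Y], T (ModuleCat.of R Y) →
        ∀ g : R →ₗ[R] Y, ∃ k : T₀ →ₗ[R] Y, k.comp f = g)
    (hExt : ∀ (Y : Type u) [AddCommGroup Y] [Module R Y], T (ModuleCat.of R Y) →
        Ext1Vanishes R T₁ Y)
    (hX : T (ModuleCat.of R X)) :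
    ∃ (m : ℕ) (π : (Fin m → T₀ × T₁) →ₗ[R] X), Surjective π ∧
      T (ModuleCat.of R (LinearMap.ker π)) := by
  have := ((h.torsion_iff _).1 hT₀).1
  have := ((h.torsion_iff _).1 hT₁).1
  have := ((h.torsion_iff _).1 hX).1
  obtain ⟨m, φ, hφ, -⟩ := exists_finite_generating_maps K (T₀ × T₁) X (R := R)
  let π : (Fin m → T₀ × T₁) →ₗ[R] X := ∑ k, φ k ∘ₗ LinearMap.proj k
  have hπ : ∀ e, π e = ∑ k, φ k (e k) := fun e => by simp [π, LinearMap.sum_apply]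
  have hfac : ∀ u : T₀ × T₁ →ₗ[R] X, ∃ v : T₀ × T₁ →ₗ[R] (Fin m → T₀ × T₁), ∀ x, π (v x) = u x := by
    intro u
    obtain ⟨c, hc⟩ := hφ u
    exact ⟨LinearMap.pi c, fun x => by rw [hπ, hc]; rfl⟩
  have hE : T (ModuleCat.of R (Fin m → T₀ × T₁)) := h.torsion_pi (h.torsion_prod hT₀ hT₁) m
  have hsurj : Surjective π := fun x => by
    obtain ⟨k, hk⟩ := happ X hX (LinearMap.toSpanSingleton R X x)
    obtain ⟨v, hv⟩ := hfac (k ∘ₗ LinearMap.fst R T₀ T₁)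
    refine ⟨v (f 1, 0), ?_⟩
    rw [hv]
    have := LinearMap.congr_fun hk 1
    simpa using this
  refine ⟨m, π, hsurj, ?_⟩
  -- `Ext¹(T₁, ker π) = 0`
  have hK1 : Ext1Vanishes R T₁ (LinearMap.ker π) := by
    refine .of_retraction fun W _ _ i p hi hp hip => ?_
    obtain ⟨g, hg⟩ := (hExt _ hE).extend i p hi hp hip (LinearMap.ker π).subtype
    have hg' : ∀ y, g (i y) = y.1 := LinearMap.congr_fun hg
    obtain ⟨u, hu⟩ := exists_factor_of_surjective p hp (π ∘ₗ g) (fun w hw => by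
      obtain ⟨y, rfl⟩ := (hip w).1 hw
      rw [LinearMap.comp_apply, hg']
      exact y.2)
    obtain ⟨v, hv⟩ := hfac (u ∘ₗ LinearMap.snd R T₀ T₁)
    let g' : W →ₗ[R] (Fin m → T₀ × T₁) := g - v ∘ₗ LinearMap.inr R T₀ T₁ ∘ₗ p
    have hg'' : ∀ w, g' w ∈ LinearMap.ker π := fun w => by
      have : π (v (0, p w)) = π (g w) := by rw [hv]; exact hu w
      change π (g w - v (0, p w)) = 0
      rw [map_sub, this, sub_self]
    refine ⟨g'.codRestrict _ hg'', LinearMap.ext fun y => Subtype.ext ?_⟩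
    change g (i y) - v (0, p (i y)) = y.1
    rw [hg', hip.apply_apply_eq_zero, Prod.mk_zero_zero, map_zero, sub_zero]
  refine (h.torsion_iff _).2 ⟨inferInstance, fun Z _ _ hZ z => LinearMap.ext fun x => ?_⟩
  -- the element `x` is the image of a map from `T₀`
  obtain ⟨k, hk⟩ := happ _ hE (LinearMap.toSpanSingleton R _ x.1)
  have hk' : ∀ r, k (f r) = r • x.1 := LinearMap.congr_fun hk
  obtain ⟨a, ha⟩ := exists_factor_of_surjective f.rangeRestrict f.surjective_rangeRestrict
    (LinearMap.toSpanSingleton R _ x) (fun r hr => Subtype.ext (by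
      have : f r = 0 := congrArg Subtype.val hr
      change r • x.1 = 0
      rw [← hk', this, map_zero]))
  obtain ⟨b, hb⟩ := hK1.extend (LinearMap.range f).subtype q Subtype.val_injective hq
    (fun t => by rw [hfq t]; simp) a
  have h1 : b (f 1) = x := by
    have h2 := LinearMap.congr_fun hb (f.rangeRestrict 1)
    rw [ha] at h2
    simpa using h2
  rw [← h1]
  exact h.hom_eq_zero hT₀ hZ (z ∘ₗ b) (f 1)

/-- Dually, every torsion-free module embeds into a power of `C'' × C'` with torsion-free
cokernel, where `0 → C'' → C' → D` comes from an Ext-injective right approximation of an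
injective cogenerator `D`. -/
lemma IsTorsionPair.exists_torsionFree_copresentation (K : Type u) [Field K] [Algebra K R]
    [FiniteDimensional K R] (h : IsTorsionPair R T F)
    {C'' C' D X : Type u} [AddCommGroup C''] [Module R C'']
    [AddCommGroup C'] [Module R C'] [AddCommGroup D] [Module R D] [AddCommGroup X] [Module R X]
    (i : C'' →ₗ[R] C') (p : C' →ₗ[R] D) (hi : Injective i) (hip : Function.Exact i p)
    (hcog : ∀ (Y : Type u) [AddCommGroup Y] [Module R Y] (y : Y), (∀ g : Y →ₗ[R] D, g y = 0) → y = 0)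
    (hC'' : F (ModuleCat.of R C'')) (hC' : F (ModuleCat.of R C'))
    (happ : ∀ (Y : Type u) [AddCommGroup Y] [Module R Y], F (ModuleCat.of R Y) →
        ∀ g : Y →ₗ[R] D, ∃ k : Y →ₗ[R] C', p.comp k = g)
    (hExt : ∀ (Y : Type u) [AddCommGroup Y] [Module R Y], F (ModuleCat.of R Y) →
        Ext1Vanishes R Y C'')
    (hX : F (ModuleCat.of R X)) :
    ∃ (m : ℕ) (ι : X →ₗ[R] (Fin m → C'' × C')), Injective ι ∧
      F (ModuleCat.of R ((Fin m → C'' × C') ⧸ LinearMap.range ι)) := by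
  have := ((h.torsionFree_iff _).1 hC'').1
  have := ((h.torsionFree_iff _).1 hC').1
  have := ((h.torsionFree_iff _).1 hX).1
  obtain ⟨m, φ, -, hφ⟩ := exists_finite_generating_maps K X (C'' × C') (R := R)
  let ι : X →ₗ[R] (Fin m → C'' × C') := LinearMap.pi φ
  have hfac : ∀ u : X →ₗ[R] C'' × C', ∃ v : (Fin m → C'' × C') →ₗ[R] C'' × C',
      ∀ x, v (ι x) = u x := by
    intro u
    obtain ⟨c, hc⟩ := hφ u
    exact ⟨∑ k, c k ∘ₗ LinearMap.proj k, fun x => by rw [hc]; simp [LinearMap.sum_apply, ι]⟩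
  have hE : F (ModuleCat.of R (Fin m → C'' × C')) := h.torsionFree_pi (h.torsionFree_prod hC'' hC') m
  have hinj : Injective ι := by
    rw [← LinearMap.ker_eq_bot, LinearMap.ker_eq_bot']
    intro x hx
    refine hcog X x fun g => ?_
    obtain ⟨k, rfl⟩ := happ X hX g
    obtain ⟨v, hv⟩ := hfac (LinearMap.inr R C'' C' ∘ₗ k)
    have := hv x
    rw [hx, map_zero] at this
    have h2 : k x = 0 := (congrArg Prod.snd this).symm
    rw [LinearMap.comp_apply, h2, map_zero]
  refine ⟨m, ι, hinj, ?_⟩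
  set L := (Fin m → C'' × C') ⧸ LinearMap.range ι
  let q : (Fin m → C'' × C') →ₗ[R] L := (LinearMap.range ι).mkQ
  have hq : Surjective q := Submodule.mkQ_surjective _
  have hιq : Function.Exact ι q := LinearMap.exact_map_mkQ_range ι
  have hL1 : Ext1Vanishes R L C'' := by
    intro W _ _ j s hj hs hjs
    obtain ⟨v, hv⟩ := (hExt _ hE).lift j s hj hjs q (fun x => hs _)
    have hv' : ∀ e, s (v e) = q e := LinearMap.congr_fun hv
    obtain ⟨u, hu⟩ := exists_factor_of_injective j hj (v ∘ₗ ι) (fun x => (hjs _).1 (by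
      rw [LinearMap.comp_apply, hv', hιq.apply_apply_eq_zero]))
    obtain ⟨e, he⟩ := hfac (LinearMap.inl R C'' C' ∘ₗ u)
    obtain ⟨t, ht⟩ := exists_factor_of_surjective q hq
      (v - j ∘ₗ LinearMap.fst R C'' C' ∘ₗ e) (fun w hw => by
        obtain ⟨x, rfl⟩ := (hιq w).1 hw
        have h1 : (e (ι x)).1 = u x := congrArg Prod.fst (he x)
        change v (ι x) - j (e (ι x)).1 = 0
        rw [h1, hu, LinearMap.comp_apply, sub_self])
    refine ⟨t, LinearMap.ext fun l => ?_⟩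
    obtain ⟨e', rfl⟩ := hq l
    rw [LinearMap.comp_apply, ht, LinearMap.sub_apply, map_sub, hv', LinearMap.comp_apply,
      hjs.apply_apply_eq_zero, sub_zero, LinearMap.id_apply]
  refine (h.torsionFree_iff _).2 ⟨inferInstance, fun Z _ _ hZ z => LinearMap.ext fun x => ?_⟩
  refine hcog L _ fun g => ?_
  obtain ⟨k, hk⟩ := happ _ hE (g ∘ₗ q)
  obtain ⟨b, rfl⟩ := hL1.lift i p hi hip g (fun l => by
    obtain ⟨e, rfl⟩ := hq l
    exact ⟨k e, LinearMap.congr_fun hk e⟩)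
  rw [LinearMap.comp_apply]
  have := h.hom_eq_zero hZ hC' (b ∘ₗ z) x
  rw [LinearMap.comp_apply] at this
  rw [this, map_zero]

end Generators

section Basic

variable {R : Type u} [Ring R]

lemma InAdd.pi {G : Type u} [AddCommGroup G] [Module R G] {ι : Type} [Fintype ι]
    {X : ι → Type u} [∀ i, AddCommGroup (X i)] [∀ i, Module R (X i)]
    (h : ∀ i, InAdd R G (X i)) : InAdd R G (∀ i, X i) := by
  classical
  choose n a b hab using fun i => (h i).exists_sum
  refine InAdd.of_sum (ι := Σ i, Fin (n i)) (fun k => a k.1 k.2 ∘ₗ LinearMap.proj k.1)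
    (fun k => LinearMap.single R X k.1 ∘ₗ b k.1 k.2) fun x => ?_
  rw [Fintype.sum_sigma]
  have : ∀ i, ∑ k, (LinearMap.single R X i ∘ₗ b i k) ((a i k ∘ₗ LinearMap.proj i) x) =
      Pi.single i (x i) := fun i => by
    simp only [LinearMap.comp_apply, ← map_sum, LinearMap.proj_apply, hab]
    rfl
  simp only [this]
  exact Finset.univ_sum_single x

lemma InAdd.prod {G X Y : Type u} [AddCommGroup G] [Module R G] [AddCommGroup X] [Module R X]
    [AddCommGroup Y] [Module R Y] (h₁ : InAdd R G X) (h₂ : InAdd R G Y) : InAdd R G (X × Y) := by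
  obtain ⟨n, a, b, h⟩ := h₁.exists_sum
  obtain ⟨m, a', b', h'⟩ := h₂.exists_sum
  refine InAdd.of_sum (ι := Fin n ⊕ Fin m)
    (Sum.elim (fun k => a k ∘ₗ LinearMap.fst R X Y) (fun k => a' k ∘ₗ LinearMap.snd R X Y))
    (Sum.elim (fun k => LinearMap.inl R X Y ∘ₗ b k) (fun k => LinearMap.inr R X Y ∘ₗ b' k))
    fun x => ?_
  rw [Fintype.sum_sum_type]
  simp only [Sum.elim_inl, Sum.elim_inr, LinearMap.comp_apply, ← map_sum, h, h']
  exact Prod.ext (by simp) (by simp)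

lemma InAdd.of_equiv {X Y : Type u} [AddCommGroup X] [Module R X]
    [AddCommGroup Y] [Module R Y] (e : X ≃ₗ[R] Y) : InAdd R X Y :=
  InAdd.of_retract e.symm.toLinearMap e.toLinearMap e.apply_symm_apply

/-- `X` is a finite family of indecomposable modules whose sum has the same additive closure
as `M`. -/
def IsIndecFamily (M : Type u) [AddCommGroup M] [Module R M] {ι : Type}
    (X : ι → ModuleCat.{u} R) : Prop :=
  (∀ i, IsIndec R (X i)) ∧ InAdd R M (∀ i, X i) ∧ InAdd R (∀ i, X i) M

lemma exists_isIndecFamily [IsArtinianRing R] [IsNoetherianRing R] (M : Type u) [AddCommGroup M]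
    [Module R M] [Module.Finite R M] :
    ∃ (ι : Type) (_ : Fintype ι) (X : ι → ModuleCat.{u} R), IsIndecFamily M X := by
  suffices H : ∀ S : Submodule R M, ∃ (ι : Type) (_ : Fintype ι) (X : ι → ModuleCat.{u} R),
      IsIndecFamily S X by
    obtain ⟨ι, hι, X, hX, h1, h2⟩ := H ⊤
    exact ⟨ι, hι, X, hX, (InAdd.of_equiv Submodule.topEquiv.symm).trans h1,
      h2.trans (InAdd.of_equiv Submodule.topEquiv)⟩
  intro S
  induction S using WellFoundedLT.induction with
  | ind S ih =>
  by_cases hS : IsIndec R S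
  · exact ⟨Unit, inferInstance, fun _ => ModuleCat.of R S, fun _ => hS,
      InAdd.pi fun _ => InAdd.refl S, InAdd.of_retract
        (LinearMap.pi fun _ => LinearMap.id) (LinearMap.proj ()) fun _ => rfl⟩
  by_cases hn : Nontrivial S
  · have : ¬ ∀ N₁ N₂ : Submodule R S, IsCompl N₁ N₂ → N₁ = ⊥ ∨ N₂ = ⊥ := fun h => hS ⟨hn, h⟩
    push Not at this
    obtain ⟨N₁, N₂, hc, h1, h2⟩ := this
    have hlt : ∀ N N' : Submodule R S, IsCompl N N' → N' ≠ ⊥ → N.map S.subtype < S := by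
      intro N N' hNN h'
      refine lt_of_le_of_ne (Submodule.map_subtype_le S N) fun he => h' ?_
      have : N = ⊤ := by
        rw [eq_top_iff]
        intro x _
        have hx : (x : M) ∈ N.map S.subtype := by rw [he]; exact x.2
        obtain ⟨y, hy, hyx⟩ := hx
        exact (Subtype.ext hyx : y = x) ▸ hy
      rw [this] at hNN
      exact eq_bot_of_top_isCompl hNN
    obtain ⟨ι₁, hι₁, X₁, hX₁, a₁, b₁⟩ := ih _ (hlt _ _ hc h2)
    obtain ⟨ι₂, hι₂, X₂, hX₂, a₂, b₂⟩ := ih _ (hlt _ _ hc.symm h1)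
    let e₁ : N₁ ≃ₗ[R] N₁.map S.subtype := Submodule.equivMapOfInjective _ Subtype.val_injective _
    let e₂ : N₂ ≃ₗ[R] N₂.map S.subtype := Submodule.equivMapOfInjective _ Subtype.val_injective _
    let e : (N₁ × N₂) ≃ₗ[R] S := Submodule.prodEquivOfIsCompl N₁ N₂ hc
    have hSprod := InAdd.of_equiv e.symm
    have hSN₁ : InAdd R S N₁ := hSprod.trans
      (InAdd.of_retract (LinearMap.inl R N₁ N₂) (LinearMap.fst R N₁ N₂) fun _ => rfl)
    have hSN₂ : InAdd R S N₂ := hSprod.trans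
      (InAdd.of_retract (LinearMap.inr R N₁ N₂) (LinearMap.snd R N₁ N₂) fun _ => rfl)
    let X : ι₁ ⊕ ι₂ → ModuleCat.{u} R := Sum.elim X₁ X₂
    have hproj : ∀ k, InAdd R (∀ i, X i) (X k) := by
      classical
      exact fun k => InAdd.of_retract (LinearMap.single R (fun i => X i) k) (LinearMap.proj k)
        fun x => by simp
    have hfac : ∀ {ι : Type} [Fintype ι] (Y : ι → ModuleCat.{u} R) k, InAdd R (∀ i, Y i) (Y k) := by
      classical
      exact fun Y k => InAdd.of_retract (LinearMap.single R (fun i => Y i) k) (LinearMap.proj k)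
        fun x => by simp
    refine ⟨ι₁ ⊕ ι₂, inferInstance, X, ?_, InAdd.pi ?_, ?_⟩
    · rintro (i | i)
      exacts [hX₁ i, hX₂ i]
    · rintro (i | i)
      · exact hSN₁.trans ((InAdd.of_equiv e₁).trans (a₁.trans (hfac X₁ i)))
      · exact hSN₂.trans ((InAdd.of_equiv e₂).trans (a₂.trans (hfac X₂ i)))
    · refine InAdd.trans (InAdd.prod ?_ ?_) (InAdd.of_equiv e)
      · exact ((InAdd.pi fun i => hproj (Sum.inl i)).trans b₁).trans (InAdd.of_equiv e₁.symm)
      · exact ((InAdd.pi fun i => hproj (Sum.inr i)).trans b₂).trans (InAdd.of_equiv e₂.symm)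
  · have hs : Subsingleton S := not_nontrivial_iff_subsingleton.1 hn
    exact ⟨Empty, inferInstance, fun i => i.elim, fun i => i.elim,
      InAdd.pi fun i => i.elim, InAdd.of_retract 0 0 fun x => Subsingleton.elim _ _⟩

/-- Every finitely generated module has the same additive closure as a basic module. -/
lemma exists_isBasic [IsArtinianRing R] [IsNoetherianRing R] (M : Type u) [AddCommGroup M]
    [Module R M] [Module.Finite R M] :
    ∃ B : ModuleCat.{u} R, IsBasic R B ∧ InAdd R M B ∧ InAdd R B M := by
  classical
  let p : ℕ → Prop := fun n => ∃ X : Fin n → ModuleCat.{u} R, IsIndecFamily M X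
  have hfac : ∀ {ι : Type} [Fintype ι] (Y : ι → ModuleCat.{u} R) k, InAdd R (∀ i, Y i) (Y k) :=
    fun Y k => InAdd.of_retract (LinearMap.single R (fun i => Y i) k) (LinearMap.proj k)
      fun x => by simp
  have hp' : ∀ (ι : Type) [Fintype ι] (X : ι → ModuleCat.{u} R), IsIndecFamily M X →
      p (Fintype.card ι) := by
    rintro ι _ X ⟨h1, h2, h3⟩
    let e := Fintype.equivFin ι
    refine ⟨fun k => X (e.symm k), fun k => h1 _, InAdd.pi fun k => h2.trans (hfac X _), ?_⟩
    refine InAdd.trans (InAdd.pi fun i => ?_) h3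
    have := hfac (fun k => X (e.symm k)) (e i)
    rwa [e.symm_apply_apply] at this
  have hp : ∃ n, p n := by
    obtain ⟨ι, hι, X, hX⟩ := exists_isIndecFamily (R := R) M
    exact ⟨_, hp' ι X hX⟩
  obtain ⟨n, ⟨X, hX, h1, h2⟩, hmin⟩ : ∃ n, p n ∧ ∀ m < n, ¬ p m :=
    ⟨Nat.find hp, Nat.find_spec hp, fun m => Nat.find_min hp⟩
  have hne : ∀ i j, i ≠ j → ¬ Nonempty (X i ≃ₗ[R] X j) := by
    rintro i j hij ⟨e⟩
    have hlt : Fintype.card {k : Fin n // k ≠ i} < n := by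
      simpa using Fintype.card_subtype_lt (p := fun k : Fin n => k ≠ i) (x := i) (by simp)
    refine hmin _ hlt (hp' _ (fun k => X k.1) ⟨fun k => hX _,
      InAdd.pi fun k => h1.trans (hfac X _), InAdd.trans (InAdd.pi fun k => ?_) h2⟩)
    by_cases hk : k = i
    · subst hk
      exact (hfac (fun k : {l : Fin n // l ≠ k} => X k.1) ⟨j, hij.symm⟩).trans
        (InAdd.of_equiv e.symm)
    · exact hfac (fun k : {l : Fin n // l ≠ i} => X k.1) ⟨k, hk⟩
  let N : Fin n → Submodule R (∀ i, X i) := fun i => LinearMap.range (LinearMap.single R (fun i => X i) i)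
  have eN : ∀ i, X i ≃ₗ[R] N i := fun i => LinearEquiv.ofInjective _ (fun x y hxy => by
    have := congrFun hxy i
    simpa using this)
  refine ⟨ModuleCat.of R (∀ i, X i), ⟨n, N, ?_, fun i => ?_, fun i j hij ⟨e⟩ => ?_⟩, h1, h2⟩
  · rw [DirectSum.isInternal_submodule_iff_iSupIndep_and_iSup_eq_top]
    constructor
    · intro i
      rw [Submodule.disjoint_def]
      rintro _ ⟨x, rfl⟩ hx
      have hle : (⨆ j, ⨆ (_ : j ≠ i), N j) ≤ LinearMap.ker (LinearMap.proj (R := R) (φ := fun i => X i) i) := by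
        refine iSup₂_le fun j hj => ?_
        rintro _ ⟨y, rfl⟩
        simp [LinearMap.mem_ker, hj.symm]
      have hx0 : x = 0 := by simpa using hle hx
      rw [hx0, map_zero]
    · rw [eq_top_iff]
      intro x _
      rw [← Finset.univ_sum_single x]
      exact Submodule.sum_mem _ fun i _ => Submodule.mem_iSup_of_mem i ⟨_, rfl⟩
  · obtain ⟨h, h'⟩ := hX i
    refine ⟨(eN i).symm.toEquiv.nontrivial, fun N₁ N₂ hc => ?_⟩
    have := h' _ _ ((Submodule.orderIsoMapComap (eN i).symm).isCompl hc)
    simpa using this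
  · exact hne i j hij ⟨((eN i).trans e).trans (eN j).symm⟩

end Basic

section BasicGenerators

variable {R : Type u} [Ring R] {T F : ModuleCat.{u} R → Prop}

lemma FacOf.of_inAdd {G U X : Type u} [AddCommGroup G] [Module R G] [AddCommGroup U] [Module R U]
    [AddCommGroup X] [Module R X] (h : FacOf R U X) (hG : InAdd R G U) : FacOf R G X := by
  obtain ⟨n, p, hp⟩ := h
  obtain ⟨m, i, q, hq⟩ := InAdd.pi (ι := Fin n) (X := fun _ => U) fun _ => hG
  exact ⟨m, p ∘ₗ q, hp.comp fun x => ⟨i x, LinearMap.congr_fun hq x⟩⟩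

lemma SubOf.of_inAdd {G U X : Type u} [AddCommGroup G] [Module R G] [AddCommGroup U] [Module R U]
    [AddCommGroup X] [Module R X] (h : SubOf R U X) (hG : InAdd R G U) : SubOf R G X := by
  obtain ⟨n, p, hp⟩ := h
  obtain ⟨m, i, q, hq⟩ := InAdd.pi (ι := Fin n) (X := fun _ => U) fun _ => hG
  have hi : Injective i := LeftInverse.injective (LinearMap.congr_fun hq)
  exact ⟨m, i ∘ₗ p, hi.comp hp⟩

/-- `G` is an Ext-projective generator of `T`, not necessarily basic. -/
def IsExtProjGen (T : ModuleCat.{u} R → Prop) (G : Type u) [AddCommGroup G] [Module R G] : Prop :=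
  T (ModuleCat.of R G) ∧
  (∀ (X : Type u) [AddCommGroup X] [Module R X], T (ModuleCat.of R X) → Ext1Vanishes R G X) ∧
  (∀ (X : Type u) [AddCommGroup X] [Module R X], T (ModuleCat.of R X) → FacOf R G X) ∧
  (∀ (X : Type u) [AddCommGroup X] [Module R X], T (ModuleCat.of R X) →
    (∀ (Y : Type u) [AddCommGroup Y] [Module R Y], T (ModuleCat.of R Y) → Ext1Vanishes R X Y) →
    InAdd R G X)

/-- `C` is an Ext-injective cogenerator of `F`, not necessarily basic. -/
def IsExtInjCogen (F : ModuleCat.{u} R → Prop) (C : Type u) [AddCommGroup C] [Module R C] : Prop :=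
  F (ModuleCat.of R C) ∧
  (∀ (X : Type u) [AddCommGroup X] [Module R X], F (ModuleCat.of R X) → Ext1Vanishes R X C) ∧
  (∀ (X : Type u) [AddCommGroup X] [Module R X], F (ModuleCat.of R X) → SubOf R C X) ∧
  (∀ (X : Type u) [AddCommGroup X] [Module R X], F (ModuleCat.of R X) →
    (∀ (Y : Type u) [AddCommGroup Y] [Module R Y], F (ModuleCat.of R Y) → Ext1Vanishes R Y X) →
    InAdd R C X)

lemma IsExtProjGen.exists_basic [IsArtinianRing R] [IsNoetherianRing R]
    (h : IsTorsionPair R T F) {U : Type u} [AddCommGroup U] [Module R U]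
    (hU : IsExtProjGen T U) : ∃ G : ModuleCat.{u} R, IsBasicExtProjGen R T G := by
  obtain ⟨hT, hE, hF, hA⟩ := hU
  have := ((h.torsion_iff U).1 hT).1
  obtain ⟨G, hG, h1, h2⟩ := exists_isBasic (R := R) U
  obtain ⟨n, i, p, hp⟩ := id h1
  have hTG : T G := h.torsion_of_surjective (h.torsion_pi hT n) p
    fun x => ⟨i x, LinearMap.congr_fun hp x⟩
  refine ⟨G, hTG, hG, fun X hX => h1.ext1Vanishes_left (hE X hX), fun X => ⟨fun hX =>
    ⟨((h.torsion_iff X).1 hX).1, (hF X hX).of_inAdd h2⟩, ?_⟩,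
    fun X hX hX' => h2.trans (hA X hX fun Y _ _ hY => hX' (ModuleCat.of R Y) hY)⟩
  rintro ⟨-, m, q, hq⟩
  exact h.torsion_of_surjective (h.torsion_pi (X := G) hTG m) q hq

lemma IsExtProjGen.inAdd {U : Type u} [AddCommGroup U] [Module R U]
    (hU : IsExtProjGen T U) {G : ModuleCat.{u} R} (hG : IsBasicExtProjGen R T G) :
    InAdd R U G ∧ InAdd R G U :=
  ⟨hU.2.2.2 G hG.1 fun Y _ _ hY => hG.2.2.1 (ModuleCat.of R Y) hY,
    hG.2.2.2.2 (ModuleCat.of R U) hU.1 fun Y hY => hU.2.1 Y hY⟩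

lemma IsExtInjCogen.exists_basic [IsArtinianRing R] [IsNoetherianRing R]
    (h : IsTorsionPair R T F) {U : Type u} [AddCommGroup U] [Module R U]
    (hU : IsExtInjCogen F U) : ∃ G : ModuleCat.{u} R, IsBasicExtInjCogen R F G := by
  obtain ⟨hT, hE, hF, hA⟩ := hU
  have := ((h.torsionFree_iff U).1 hT).1
  obtain ⟨G, hG, h1, h2⟩ := exists_isBasic (R := R) U
  obtain ⟨n, i, p, hp⟩ := id h1
  have hTG : F G := h.torsionFree_of_injective (h.torsionFree_pi hT n) i
    (LeftInverse.injective (LinearMap.congr_fun hp))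
  refine ⟨G, hTG, hG, fun X hX => h1.ext1Vanishes_right (hE X hX), fun X => ⟨fun hX =>
    ⟨((h.torsionFree_iff X).1 hX).1, (hF X hX).of_inAdd h2⟩, ?_⟩,
    fun X hX hX' => h2.trans (hA X hX fun Y _ _ hY => hX' (ModuleCat.of R Y) hY)⟩
  rintro ⟨-, m, q, hq⟩
  exact h.torsionFree_of_injective (h.torsionFree_pi (X := G) hTG m) q hq

lemma IsExtInjCogen.inAdd {U : Type u} [AddCommGroup U] [Module R U]
    (hU : IsExtInjCogen F U) {G : ModuleCat.{u} R} (hG : IsBasicExtInjCogen R F G) :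
    InAdd R U G ∧ InAdd R G U :=
  ⟨hU.2.2.2 G hG.1 fun Y _ _ hY => hG.2.2.1 (ModuleCat.of R Y) hY,
    hG.2.2.2.2 (ModuleCat.of R U) hU.1 fun Y hY => hU.2.1 Y hY⟩

lemma IsTorsionPair.isExtProjGen (K : Type u) [Field K] [Algebra K R]
    [FiniteDimensional K R] [IsNoetherianRing R] (h : IsTorsionPair R T F)
    {T₀ T₁ : Type u} [AddCommGroup T₀] [Module R T₀] [AddCommGroup T₁] [Module R T₁]
    (f : R →ₗ[R] T₀) (q : T₀ →ₗ[R] T₁) (hq : Surjective q) (hfq : Function.Exact f q)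
    (hT₀ : T (ModuleCat.of R T₀))
    (happ : ∀ (Y : Type u) [AddCommGroup Y] [Module R Y], T (ModuleCat.of R Y) →
        ∀ g : R →ₗ[R] Y, ∃ k : T₀ →ₗ[R] Y, k.comp f = g)
    (hExt : ∀ (Y : Type u) [AddCommGroup Y] [Module R Y], T (ModuleCat.of R Y) →
        Ext1Vanishes R T₀ Y) : IsExtProjGen T (T₀ × T₁) := by
  have hT₁ : T (ModuleCat.of R T₁) := h.torsion_of_surjective hT₀ q hq
  have hExt' : ∀ (Y : Type u) [AddCommGroup Y] [Module R Y], T (ModuleCat.of R Y) →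
      Ext1Vanishes R T₁ Y := fun Y _ _ hY =>
    ext1Vanishes_cokernel f q hq hfq (happ Y hY) (hExt Y hY)
  have key := fun (X : Type u) [AddCommGroup X] [Module R X] (hX : T (ModuleCat.of R X)) =>
    h.exists_torsion_presentation K f q hq hfq hT₀ hT₁ happ hExt' hX
  refine ⟨h.torsion_prod hT₀ hT₁, fun X _ _ hX => ?_, fun X _ _ hX => ?_, fun X _ _ hX hX' => ?_⟩
  · intro E _ _ i p hi hp hip
    obtain ⟨s, hs⟩ := (hExt X hX).lift i p hi hip (LinearMap.inl R T₀ T₁) fun x => hp _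
    obtain ⟨s', hs'⟩ := (hExt' X hX).lift i p hi hip (LinearMap.inr R T₀ T₁) fun x => hp _
    refine ⟨s.coprod s', ?_⟩
    rw [LinearMap.comp_coprod, hs, hs', LinearMap.coprod_inl_inr]
  · obtain ⟨m, π, hπ, -⟩ := key X hX
    exact ⟨m, π, hπ⟩
  · obtain ⟨m, π, hπ, hk⟩ := key X hX
    obtain ⟨s, hs⟩ := hX' _ hk _ (LinearMap.ker π).subtype π Subtype.val_injective hπ
      (LinearMap.exact_subtype_ker_map π)
    exact ⟨m, s, π, hs⟩

lemma IsTorsionPair.isExtInjCogen (K : Type u) [Field K] [Algebra K R]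
    [FiniteDimensional K R] [IsNoetherianRing R] (h : IsTorsionPair R T F)
    {C'' C' D : Type u} [AddCommGroup C''] [Module R C'']
    [AddCommGroup C'] [Module R C'] [AddCommGroup D] [Module R D]
    (i : C'' →ₗ[R] C') (p : C' →ₗ[R] D) (hi : Injective i) (hip : Function.Exact i p)
    (hcog : ∀ (Y : Type u) [AddCommGroup Y] [Module R Y] (y : Y),
      (∀ g : Y →ₗ[R] D, g y = 0) → y = 0)
    (hC' : F (ModuleCat.of R C'))
    (happ : ∀ (Y : Type u) [AddCommGroup Y] [Module R Y], F (ModuleCat.of R Y) →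
        ∀ g : Y →ₗ[R] D, ∃ k : Y →ₗ[R] C', p.comp k = g)
    (hExt' : ∀ (Y : Type u) [AddCommGroup Y] [Module R Y], F (ModuleCat.of R Y) →
        Ext1Vanishes R Y C')
    (hExt : ∀ (Y : Type u) [AddCommGroup Y] [Module R Y], F (ModuleCat.of R Y) →
        Ext1Vanishes R Y C'') : IsExtInjCogen F (C'' × C') := by
  have hC'' : F (ModuleCat.of R C'') := h.torsionFree_of_injective hC' i hi
  have key := fun (X : Type u) [AddCommGroup X] [Module R X] (hX : F (ModuleCat.of R X)) =>
    h.exists_torsionFree_copresentation K i p hi hip hcog hC'' hC' happ hExt hX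
  refine ⟨h.torsionFree_prod hC'' hC', fun X _ _ hX => ?_, fun X _ _ hX => ?_,
    fun X _ _ hX hX' => ?_⟩
  · refine .of_retraction fun E _ _ j s hj hs hjs => ?_
    obtain ⟨r, hr⟩ := (hExt X hX).extend j s hj hs hjs (LinearMap.fst R C'' C')
    obtain ⟨r', hr'⟩ := (hExt' X hX).extend j s hj hs hjs (LinearMap.snd R C'' C')
    refine ⟨r.prod r', ?_⟩
    rw [LinearMap.prod_comp, hr, hr']
    rfl
  · obtain ⟨m, ι, hι, -⟩ := key X hX
    exact ⟨m, ι, hι⟩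
  · obtain ⟨m, ι, hι, hk⟩ := key X hX
    have hex : Function.Exact ι (LinearMap.range ι).mkQ := LinearMap.exact_map_mkQ_range ι
    obtain ⟨r, hr⟩ := (exists_section_iff_exists_retraction hι (Submodule.mkQ_surjective _) hex).1
      (hX' _ hk _ ι (LinearMap.range ι).mkQ hι (Submodule.mkQ_surjective _) hex)
    exact ⟨m, ι, r, hr⟩

end BasicGenerators

section KLinear

variable {R : Type u} [Ring R] (K : Type u) [Field K] [Algebra K R]
variable {A B A' B' : Type u} [AddCommGroup A] [Module R A] [AddCommGroup B] [Module R B]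
  [AddCommGroup A'] [Module R A'] [AddCommGroup B'] [Module R B']

/-- `K`-linearity of an additive functional on a space of `R`-linear maps, for the `K`-structure
induced by `K → R`. -/
def IsKLinear (φ : (A →ₗ[R] B) →+ K) : Prop :=
  ∀ (c : K) (g h : A →ₗ[R] B), (∀ x, h x = algebraMap K R c • g x) → φ h = c * φ g

/-- `K`-linearity of an additive map between spaces of `R`-linear maps. -/
def IsKMap (L : (A →ₗ[R] B) →+ (A' →ₗ[R] B')) : Prop :=
  ∀ (c : K) (g h : A →ₗ[R] B), (∀ x, h x = algebraMap K R c • g x) →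
    ∀ x, L h x = algebraMap K R c • L g x

/-- Precomposition with `d`. -/
def precomp (B : Type u) [AddCommGroup B] [Module R B] (d : A' →ₗ[R] A) :
    (A →ₗ[R] B) →+ (A' →ₗ[R] B) :=
  AddMonoidHom.mk' (fun g => g ∘ₗ d) fun _ _ => LinearMap.add_comp _ _ _

/-- Postcomposition with `d`. -/
def postcomp (A : Type u) [AddCommGroup A] [Module R A] (d : B →ₗ[R] B') :
    (A →ₗ[R] B) →+ (A →ₗ[R] B') :=
  AddMonoidHom.mk' (fun g => d ∘ₗ g) fun _ _ => LinearMap.comp_add _ _ _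

lemma postcomp_apply (d : B →ₗ[R] B') (g : A →ₗ[R] B) : postcomp A d g = d ∘ₗ g := rfl

lemma isKMap_precomp (d : A' →ₗ[R] A) : IsKMap K (precomp B d) := fun _ _ _ h x => h (d x)

lemma isKMap_postcomp (d : B →ₗ[R] B') : IsKMap K (postcomp A d) := fun c g h hh x => by
  rw [postcomp_apply, LinearMap.comp_apply, hh, map_smul]
  rfl

variable {K} in
lemma IsKLinear.comp {φ : (A' →ₗ[R] B') →+ K} (hφ : IsKLinear K φ)
    {L : (A →ₗ[R] B) →+ (A' →ₗ[R] B')} (hL : IsKMap K L) : IsKLinear K (φ.comp L) :=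
  fun c g h hh => hφ c _ _ (hL c g h hh)

/-- A functional vanishing on the kernel of `L` factors through `L`. -/
lemma IsKLinear.exists_factor {ψ : (A →ₗ[R] B) →+ K} (hψ : IsKLinear K ψ)
    {L : (A →ₗ[R] B) →+ (A' →ₗ[R] B')} (hL : IsKMap K L) (h0 : ∀ v, L v = 0 → ψ v = 0) :
    ∃ φ : (A' →ₗ[R] B') →+ K, IsKLinear K φ ∧ ∀ v, φ (L v) = ψ v := by
  let _ := Module.compHom A (algebraMap K R)
  let _ := Module.compHom B (algebraMap K R)
  let _ := Module.compHom A' (algebraMap K R)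
  let _ := Module.compHom B' (algebraMap K R)
  have := isScalarTower_compHom (R := R) K A
  have := isScalarTower_compHom (R := R) K B
  have := isScalarTower_compHom (R := R) K A'
  have := isScalarTower_compHom (R := R) K B'
  let ψ' : Module.Dual K (A →ₗ[R] B) :=
    { ψ with map_smul' := fun c g => hψ c g (c • g) fun x => rfl }
  let L' : (A →ₗ[R] B) →ₗ[K] (A' →ₗ[R] B') :=
    { L with map_smul' := fun c g => LinearMap.ext (hL c g (c • g) fun x => rfl) }
  have hmem : ψ' ∈ LinearMap.range L'.dualMap := by
    rw [LinearMap.range_dualMap_eq_dualAnnihilator_ker]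
    exact (Submodule.mem_dualAnnihilator _).2 fun v hv => h0 v hv
  obtain ⟨φ, hφ⟩ := hmem
  refine ⟨φ.toAddMonoidHom, fun c g h hh => ?_, LinearMap.congr_fun hφ⟩
  have : h = c • g := LinearMap.ext hh
  subst this
  exact φ.map_smul c g

end KLinear

section NakayamaTrace

variable {R : Type u} [Ring R] {K : Type u} [Field K] [Algebra K R]

/-- A trace exhibiting `I` as the Nakayama partner of `P`: the functional `t` induces, for every
finitely generated `Y`, a nondegenerate pairing of `Hom(P, Y)` and `Hom(Y, I)`. -/
structure IsNakayamaTrace {P I : Type u} [AddCommGroup P] [Module R P] [AddCommGroup I]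
    [Module R I] (t : (P →ₗ[R] I) →+ K) : Prop where
  isKLinear : IsKLinear K t
  left : ∀ (Y : Type u) [AddCommGroup Y] [Module R Y] [Module.Finite R Y] (a : P →ₗ[R] Y),
    (∀ b : Y →ₗ[R] I, t (b ∘ₗ a) = 0) → a = 0
  right : ∀ (Y : Type u) [AddCommGroup Y] [Module R Y] [Module.Finite R Y] (b : Y →ₗ[R] I),
    (∀ a : P →ₗ[R] Y, t (b ∘ₗ a) = 0) → b = 0

section Representation

variable [FiniteDimensional K R]
  {P I : Type u} [AddCommGroup P] [Module R P] [AddCommGroup I] [Module R I]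
  [Module.Finite R P] [Module.Finite R I] {t : (P →ₗ[R] I) →+ K}

lemma IsNakayamaTrace.representable (ht : IsNakayamaTrace t) (Y : Type u) [AddCommGroup Y]
    [Module R Y] [Module.Finite R Y] :
    (∀ φ : (P →ₗ[R] Y) →+ K, IsKLinear K φ → ∃ b : Y →ₗ[R] I, ∀ a, t (b ∘ₗ a) = φ a) ∧
    (∀ φ : (Y →ₗ[R] I) →+ K, IsKLinear K φ → ∃ a : P →ₗ[R] Y, ∀ b, t (b ∘ₗ a) = φ b) := by
  let _ := Module.compHom P (algebraMap K R)
  let _ := Module.compHom Y (algebraMap K R)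
  let _ := Module.compHom I (algebraMap K R)
  have := isScalarTower_compHom (R := R) K P
  have := isScalarTower_compHom (R := R) K Y
  have := isScalarTower_compHom (R := R) K I
  let p : (P →ₗ[R] Y) →ₗ[K] (Y →ₗ[R] I) →ₗ[K] K :=
    LinearMap.mk₂ K (fun a b => t (b ∘ₗ a))
      (fun a a' b => by rw [LinearMap.comp_add, map_add])
      (fun c a b => ht.isKLinear c _ _ fun x => by
        change b (algebraMap K R c • a x) = _
        rw [map_smul]
        rfl)
      (fun a b b' => by rw [LinearMap.add_comp, map_add])
      (fun c a b => ht.isKLinear c _ _ fun x => rfl)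
  have h1 : Injective p := by
    rw [← LinearMap.ker_eq_bot, LinearMap.ker_eq_bot']
    exact fun a ha => ht.left Y a fun b => LinearMap.congr_fun ha b
  have h2 : Injective p.flip := by
    rw [← LinearMap.ker_eq_bot, LinearMap.ker_eq_bot']
    exact fun b hb => ht.right Y b fun a => LinearMap.congr_fun hb a
  have : FiniteDimensional K (P →ₗ[R] Y) := finite_hom K P Y
  have hp := LinearMap.IsPerfPair.of_injective h1 h2
  constructor
  · intro φ hφ
    obtain ⟨b, hb⟩ := hp.bijective_right.2 { φ with map_smul' := fun c g => hφ c g _ fun x => rfl }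
    exact ⟨b, fun a => LinearMap.congr_fun hb a⟩
  · intro φ hφ
    obtain ⟨a, ha⟩ := hp.bijective_left.2 { φ with map_smul' := fun c g => hφ c g _ fun x => rfl }
    exact ⟨a, fun b => LinearMap.congr_fun ha b⟩

lemma IsNakayamaTrace.extend (ht : IsNakayamaTrace t) {X Y : Type u} [AddCommGroup X]
    [Module R X] [Module.Finite R X] [AddCommGroup Y] [Module R Y] [Module.Finite R Y]
    (i : X →ₗ[R] Y) (hi : Injective i) (g : X →ₗ[R] I) : ∃ b : Y →ₗ[R] I, b ∘ₗ i = g := by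
  obtain ⟨φ, hφ, h⟩ := IsKLinear.exists_factor K (ht.isKLinear.comp (isKMap_postcomp K g))
    (isKMap_postcomp K (A := P) i) (fun v hv => by
      have : v = 0 := LinearMap.ext fun x => hi ((LinearMap.congr_fun hv x).trans (map_zero i).symm)
      rw [this, map_zero])
  obtain ⟨b, hb⟩ := (ht.representable Y).1 φ hφ
  refine ⟨b, sub_eq_zero.1 (ht.right X _ fun a => ?_)⟩
  rw [LinearMap.sub_comp, map_sub, LinearMap.comp_assoc, hb]
  exact sub_eq_zero.2 (h a)

lemma IsNakayamaTrace.injective (ht : IsNakayamaTrace t) : Module.Injective R I := by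
  have : IsNoetherianRing R := IsNoetherianRing.of_finite K R
  refine Module.Baer.injective fun J g => ?_
  obtain ⟨b, hb⟩ := ht.extend J.subtype Subtype.val_injective g
  exact ⟨b, fun x hx => LinearMap.congr_fun hb ⟨x, hx⟩⟩

end Representation

section Adjoint

/-- The maps `d` and `d'` correspond to each other under the Nakayama functor. -/
def IsNakayamaAdj {P₁ P₀ I₁ I₀ : Type u} [AddCommGroup P₁] [Module R P₁]
    [AddCommGroup P₀] [Module R P₀] [AddCommGroup I₁] [Module R I₁] [AddCommGroup I₀] [Module R I₀]
    (t₁ : (P₁ →ₗ[R] I₁) →+ K) (t₀ : (P₀ →ₗ[R] I₀) →+ K) (d : P₁ →ₗ[R] P₀) (d' : I₁ →ₗ[R] I₀) :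
    Prop :=
  ∀ c : P₀ →ₗ[R] I₁, t₁ (c ∘ₗ d) = t₀ (d' ∘ₗ c)

variable {P₂ P₁ P₀ I₂ I₁ I₀ : Type u} [AddCommGroup P₂] [Module R P₂]
  [AddCommGroup P₁] [Module R P₁]
  [AddCommGroup P₀] [Module R P₀] [AddCommGroup I₂] [Module R I₂]
  [AddCommGroup I₁] [Module R I₁] [AddCommGroup I₀] [Module R I₀]
  {t₂ : (P₂ →ₗ[R] I₂) →+ K} {t₁ : (P₁ →ₗ[R] I₁) →+ K} {t₀ : (P₀ →ₗ[R] I₀) →+ K}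

lemma IsNakayamaAdj.comp {d₁ : P₂ →ₗ[R] P₁} {d₁' : I₂ →ₗ[R] I₁} {d₀ : P₁ →ₗ[R] P₀}
    {d₀' : I₁ →ₗ[R] I₀} (h₁ : IsNakayamaAdj t₂ t₁ d₁ d₁') (h₀ : IsNakayamaAdj t₁ t₀ d₀ d₀') :
    IsNakayamaAdj t₂ t₀ (d₀ ∘ₗ d₁) (d₀' ∘ₗ d₁') := fun c => by
  rw [← LinearMap.comp_assoc, h₁, ← LinearMap.comp_assoc, h₀, LinearMap.comp_assoc]

lemma IsNakayamaAdj.id (t₁ : (P₁ →ₗ[R] I₁) →+ K) :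
    IsNakayamaAdj t₁ t₁ LinearMap.id LinearMap.id := fun c => rfl

lemma IsNakayamaAdj.sub {d e : P₁ →ₗ[R] P₀} {d' e' : I₁ →ₗ[R] I₀}
    (h : IsNakayamaAdj t₁ t₀ d d') (h' : IsNakayamaAdj t₁ t₀ e e') :
    IsNakayamaAdj t₁ t₀ (d - e) (d' - e') := fun c => by
  rw [LinearMap.comp_sub, LinearMap.sub_comp, map_sub, map_sub, h, h']

lemma IsNakayamaAdj.unique_right [Module.Finite R I₁] (ht₀ : IsNakayamaTrace t₀)
    {d : P₁ →ₗ[R] P₀} {d' e' : I₁ →ₗ[R] I₀}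
    (h : IsNakayamaAdj t₁ t₀ d d') (h' : IsNakayamaAdj t₁ t₀ d e') : d' = e' :=
  sub_eq_zero.1 (ht₀.right _ _ fun a => by
    rw [LinearMap.sub_comp, map_sub, ← h, ← h', sub_self])

lemma IsNakayamaAdj.unique_left [Module.Finite R P₀] (ht₁ : IsNakayamaTrace t₁)
    {d e : P₁ →ₗ[R] P₀} {d' : I₁ →ₗ[R] I₀}
    (h : IsNakayamaAdj t₁ t₀ d d') (h' : IsNakayamaAdj t₁ t₀ e d') : d = e :=
  sub_eq_zero.1 (ht₁.left _ _ fun a => by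
    rw [LinearMap.comp_sub, map_sub, h, h', sub_self])

variable [FiniteDimensional K R] [Module.Finite R P₂] [Module.Finite R P₁] [Module.Finite R P₀]
  [Module.Finite R I₂] [Module.Finite R I₁] [Module.Finite R I₀]

lemma IsNakayamaTrace.exists_adj_right (ht₁ : IsNakayamaTrace t₁) (ht₀ : IsNakayamaTrace t₀)
    (d : P₁ →ₗ[R] P₀) : ∃ d', IsNakayamaAdj t₁ t₀ d d' := by
  obtain ⟨d', hd'⟩ := (ht₀.representable I₁).1 _ (ht₁.isKLinear.comp (isKMap_precomp K d))
  exact ⟨d', fun c => (hd' c).symm⟩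

lemma IsNakayamaTrace.exists_adj_left (ht₁ : IsNakayamaTrace t₁) (ht₀ : IsNakayamaTrace t₀)
    (d' : I₁ →ₗ[R] I₀) : ∃ d, IsNakayamaAdj t₁ t₀ d d' := by
  obtain ⟨d, hd⟩ := (ht₁.representable P₀).2 _ (ht₀.isKLinear.comp (isKMap_postcomp K d'))
  exact ⟨d, hd⟩

lemma IsNakayamaAdj.exact_of_exact (ht₂ : IsNakayamaTrace t₂) (ht₁ : IsNakayamaTrace t₁)
    {d₁ : P₂ →ₗ[R] P₁} {d₁' : I₂ →ₗ[R] I₁} {d₀ : P₁ →ₗ[R] P₀}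
    {d₀' : I₁ →ₗ[R] I₀} (h₁ : IsNakayamaAdj t₂ t₁ d₁ d₁') (h₀ : IsNakayamaAdj t₁ t₀ d₀ d₀')
    (ht₀ : IsNakayamaTrace t₀)
    (Y : Type u) [AddCommGroup Y] [Module R Y] [Module.Finite R Y]
    (h : Function.Exact (fun c : P₀ →ₗ[R] Y => c.comp d₀) (fun c : P₁ →ₗ[R] Y => c.comp d₁)) :
    Function.Exact (fun c : Y →ₗ[R] I₂ => d₁'.comp c) (fun c : Y →ₗ[R] I₁ => d₀'.comp c) := by
  intro b
  constructor
  · intro hb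
    replace hb : d₀' ∘ₗ b = 0 := hb
    obtain ⟨φ, hφ, hφ'⟩ := IsKLinear.exists_factor K (ht₁.isKLinear.comp (isKMap_postcomp K b))
      (isKMap_precomp K (B := Y) d₁) (fun v hv => by
        obtain ⟨c, rfl⟩ := (h v).1 hv
        change t₁ ((b ∘ₗ c) ∘ₗ d₀) = 0
        rw [h₀, ← LinearMap.comp_assoc, hb, LinearMap.zero_comp, map_zero])
    obtain ⟨b', hb'⟩ := (ht₂.representable Y).1 φ hφ
    refine ⟨b', sub_eq_zero.1 (ht₁.right Y _ fun a => ?_)⟩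
    rw [LinearMap.sub_comp, map_sub, sub_eq_zero, LinearMap.comp_assoc, ← h₁, LinearMap.comp_assoc,
      hb']
    exact hφ' a
  · rintro ⟨b', rfl⟩
    refine ht₀.right Y _ fun c => ?_
    have h0 : (c ∘ₗ d₀) ∘ₗ d₁ = 0 := h.apply_apply_eq_zero c
    have := (h₁.comp h₀) (b' ∘ₗ c)
    rw [LinearMap.comp_assoc, ← LinearMap.comp_assoc d₁, h0, LinearMap.comp_zero, map_zero] at this
    exact this.symm

lemma IsNakayamaAdj.exact_of_exact' (ht₂ : IsNakayamaTrace t₂) (ht₁ : IsNakayamaTrace t₁)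
    {d₁ : P₂ →ₗ[R] P₁} {d₁' : I₂ →ₗ[R] I₁} {d₀ : P₁ →ₗ[R] P₀}
    {d₀' : I₁ →ₗ[R] I₀} (h₁ : IsNakayamaAdj t₂ t₁ d₁ d₁') (h₀ : IsNakayamaAdj t₁ t₀ d₀ d₀')
    (ht₀ : IsNakayamaTrace t₀)
    (Y : Type u) [AddCommGroup Y] [Module R Y] [Module.Finite R Y]
    (h : Function.Exact (fun c : Y →ₗ[R] I₂ => d₁'.comp c) (fun c : Y →ₗ[R] I₁ => d₀'.comp c)) :
    Function.Exact (fun c : P₀ →ₗ[R] Y => c.comp d₀) (fun c : P₁ →ₗ[R] Y => c.comp d₁) := by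
  intro a
  constructor
  · intro ha
    obtain ⟨φ, hφ, hφ'⟩ := IsKLinear.exists_factor K (ht₁.isKLinear.comp (isKMap_precomp K a))
      (isKMap_postcomp K (A := Y) d₀') (fun v hv => by
        obtain ⟨c, rfl⟩ := (h v).1 hv
        change t₁ (d₁' ∘ₗ (c ∘ₗ a)) = 0
        rw [← h₁, LinearMap.comp_assoc]
        have : a ∘ₗ d₁ = 0 := ha
        rw [this, LinearMap.comp_zero, map_zero])
    obtain ⟨a', ha'⟩ := (ht₀.representable Y).2 φ hφ
    refine ⟨a', sub_eq_zero.1 (ht₁.left Y _ fun b => ?_)⟩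
    rw [LinearMap.comp_sub, map_sub, sub_eq_zero, ← LinearMap.comp_assoc, h₀,
      ← LinearMap.comp_assoc, ha']
    exact hφ' b
  · rintro ⟨a', rfl⟩
    refine ht₂.left Y _ fun c => ?_
    change t₂ (c ∘ₗ (a' ∘ₗ d₀) ∘ₗ d₁) = 0
    have h0 : d₀' ∘ₗ d₁' ∘ₗ c = 0 := h.apply_apply_eq_zero c
    have := (h₁.comp h₀) (c ∘ₗ a')
    have e : (d₀' ∘ₗ d₁') ∘ₗ c ∘ₗ a' = 0 := by
      change (d₀' ∘ₗ d₁' ∘ₗ c) ∘ₗ a' = 0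
      rw [h0, LinearMap.zero_comp]
    rw [e, map_zero] at this
    exact this

lemma IsNakayamaAdj.eq_zero_of_surjective (ht₁ : IsNakayamaTrace t₁)
    {d₀ : P₁ →ₗ[R] P₀} {d₀' : I₁ →ₗ[R] I₀} (h₀ : IsNakayamaAdj t₁ t₀ d₀ d₀')
    {Y : Type u} [AddCommGroup Y] [Module R Y] [Module.Finite R Y]
    (h : ∀ a : P₁ →ₗ[R] Y, ∃ c : P₀ →ₗ[R] Y, c ∘ₗ d₀ = a) (b : Y →ₗ[R] I₁) (hb : d₀' ∘ₗ b = 0) :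
    b = 0 :=
  ht₁.right Y b fun a => by
    obtain ⟨c, rfl⟩ := h a
    rw [← LinearMap.comp_assoc, h₀, ← LinearMap.comp_assoc, hb, LinearMap.zero_comp, map_zero]

lemma IsNakayamaAdj.exists_lift_of_injective (ht₁ : IsNakayamaTrace t₁) (ht₀ : IsNakayamaTrace t₀)
    {d₀ : P₁ →ₗ[R] P₀} {d₀' : I₁ →ₗ[R] I₀} (h₀ : IsNakayamaAdj t₁ t₀ d₀ d₀')
    {Y : Type u} [AddCommGroup Y] [Module R Y] [Module.Finite R Y]
    (h : ∀ c : P₀ →ₗ[R] Y, c ∘ₗ d₀ = 0 → c = 0) (g : Y →ₗ[R] I₀) :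
    ∃ b : Y →ₗ[R] I₁, d₀' ∘ₗ b = g := by
  obtain ⟨φ, hφ, hφ'⟩ := IsKLinear.exists_factor K (ht₀.isKLinear.comp (isKMap_postcomp K g))
    (isKMap_precomp K (B := Y) d₀) (fun v hv => by rw [h v hv, map_zero])
  obtain ⟨b, hb⟩ := (ht₁.representable Y).1 φ hφ
  refine ⟨b, sub_eq_zero.1 (ht₀.right Y _ fun c => ?_)⟩
  rw [LinearMap.sub_comp, map_sub, sub_eq_zero, LinearMap.comp_assoc, ← h₀, LinearMap.comp_assoc, hb]
  exact hφ' c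

end Adjoint

end NakayamaTrace

section Partner

variable {R : Type u} [Ring R] {K : Type u} [Field K] [Algebra K R]

/-- Elements of a module are separated by maps to the dual of the regular module. -/
lemma exists_hom_dual_apply_one_ne_zero (R K : Type u) [Ring R] [Field K] [Algebra K R] {Y : Type u}
    [AddCommGroup Y] [Module R Y] {y : Y} (hy : y ≠ 0) :
    ∃ g : Y →ₗ[R] OpDual R K R, OpDual.toL R K R (g y) 1 ≠ 0 := by
  let _ := Module.compHom Y (algebraMap K R)
  have := isScalarTower_compHom (R := R) K Y
  obtain ⟨l, hl⟩ : ∃ l : Y →ₗ[K] K, l y ≠ 0 := by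
    by_contra! h
    exact hy ((Module.forall_dual_apply_eq_zero_iff K y).1 h)
  let g : Y →ₗ[R] OpDual R K R :=
    { toFun := fun x =>
        ({ toFun := fun s => l (s • x)
           map_add' := fun a b => by rw [add_smul, map_add]
           map_smul' := fun c a => by
            rw [smul_assoc, map_smul, RingHom.id_apply] } : R →ₗ[K] K)
      map_add' := fun a b => OpDual.toL_injective R K R <| LinearMap.ext fun s => by
        change l (s • (a + b)) = l (s • a) + l (s • b)
        rw [smul_add, map_add]
      map_smul' := fun r a => OpDual.toL_injective R K R <| LinearMap.ext fun s => by
        change l (s • r • a) = l ((s * r) • a)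
        rw [mul_smul] }
  refine ⟨g, ?_⟩
  change l ((1 : R) • y) ≠ 0
  rwa [one_smul]

lemma finite_opDual (R K : Type u) [Ring R] [Field K] [Algebra K R] [FiniteDimensional K R] :
    Module.Finite R (OpDual R K R) := by
  have : Module.Finite K (OpDual R K R) := inferInstanceAs (Module.Finite K (R →ₗ[K] K))
  exact Module.Finite.of_restrictScalars_finite K R _

/-- Evaluation at `1`, the trace pairing the regular module with its dual. -/
def regularTrace (R K : Type u) [Ring R] [Field K] [Algebra K R] : (R →ₗ[R] OpDual R K R) →+ K :=
  AddMonoidHom.mk' (fun c => OpDual.toL R K R (c 1) 1) fun _ _ => rfl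

lemma isNakayamaTrace_regularTrace (R K : Type u) [Ring R] [Field K] [Algebra K R] :
    IsNakayamaTrace (regularTrace R K) where
  isKLinear c g h hh := by
    change OpDual.toL R K R (h 1) 1 = c * OpDual.toL R K R (g 1) 1
    rw [hh, algebraMap_smul]
    rfl
  left Y _ _ _ a ha := by
    by_contra h0
    have h1 : a 1 ≠ 0 := fun h => h0 (LinearMap.ext_ring h)
    obtain ⟨g, hg⟩ := exists_hom_dual_apply_one_ne_zero R K h1
    exact hg (ha g)
  right Y _ _ _ b hb := by
    refine LinearMap.ext fun y => OpDual.toL_injective R K R <| LinearMap.ext fun s => ?_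
    have : OpDual.toL R K R (b ((1 : R) • s • y)) 1 = 0 := hb (LinearMap.toSpanSingleton R Y (s • y))
    rw [one_smul, map_smul, OpDual.smul_toL, op_smul_eq_mul, one_mul] at this
    exact this

variable {P I P' I' : Type u} [AddCommGroup P] [Module R P] [AddCommGroup I] [Module R I]
  [AddCommGroup P'] [Module R P'] [AddCommGroup I'] [Module R I']
  {t : (P →ₗ[R] I) →+ K} {t' : (P' →ₗ[R] I') →+ K}

/-- The sum of two traces. -/
def prodTrace (t : (P →ₗ[R] I) →+ K) (t' : (P' →ₗ[R] I') →+ K) :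
    (P × P' →ₗ[R] I × I') →+ K :=
  t.comp ((precomp I (LinearMap.inl R P P')).comp (postcomp (P × P') (LinearMap.fst R I I'))) +
    t'.comp ((precomp I' (LinearMap.inr R P P')).comp (postcomp (P × P') (LinearMap.snd R I I')))

lemma prodTrace_apply (t : (P →ₗ[R] I) →+ K) (t' : (P' →ₗ[R] I') →+ K)
    (c : P × P' →ₗ[R] I × I') :
    prodTrace t t' c = t (LinearMap.fst R I I' ∘ₗ c ∘ₗ LinearMap.inl R P P') +
      t' (LinearMap.snd R I I' ∘ₗ c ∘ₗ LinearMap.inr R P P') := rfl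

lemma IsNakayamaTrace.prod (ht : IsNakayamaTrace t) (ht' : IsNakayamaTrace t') :
    IsNakayamaTrace (prodTrace t t') where
  isKLinear c g h hh := by
    rw [prodTrace_apply, prodTrace_apply, mul_add]
    congr 1
    · refine ht.isKLinear c _ _ fun x => ?_
      simp [hh]
    · refine ht'.isKLinear c _ _ fun x => ?_
      simp [hh]
  left Y _ _ _ a ha := by
    refine LinearMap.prod_ext (ht.left Y _ fun b => ?_) (ht'.left Y _ fun b => ?_)
    · have := ha (LinearMap.inl R I I' ∘ₗ b)
      rw [prodTrace_apply] at this
      have e : LinearMap.snd R I I' ∘ₗ ((LinearMap.inl R I I' ∘ₗ b) ∘ₗ a) ∘ₗ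
        LinearMap.inr R P P' = 0 := rfl
      rwa [e, map_zero, add_zero] at this
    · have := ha (LinearMap.inr R I I' ∘ₗ b)
      rw [prodTrace_apply] at this
      have e : LinearMap.fst R I I' ∘ₗ ((LinearMap.inr R I I' ∘ₗ b) ∘ₗ a) ∘ₗ
        LinearMap.inl R P P' = 0 := rfl
      rwa [e, map_zero, zero_add] at this
  right Y _ _ _ b hb := by
    have h1 : LinearMap.fst R I I' ∘ₗ b = 0 := ht.right Y _ fun a => by
      have := hb (a ∘ₗ LinearMap.fst R P P')
      rw [prodTrace_apply] at this
      have e : LinearMap.snd R I I' ∘ₗ (b ∘ₗ a ∘ₗ LinearMap.fst R P P') ∘ₗ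
        LinearMap.inr R P P' = 0 := LinearMap.ext fun x => by simp
      rwa [e, map_zero, add_zero] at this
    have h2 : LinearMap.snd R I I' ∘ₗ b = 0 := ht'.right Y _ fun a => by
      have := hb (a ∘ₗ LinearMap.snd R P P')
      rw [prodTrace_apply] at this
      have e : LinearMap.fst R I I' ∘ₗ (b ∘ₗ a ∘ₗ LinearMap.snd R P P') ∘ₗ
        LinearMap.inl R P P' = 0 := LinearMap.ext fun x => by simp
      rwa [e, map_zero, zero_add] at this
    exact LinearMap.ext fun y => Prod.ext (LinearMap.congr_fun h1 y) (LinearMap.congr_fun h2 y)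

/-- The sum of `n` copies of a trace. -/
def powTrace (t : (P →ₗ[R] I) →+ K) (n : ℕ) : ((Fin n → P) →ₗ[R] (Fin n → I)) →+ K :=
  ∑ k, t.comp ((precomp I (LinearMap.single R (fun _ : Fin n => P) k)).comp
    (postcomp (Fin n → P) (LinearMap.proj k)))

lemma powTrace_apply (t : (P →ₗ[R] I) →+ K) (n : ℕ) (c : (Fin n → P) →ₗ[R] (Fin n → I)) :
    powTrace t n c =
      ∑ k, t (LinearMap.proj k ∘ₗ c ∘ₗ LinearMap.single R (fun _ : Fin n => P) k) := by
  rw [powTrace, AddMonoidHom.finsetSum_apply]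
  rfl

lemma IsNakayamaTrace.pow (ht : IsNakayamaTrace t) (n : ℕ) : IsNakayamaTrace (powTrace t n) where
  isKLinear c g h hh := by
    rw [powTrace_apply, powTrace_apply, Finset.mul_sum]
    refine Finset.sum_congr rfl fun k _ => ht.isKLinear c _ _ fun x => ?_
    simp [hh]
  left Y _ _ _ a ha := by
    refine LinearMap.pi_ext' fun k => ht.left Y _ fun b => ?_
    have := ha (LinearMap.single R (fun _ : Fin n => I) k ∘ₗ b)
    rw [powTrace_apply, Finset.sum_eq_single k] at this
    · convert this using 2
      ext x
      simp
    · intro l _ hl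
      convert map_zero t
      ext x
      simp [hl]
    · simp
  right Y _ _ _ b hb := by
    refine LinearMap.ext fun y => funext fun k => ?_
    have hk : LinearMap.proj k ∘ₗ b = 0 := ht.right Y _ fun a => by
      have := hb (a ∘ₗ LinearMap.proj k)
      rw [powTrace_apply, Finset.sum_eq_single k] at this
      · convert this using 2
        ext x
        simp
      · intro l _ hl
        convert map_zero t
        ext x
        simp [hl.symm]
      · simp
    exact LinearMap.congr_fun hk y

/-- A trace restricts along compatible retractions. -/
lemma IsNakayamaTrace.retract (ht : IsNakayamaTrace t) (i : P' →ₗ[R] P) (p : P →ₗ[R] P')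
    (hpi : ∀ x, p (i x) = x) (j : I' →ₗ[R] I) (q : I →ₗ[R] I') (hqj : ∀ x, q (j x) = x)
    (h : IsNakayamaAdj t t (i ∘ₗ p) (j ∘ₗ q)) :
    IsNakayamaTrace (t.comp ((precomp I p).comp (postcomp P' j))) where
  isKLinear := by
    have := (ht.isKLinear.comp (isKMap_precomp K p)).comp (isKMap_postcomp K (A := P') j)
    exact this
  left Y _ _ _ a ha := by
    have : a ∘ₗ p = 0 := ht.left Y _ fun b => by
      have h1 := h (b ∘ₗ a ∘ₗ p)
      have e : (b ∘ₗ a ∘ₗ p) ∘ₗ i ∘ₗ p = b ∘ₗ a ∘ₗ p := LinearMap.ext fun x => by simp [hpi]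
      rw [e] at h1
      exact h1.trans (ha (q ∘ₗ b))
    exact LinearMap.ext fun x => by simpa [hpi] using LinearMap.congr_fun this (i x)
  right Y _ _ _ b hb := by
    have : j ∘ₗ b = 0 := ht.right Y _ fun a => by
      have h1 := h (j ∘ₗ b ∘ₗ a)
      have e : (j ∘ₗ q) ∘ₗ j ∘ₗ b ∘ₗ a = j ∘ₗ b ∘ₗ a := LinearMap.ext fun x => by simp [hqj]
      rw [e] at h1
      exact h1.symm.trans (hb (a ∘ₗ i))
    exact LinearMap.ext fun x => by
      simpa [hqj] using congrArg q (LinearMap.congr_fun this x)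

lemma eq_zero_of_forall_hom_dual (R K : Type u) [Ring R] [Field K] [Algebra K R] {Y : Type u}
    [AddCommGroup Y] [Module R Y] {y : Y} (hy : ∀ g : Y →ₗ[R] OpDual R K R, g y = 0) : y = 0 := by
  by_contra h
  obtain ⟨g, hg⟩ := exists_hom_dual_apply_one_ne_zero R K h
  rw [hy] at hg
  exact hg rfl

variable [FiniteDimensional K R]

/-- Idempotents corresponding to each other split to Nakayama partners. -/
lemma IsNakayamaTrace.exists_partner_of_retract [Module.Finite R P] [Module.Finite R I]
    (ht : IsNakayamaTrace t) (i : P' →ₗ[R] P) (p : P →ₗ[R] P') (hpi : ∀ x, p (i x) = x) :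
    ∃ I' : ModuleCat.{u} R, Module.Finite R I' ∧
      ∃ t' : (P' →ₗ[R] I') →+ K, IsNakayamaTrace t' := by
  have : IsNoetherianRing R := IsNoetherianRing.of_finite K R
  obtain ⟨e, he⟩ := ht.exists_adj_right ht (i ∘ₗ p)
  have hee : e ∘ₗ e = e := (he.comp he).unique_right ht (by
    have h1 : (i ∘ₗ p) ∘ₗ i ∘ₗ p = i ∘ₗ p := LinearMap.ext fun x => by simp [hpi]
    rwa [h1])
  refine ⟨ModuleCat.of R (LinearMap.range e), inferInstance, _,
    ht.retract i p hpi (LinearMap.range e).subtype e.rangeRestrict ?_ ?_⟩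
  · rintro ⟨_, x, rfl⟩
    exact Subtype.ext (LinearMap.congr_fun hee x)
  · exact he

lemma IsNakayamaTrace.exists_projective_partner_of_retract [Module.Finite R P] [Module.Finite R I]
    [Module.Projective R P] (ht : IsNakayamaTrace t) (j : I' →ₗ[R] I) (q : I →ₗ[R] I')
    (hqj : ∀ x, q (j x) = x) :
    ∃ P' : ModuleCat.{u} R, Module.Finite R P' ∧ Module.Projective R P' ∧
      ∃ t' : (P' →ₗ[R] I') →+ K, IsNakayamaTrace t' := by
  have : IsNoetherianRing R := IsNoetherianRing.of_finite K R
  obtain ⟨e, he⟩ := ht.exists_adj_left ht (j ∘ₗ q)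
  have hee : e ∘ₗ e = e := (he.comp he).unique_left ht (by
    have h1 : (j ∘ₗ q) ∘ₗ j ∘ₗ q = j ∘ₗ q := LinearMap.ext fun x => by simp [hqj]
    rwa [h1])
  have hr : ∀ x, e.rangeRestrict ((LinearMap.range e).subtype x) = x := by
    rintro ⟨_, x, rfl⟩
    exact Subtype.ext (LinearMap.congr_fun hee x)
  exact ⟨ModuleCat.of R (LinearMap.range e), inferInstance,
    Module.Projective.of_split (LinearMap.range e).subtype e.rangeRestrict (LinearMap.ext hr), _,
    ht.retract (LinearMap.range e).subtype e.rangeRestrict hr j q hqj he⟩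

/-- Every finitely generated projective module has a Nakayama partner. -/
lemma exists_injective_partner (R K : Type u) [Ring R] [Field K] [Algebra K R]
    [FiniteDimensional K R] (P : Type u) [AddCommGroup P] [Module R P] [Module.Finite R P]
    [Module.Projective R P] :
    ∃ I : ModuleCat.{u} R, Module.Finite R I ∧
      ∃ t : (P →ₗ[R] I) →+ K, IsNakayamaTrace t := by
  have := finite_opDual R K
  obtain ⟨n, π, hπ⟩ := Module.Finite.exists_fin' R P
  obtain ⟨s, hs⟩ := Module.projective_lifting_property π LinearMap.id hπ
  exact ((isNakayamaTrace_regularTrace R K).pow n).exists_partner_of_retract s π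
    (LinearMap.congr_fun hs)

/-- Every finitely generated injective module has a projective Nakayama partner. -/
lemma exists_projective_partner (R K : Type u) [Ring R] [Field K] [Algebra K R]
    [FiniteDimensional K R] (I : Type u) [AddCommGroup I] [Module R I] [Module.Finite R I]
    [Module.Injective R I] :
    ∃ P : ModuleCat.{u} R, Module.Finite R P ∧ Module.Projective R P ∧
      ∃ t : (P →ₗ[R] I) →+ K, IsNakayamaTrace t := by
  have := finite_opDual R K
  obtain ⟨n, φ, -, hφ⟩ := exists_finite_generating_maps (R := R) K I (OpDual R K R)
  have hinj : Injective (LinearMap.pi φ) := by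
    refine LinearMap.ker_eq_bot.1 (LinearMap.ker_eq_bot'.2 fun x hx => ?_)
    refine eq_zero_of_forall_hom_dual R K fun g => ?_
    obtain ⟨c, hc⟩ := hφ g
    rw [hc]
    exact Finset.sum_eq_zero fun k _ => by
      rw [show φ k x = 0 from congrFun hx k, map_zero]
  obtain ⟨q, hq⟩ := Module.Injective.out (LinearMap.pi φ) hinj LinearMap.id
  exact ((isNakayamaTrace_regularTrace R K).pow n).exists_projective_partner_of_retract
    (LinearMap.pi φ) q hq

end Partner

section GPStep

variable {R : Type u} [Ring R]

/-- A short exact sequence `0 → Z → P → Z' → 0` with `P` finitely generated projective which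
remains exact after applying `Hom(-, R)`. -/
structure GPStep (Z Z' : ModuleCat.{u} R) where
  P : ModuleCat.{u} R
  i : Z →ₗ[R] P
  p : P →ₗ[R] Z'
  finite : Module.Finite R P
  projective : Module.Projective R P
  injective : Injective i
  surjective : Surjective p
  exact : Function.Exact i p
  extend : ∀ c : Z →ₗ[R] R, ∃ g : P →ₗ[R] R, g ∘ₗ i = c

namespace GPStep

variable {Z Z' : ModuleCat.{u} R}

lemma extend_projective (s : GPStep Z Z') {Q : Type u} [AddCommGroup Q] [Module R Q]
    [Module.Finite R Q] [Module.Projective R Q] (c : Z →ₗ[R] Q) :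
    ∃ g : s.P →ₗ[R] Q, g ∘ₗ s.i = c := by
  obtain ⟨n, π, hπ⟩ := Module.Finite.exists_fin' R Q
  obtain ⟨σ, hσ⟩ := Module.projective_lifting_property π LinearMap.id hπ
  choose g hg using fun k => s.extend (LinearMap.proj k ∘ₗ σ ∘ₗ c)
  refine ⟨π ∘ₗ LinearMap.pi g, LinearMap.ext fun z => ?_⟩
  have : LinearMap.pi g (s.i z) = σ (c z) := funext fun k => LinearMap.congr_fun (hg k) z
  change π (LinearMap.pi g (s.i z)) = c z
  rw [this]
  exact LinearMap.congr_fun hσ (c z)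

/-- The power of a step. -/
def pow (s : GPStep Z Z') (n : ℕ) :
    GPStep (ModuleCat.of R (Fin n → Z)) (ModuleCat.of R (Fin n → Z')) where
  P := ModuleCat.of R (Fin n → s.P)
  i := LinearMap.pi fun k => s.i ∘ₗ LinearMap.proj k
  p := LinearMap.pi fun k => s.p ∘ₗ LinearMap.proj k
  finite := by
    have := s.finite
    exact Module.Finite.pi
  projective := by
    have := s.projective
    exact Module.Projective.of_equiv
      (DFinsupp.linearEquivFunOnFintype (R := R) (M := fun _ : Fin n => (s.P : Type u)))
  injective := fun x y h => funext fun k => s.injective (congrFun h k)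
  surjective := fun y => ⟨fun k => (s.surjective (y k)).choose, funext fun k =>
    (s.surjective (y k)).choose_spec⟩
  exact := fun y => by
    constructor
    · intro h
      exact ⟨fun k => ((s.exact (y k)).1 (congrFun h k)).choose, funext fun k =>
        ((s.exact (y k)).1 (congrFun h k)).choose_spec⟩
    · rintro ⟨x, rfl⟩
      exact funext fun k => s.exact.apply_apply_eq_zero (x k)
  extend := fun c => by
    choose g hg using fun k => s.extend (c ∘ₗ LinearMap.single R (fun _ : Fin n => (Z : Type u)) k)
    refine ⟨LinearMap.lsum R _ ℕ g, LinearMap.pi_ext' fun k => ?_⟩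
    rw [← hg k]
    ext x
    simp [LinearMap.lsum_apply, Pi.single_apply, apply_ite]

variable (Q : ModuleCat.{u} R) [Module.Finite R Q] [Module.Projective R Q]

/-- Adding a projective module to the left and middle terms of a step. -/
def prodLeft (s : GPStep Z Z') : GPStep (ModuleCat.of R (Z × Q)) Z' where
  P := ModuleCat.of R (s.P × Q)
  i := s.i.prodMap LinearMap.id
  p := s.p ∘ₗ LinearMap.fst R _ _
  finite := by
    have := s.finite
    exact Module.Finite.prod
  projective := by
    have := s.projective
    exact inferInstanceAs (Module.Projective R (s.P × Q))
  injective := fun x y h => Prod.ext (s.injective (congrArg Prod.fst h)) (congrArg Prod.snd h :)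
  surjective := s.surjective.comp LinearMap.fst_surjective
  exact := fun y => by
    constructor
    · intro h
      obtain ⟨x, hx⟩ := (s.exact y.1).1 h
      exact ⟨(x, y.2), Prod.ext hx rfl⟩
    · rintro ⟨x, rfl⟩
      exact s.exact.apply_apply_eq_zero x.1
  extend := fun c => by
    obtain ⟨g, hg⟩ := s.extend (c ∘ₗ LinearMap.inl R _ _)
    refine ⟨g.coprod (c ∘ₗ LinearMap.inr R _ _), LinearMap.prod_ext ?_ ?_⟩
    · rw [← hg]
      exact LinearMap.ext fun x =>
        (congrArg (g (s.i x) + ·) (map_zero (c ∘ₗ LinearMap.inr R _ _))).trans (add_zero _)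
    · exact LinearMap.ext fun x =>
        (congrArg (g · + c (0, x)) (map_zero s.i)).trans
          ((congrArg (· + c (0, x)) (map_zero g)).trans (zero_add _))

/-- Adding a projective module to the middle and right terms of a step. -/
def prodRight (s : GPStep Z Z') : GPStep Z (ModuleCat.of R (Z' × Q)) where
  P := ModuleCat.of R (s.P × Q)
  i := LinearMap.inl R _ _ ∘ₗ s.i
  p := s.p.prodMap LinearMap.id
  finite := by
    have := s.finite
    exact Module.Finite.prod
  projective := by
    have := s.projective
    exact inferInstanceAs (Module.Projective R (s.P × Q))
  injective := fun x y h => s.injective (congrArg Prod.fst h)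
  surjective := fun y => by
    obtain ⟨x, hx⟩ := s.surjective y.1
    exact ⟨(x, y.2), Prod.ext hx rfl⟩
  exact := fun y => by
    constructor
    · intro h
      obtain ⟨x, hx⟩ := (s.exact y.1).1 (congrArg Prod.fst h)
      exact ⟨x, Prod.ext hx (congrArg Prod.snd h).symm⟩
    · rintro ⟨x, rfl⟩
      exact Prod.ext (s.exact.apply_apply_eq_zero x) rfl
  extend := fun c => by
    obtain ⟨g, hg⟩ := s.extend c
    exact ⟨g ∘ₗ LinearMap.fst R _ _, hg⟩

end GPStep

/-- `M` is a direct summand of `W`, without choosing the splitting. -/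
def IsRetract (M W : ModuleCat.{u} R) : Prop :=
  ∃ (i : M →ₗ[R] W) (p : W →ₗ[R] M), ∀ x, p (i x) = x

lemma GPStep.exists_of_isRetract_left {W V M : ModuleCat.{u} R} (s : GPStep W V)
    (h : IsRetract M W) :
    ∃ M' : ModuleCat.{u} R, Nonempty (GPStep M M') ∧
      IsRetract M' (ModuleCat.of R (V × s.P)) := by
  obtain ⟨i, p, hpi⟩ := h
  have := s.finite
  have := s.projective
  obtain ⟨e, he⟩ := s.extend_projective (s.i ∘ₗ i ∘ₗ p)
  have he' : ∀ w, e (s.i w) = s.i (i (p w)) := LinearMap.congr_fun he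
  let N := LinearMap.range (s.i ∘ₗ i)
  refine ⟨ModuleCat.of R (s.P ⧸ N), ⟨⟨s.P, s.i ∘ₗ i, N.mkQ, inferInstance, inferInstance,
    ?_, N.mkQ_surjective, ?_, ?_⟩⟩, ?_⟩
  · exact s.injective.comp fun x y hxy => by rw [← hpi x, hxy, hpi]
  · exact LinearMap.exact_iff.2 (Submodule.ker_mkQ N)
  · intro c
    obtain ⟨g, hg⟩ := s.extend (c ∘ₗ p)
    refine ⟨g, LinearMap.ext fun x => ?_⟩
    change (g ∘ₗ s.i) (i x) = c x
    rw [hg, LinearMap.comp_apply, hpi]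
  · let u : (s.P ⧸ N) →ₗ[R] V := N.liftQ s.p (by
      rintro _ ⟨x, rfl⟩
      exact s.exact.apply_apply_eq_zero _)
    obtain ⟨v, hv⟩ := exists_factor_of_surjective s.p s.surjective (N.mkQ ∘ₗ e) (fun a ha => by
      obtain ⟨w, rfl⟩ := (s.exact a).1 ha
      change N.mkQ (e (s.i w)) = 0
      rw [he', Submodule.mkQ_apply, Submodule.Quotient.mk_eq_zero]
      exact ⟨p w, rfl⟩)
    let w : (s.P ⧸ N) →ₗ[R] s.P := N.liftQ (LinearMap.id - e) (by
      rintro _ ⟨x, rfl⟩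
      change s.i (i x) - e (s.i (i x)) = 0
      rw [he', hpi, sub_self])
    refine ⟨u.prod w, v.coprod N.mkQ, fun x => ?_⟩
    obtain ⟨x, rfl⟩ := N.mkQ_surjective x
    change v (s.p x) + N.mkQ (x - e x) = N.mkQ x
    rw [hv, map_sub, LinearMap.comp_apply, add_sub_cancel]

lemma GPStep.exists_of_isRetract_right {V W M X : ModuleCat.{u} R} (s : GPStep V W)
    (h : IsRetract M W) (π : X →ₗ[R] M) (hπ : Surjective π) [Module.Projective R X] :
    (∀ c : LinearMap.ker π →ₗ[R] R, ∃ g : X →ₗ[R] R, g ∘ₗ (LinearMap.ker π).subtype = c) ∧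
      IsRetract (ModuleCat.of R (LinearMap.ker π)) (ModuleCat.of R (V × X)) := by
  obtain ⟨i, p, hpi⟩ := h
  have := s.projective
  obtain ⟨f, hf⟩ := Module.projective_lifting_property s.p (i ∘ₗ π) s.surjective
  obtain ⟨g, hg⟩ := Module.projective_lifting_property π (p ∘ₗ s.p) hπ
  have hf' : ∀ x, s.p (f x) = i (π x) := LinearMap.congr_fun hf
  have hg' : ∀ x, π (g x) = p (s.p x) := LinearMap.congr_fun hg
  let w : X →ₗ[R] LinearMap.ker π := (g ∘ₗ f - LinearMap.id).codRestrict _ fun x => by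
    rw [LinearMap.mem_ker, LinearMap.sub_apply, LinearMap.comp_apply, map_sub, hg', hf', hpi,
      LinearMap.id_apply, sub_self]
  obtain ⟨f', hf''⟩ := exists_factor_of_injective s.i s.injective (f ∘ₗ (LinearMap.ker π).subtype)
    (fun x => (s.exact _).1 (by
      change s.p (f x) = 0
      rw [hf', LinearMap.mem_ker.1 x.2, map_zero]))
  let g' : V →ₗ[R] LinearMap.ker π := (g ∘ₗ s.i).codRestrict _ fun x => by
    rw [LinearMap.mem_ker, LinearMap.comp_apply, hg', s.exact.apply_apply_eq_zero, map_zero]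
  have key : ∀ x : LinearMap.ker π, g' (f' x) - w x = x := fun x => Subtype.ext (by
    change g (s.i (f' x)) - (g (f x) - x) = x
    rw [hf'']
    exact sub_sub_cancel _ _)
  refine ⟨fun c => ?_, f'.prod (LinearMap.ker π).subtype, g'.coprod (-w), fun x => ?_⟩
  · obtain ⟨k, hk⟩ := s.extend (c ∘ₗ g')
    refine ⟨k ∘ₗ f - c ∘ₗ w, LinearMap.ext fun x => ?_⟩
    change k (f x) - c (w x) = c x
    have h1 : s.i (f' x) = f x := hf'' x
    rw [← h1, ← LinearMap.comp_apply, hk, LinearMap.comp_apply, ← map_sub, key]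
  · change g' (f' x) + -w x = x
    rw [← sub_eq_add_neg, key]

end GPStep

section Chains

variable {R : Type u} [Ring R]

lemma IsRetract.trans {A B C : ModuleCat.{u} R} (h : IsRetract A B) (h' : IsRetract B C) :
    IsRetract A C := by
  obtain ⟨i, p, hip⟩ := h
  obtain ⟨j, q, hjq⟩ := h'
  exact ⟨j ∘ₗ i, p ∘ₗ q, fun x => by simp [hip, hjq]⟩

/-- A class of modules whose members can be continued by steps in both directions. -/
def IsStepClosed (S : ModuleCat.{u} R → Prop) : Prop :=
  (∀ Z, S Z → ∃ Z', S Z' ∧ Nonempty (GPStep Z Z')) ∧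
    ∀ Z, S Z → ∃ Z', S Z' ∧ Nonempty (GPStep Z' Z)

/-- The direct summands of `Zⁿ × Q` with `Z` in `S` and `Q` finitely generated projective. -/
def StAdd (S : ModuleCat.{u} R → Prop) (M : ModuleCat.{u} R) : Prop :=
  ∃ (Z : ModuleCat.{u} R) (n : ℕ) (Q : ModuleCat.{u} R), S Z ∧ Module.Finite R Q ∧
    Module.Projective R Q ∧ IsRetract M (ModuleCat.of R ((Fin n → Z) × Q))

variable {S : ModuleCat.{u} R → Prop}

lemma IsStepClosed.exists_right (hS : IsStepClosed S) {M : ModuleCat.{u} R} (hM : StAdd S M) :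
    ∃ M', StAdd S M' ∧ Nonempty (GPStep M M') := by
  obtain ⟨Z, n, Q, hZ, h1, h2, h3⟩ := hM
  obtain ⟨Z', hZ', ⟨s⟩⟩ := hS.1 Z hZ
  obtain ⟨M', hM', h⟩ := ((s.pow n).prodLeft Q).exists_of_isRetract_left h3
  exact ⟨M', ⟨Z', n, _, hZ', GPStep.finite _, GPStep.projective _, h⟩, hM'⟩

lemma IsStepClosed.ker (hS : IsStepClosed S) {M X : ModuleCat.{u} R} (hM : StAdd S M)
    [Module.Finite R X] [Module.Projective R X] (π : X →ₗ[R] M) (hπ : Surjective π) :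
    (∀ c : LinearMap.ker π →ₗ[R] R, ∃ g : X →ₗ[R] R, g ∘ₗ (LinearMap.ker π).subtype = c) ∧
      StAdd S (ModuleCat.of R (LinearMap.ker π)) := by
  obtain ⟨Z, n, Q, hZ, h1, h2, h3⟩ := hM
  obtain ⟨Z', hZ', ⟨s⟩⟩ := hS.2 Z hZ
  obtain ⟨he, h⟩ := ((s.pow n).prodRight Q).exists_of_isRetract_right h3 π hπ
  exact ⟨he, Z', n, X, hZ', inferInstance, inferInstance, h⟩

lemma IsStepClosed.finite (hS : IsStepClosed S) {M : ModuleCat.{u} R} (hM : StAdd S M) :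
    Module.Finite R M := by
  obtain ⟨Z, n, Q, hZ, h1, h2, i, p, hip⟩ := hM
  obtain ⟨Z', -, ⟨s⟩⟩ := hS.2 Z hZ
  have := s.finite
  have : Module.Finite R Z := Module.Finite.of_surjective s.p s.surjective
  have : Module.Finite R ((Fin n → Z) × Q) := inferInstance
  exact Module.Finite.of_surjective (M := (Fin n → Z) × Q) p fun x => ⟨i x, hip x⟩

/-- The step given by a surjection from a projective module. -/
def GPStep.ofSurjective {M X : ModuleCat.{u} R} [Module.Finite R X] [Module.Projective R X]
    (π : X →ₗ[R] M) (hπ : Surjective π)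
    (h : ∀ c : LinearMap.ker π →ₗ[R] R, ∃ g : X →ₗ[R] R, g ∘ₗ (LinearMap.ker π).subtype = c) :
    GPStep (ModuleCat.of R (LinearMap.ker π)) M where
  P := X
  i := (LinearMap.ker π).subtype
  p := π
  finite := inferInstance
  projective := inferInstance
  injective := Subtype.val_injective
  surjective := hπ
  exact := fun y => ⟨fun h => ⟨⟨y, h⟩, rfl⟩, fun ⟨x, hx⟩ => hx ▸ x.2⟩
  extend := h

lemma IsStepClosed.exists_left (hS : IsStepClosed S) {M : ModuleCat.{u} R} (hM : StAdd S M) :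
    ∃ M', StAdd S M' ∧ Nonempty (GPStep M' M) := by
  have := hS.finite hM
  obtain ⟨n, π, hπ⟩ := Module.Finite.exists_fin' R M
  have hk := hS.ker (X := ModuleCat.of R (Fin n → R)) hM π hπ
  exact ⟨_, hk.2, ⟨GPStep.ofSurjective (X := ModuleCat.of R (Fin n → R)) π hπ hk.1⟩⟩

/-- An infinite chain of related objects in a class closed under passing to related ones. -/
lemma exists_ray {α : Type*} {p : α → Prop} {β : α → α → Type*}
    (h : ∀ a, p a → ∃ b, p b ∧ Nonempty (β a b)) {a : α} (ha : p a) :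
    ∃ f : ℕ → α, Nonempty (β a (f 0)) ∧ Nonempty (∀ k, β (f k) (f (k + 1))) := by
  choose g hg hβ using h
  let F : ℕ → {a // p a} := fun k => (fun x : {a // p a} => ⟨g x.1 x.2, hg x.1 x.2⟩)^[k + 1] ⟨a, ha⟩
  refine ⟨fun k => (F k).1, hβ a ha, ⟨fun k => ?_⟩⟩
  have : F (k + 1) = ⟨g (F k).1 (F k).2, hg _ _⟩ := Function.iterate_succ_apply' _ _ _
  change β (F k).1 (F (k + 1)).1
  rw [this]
  exact (hβ _ _).some

/-- Prepend an object to a sequence. -/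
def consObj (A : ModuleCat.{u} R) (X : ℕ → ModuleCat.{u} R) : ℕ → ModuleCat.{u} R
  | 0 => A
  | k + 1 => X k

/-- Prepend a step to a sequence of steps. -/
def consStep {A : ModuleCat.{u} R} {X : ℕ → ModuleCat.{u} R} (s : GPStep A (X 0))
    (x : ∀ k, GPStep (X k) (X (k + 1))) : ∀ k, GPStep (consObj A X k) (consObj A X (k + 1))
  | 0 => s
  | k + 1 => x k

/-- Glue two sequences to a sequence indexed by the integers. -/
def intObj (X Y : ℕ → ModuleCat.{u} R) : ℤ → ModuleCat.{u} R
  | Int.ofNat k => X k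
  | Int.negSucc k => Y k

/-- Glue two sequences of steps to a sequence indexed by the integers. -/
def intStep {X Y : ℕ → ModuleCat.{u} R} (s : GPStep (Y 0) (X 0))
    (x : ∀ k, GPStep (X k) (X (k + 1))) (y : ∀ k, GPStep (Y (k + 1)) (Y k)) :
    ∀ n : ℤ, GPStep (intObj X Y n) (intObj X Y (n + 1))
  | Int.ofNat k => x k
  | Int.negSucc 0 => s
  | Int.negSucc (k + 1) => y k

variable {Z : ℤ → ModuleCat.{u} R}

/-- The differential of the complex spliced from a sequence of steps. -/
def chainD (s : ∀ n : ℤ, GPStep (Z n) (Z (n + 1))) (n : ℤ) : (s n).P →ₗ[R] (s (n + 1)).P :=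
  (s (n + 1)).i ∘ₗ (s n).p

lemma chainD_exact (s : ∀ n : ℤ, GPStep (Z n) (Z (n + 1))) (n : ℤ) :
    Function.Exact (chainD s n) (chainD s (n + 1)) := fun y => by
  constructor
  · intro h
    obtain ⟨z, rfl⟩ := ((s (n + 1)).exact y).1 ((s (n + 1 + 1)).injective (h.trans (map_zero _).symm))
    obtain ⟨x, rfl⟩ := (s n).surjective z
    exact ⟨x, rfl⟩
  · rintro ⟨x, rfl⟩
    change (s (n + 1 + 1)).i ((s (n + 1)).p ((s (n + 1)).i _)) = 0
    rw [(s (n + 1)).exact.apply_apply_eq_zero, map_zero]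

lemma chainD_hom_exact (s : ∀ n : ℤ, GPStep (Z n) (Z (n + 1))) (n : ℤ) (Q : Type u)
    [AddCommGroup Q] [Module R Q]
    (hQ : ∀ c : Z (n + 1 + 1) →ₗ[R] Q, ∃ g : (s (n + 1 + 1)).P →ₗ[R] Q,
      g ∘ₗ (s (n + 1 + 1)).i = c) :
    Function.Exact (fun g : (s (n + 1 + 1)).P →ₗ[R] Q => g.comp (chainD s (n + 1)))
      (fun g : (s (n + 1)).P →ₗ[R] Q => g.comp (chainD s n)) := fun c => by
  constructor
  · intro h
    obtain ⟨b, hb⟩ := exists_factor_of_surjective (s (n + 1)).p (s (n + 1)).surjective c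
      (fun a ha => by
        obtain ⟨z, rfl⟩ := ((s (n + 1)).exact a).1 ha
        obtain ⟨x, rfl⟩ := (s n).surjective z
        exact LinearMap.congr_fun h x)
    obtain ⟨g, hg⟩ := hQ b
    refine ⟨g, LinearMap.ext fun x => ?_⟩
    exact (LinearMap.congr_fun hg ((s (n + 1)).p x)).trans (hb x)
  · rintro ⟨g, rfl⟩
    refine LinearMap.ext fun x => ?_
    change g (chainD s (n + 1) (chainD s n x)) = 0
    rw [(chainD_exact s n).apply_apply_eq_zero, map_zero]

lemma isGP_of_chain (s : ∀ n : ℤ, GPStep (Z n) (Z (n + 1))) : IsGP R (Z 0) := by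
  refine ⟨fun n => (s n).P, inferInstance, inferInstance, chainD s, fun n => (s n).finite,
    fun n => (s n).projective, chainD_exact s,
    fun n => chainD_hom_exact s n R (s (n + 1 + 1)).extend, ?_⟩
  have h : LinearMap.range (chainD s (-1)) = LinearMap.range (s (-1 + 1)).i :=
    LinearMap.range_comp_of_range_eq_top _ (LinearMap.range_eq_top.2 (s (-1)).surjective)
  exact ⟨(LinearEquiv.ofInjective (s (-1 + 1)).i (s (-1 + 1)).injective).trans
    (LinearEquiv.ofEq _ _ h.symm)⟩

lemma IsStepClosed.isGP (hS : IsStepClosed S) {M : ModuleCat.{u} R} (hM : StAdd S M) :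
    IsGP R M := by
  obtain ⟨X, ⟨x₀⟩, ⟨x⟩⟩ := exists_ray (fun _ => hS.exists_right) hM
  obtain ⟨Y, ⟨y₀⟩, ⟨y⟩⟩ := exists_ray (β := fun A B => GPStep B A) (fun _ => hS.exists_left) hM
  exact isGP_of_chain (intStep (X := consObj M X) y₀ (consStep x₀ x) y)

/-- The images in a complete projective resolution form a class closed under steps. -/
lemma isStepClosed_of_complex {P : ℤ → Type u} [∀ n, AddCommGroup (P n)] [∀ n, Module R (P n)]
    (d : ∀ n, P n →ₗ[R] P (n + 1)) (hfin : ∀ n, Module.Finite R (P n))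
    (hproj : ∀ n, Module.Projective R (P n)) (hex : ∀ n, Function.Exact (d n) (d (n + 1)))
    (hhom : ∀ n, Function.Exact (fun g : P (n + 1 + 1) →ₗ[R] R => g.comp (d (n + 1)))
      (fun g : P (n + 1) →ₗ[R] R => g.comp (d n))) :
    IsStepClosed (R := R) fun Z => ∃ n, Nonempty (Z ≃ₗ[R] LinearMap.range (d (n + 1))) := by
  have key : ∀ n (Z Z' : ModuleCat.{u} R), (Z ≃ₗ[R] LinearMap.range (d n)) →
      (Z' ≃ₗ[R] LinearMap.range (d (n + 1))) → Nonempty (GPStep Z Z') := by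
    intro n Z Z' e e'
    refine ⟨⟨ModuleCat.of R (P (n + 1)), (LinearMap.range (d n)).subtype ∘ₗ e.toLinearMap,
      e'.symm.toLinearMap ∘ₗ (d (n + 1)).rangeRestrict, hfin _, hproj _,
      Subtype.val_injective.comp e.injective,
      e'.symm.surjective.comp (d (n + 1)).surjective_rangeRestrict, fun y => ?_, fun c => ?_⟩⟩
    · constructor
      · intro h
        have h1 : d (n + 1) y = 0 :=
          congrArg Subtype.val (e'.symm.injective (h.trans (map_zero _).symm))
        obtain ⟨x, rfl⟩ := (hex n y).1 h1
        exact ⟨e.symm ⟨d n x, x, rfl⟩, by simp⟩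
      · rintro ⟨z, rfl⟩
        obtain ⟨x, hx⟩ := (e z).2
        have h1 : d (n + 1) (e z) = 0 := by
          rw [← hx]
          exact (hex n).apply_apply_eq_zero x
        have h2 : (d (n + 1)).rangeRestrict (e z) = 0 := Subtype.ext h1
        exact (congrArg e'.symm h2).trans (map_zero _)
    · obtain ⟨m, rfl⟩ : ∃ m, n = m + 1 := ⟨n - 1, (sub_add_cancel n 1).symm⟩
      obtain ⟨g, hg⟩ := (hhom m (c ∘ₗ e.symm.toLinearMap ∘ₗ (d (m + 1)).rangeRestrict)).1 (by
        refine LinearMap.ext fun x => ?_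
        have h1 : (d (m + 1)).rangeRestrict (d m x) = 0 :=
          Subtype.ext ((hex m).apply_apply_eq_zero x)
        change c (e.symm ((d (m + 1)).rangeRestrict (d m x))) = 0
        rw [h1, map_zero, map_zero])
      refine ⟨g, LinearMap.ext fun z => ?_⟩
      obtain ⟨x, hx⟩ := (e z).2
      have h1 : (d (m + 1)).rangeRestrict x = e z := Subtype.ext hx
      have h2 : g (d (m + 1) x) = c (e.symm ((d (m + 1)).rangeRestrict x)) :=
        LinearMap.congr_fun hg x
      rw [h1, e.symm_apply_apply, hx] at h2
      exact h2
  constructor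
  · rintro Z ⟨n, ⟨e⟩⟩
    exact ⟨ModuleCat.of R (LinearMap.range (d (n + 1 + 1))), ⟨n + 1, ⟨LinearEquiv.refl R _⟩⟩,
      key (n + 1) _ _ e (LinearEquiv.refl R _)⟩
  · rintro Z ⟨n, ⟨e⟩⟩
    obtain ⟨m, rfl⟩ : ∃ m, n = m + 1 := ⟨n - 1, (sub_add_cancel n 1).symm⟩
    exact ⟨ModuleCat.of R (LinearMap.range (d (m + 1))), ⟨m, ⟨LinearEquiv.refl R _⟩⟩,
      key (m + 1) _ _ (LinearEquiv.refl R _) e⟩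

lemma exists_isStepClosed {G : Type u} [AddCommGroup G] [Module R G] (h : IsGP R G) :
    ∃ S : ModuleCat.{u} R → Prop, IsStepClosed S ∧ S (ModuleCat.of R G) := by
  obtain ⟨P, _, _, d, h1, h2, h3, h4, h5⟩ := h
  refine ⟨_, isStepClosed_of_complex d h1 h2 h3 h4, ?_⟩
  revert h5
  generalize (-1 : ℤ) = k
  obtain ⟨n, rfl⟩ : ∃ n, k = n + 1 := ⟨k - 1, (sub_add_cancel k 1).symm⟩
  exact fun h => ⟨n, h⟩

lemma StAdd.of_inAdd {G M : Type u} [AddCommGroup G] [Module R G] [AddCommGroup M] [Module R M]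
    (hG : S (ModuleCat.of R G)) (h : InAdd R G M) : StAdd S (ModuleCat.of R M) := by
  obtain ⟨n, i, p, hip⟩ := h
  exact ⟨ModuleCat.of R G, n, ModuleCat.of R PUnit, hG, inferInstance, inferInstance,
    LinearMap.inl R _ _ ∘ₗ i, p ∘ₗ LinearMap.fst R _ _, LinearMap.congr_fun hip⟩

end Chains

section GorensteinInjective

variable {R : Type u} [Ring R] {K : Type u} [Field K] [Algebra K R]

lemma exact_of_hom_self_exact {A B C : Type u} [AddCommGroup A] [Module R A] [AddCommGroup B]
    [Module R B] [AddCommGroup C] [Module R C] (f : A →ₗ[R] B) (g : B →ₗ[R] C)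
    (h : Function.Exact (fun c : R →ₗ[R] A => f.comp c) (fun c : R →ₗ[R] B => g.comp c)) :
    Function.Exact f g := fun y => by
  constructor
  · intro hy
    obtain ⟨c, hc⟩ := (h (LinearMap.toSpanSingleton R B y)).1 (LinearMap.ext_ring (by simp [hy]))
    exact ⟨c 1, (LinearMap.congr_fun hc 1).trans (by simp)⟩
  · rintro ⟨x, rfl⟩
    have := LinearMap.congr_fun (h.apply_apply_eq_zero (LinearMap.toSpanSingleton R A x)) 1
    simpa using this

section Uniqueness

variable {P₁ P₀ I₁ I₀ J₁ J₀ : Type u} [AddCommGroup P₁] [Module R P₁]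
  [AddCommGroup P₀] [Module R P₀] [AddCommGroup I₁] [Module R I₁] [AddCommGroup I₀] [Module R I₀]
  [AddCommGroup J₁] [Module R J₁] [AddCommGroup J₀] [Module R J₀]
  [Module.Finite R P₁] [Module.Finite R P₀] [Module.Finite R I₁] [Module.Finite R I₀]
  [Module.Finite R J₁] [Module.Finite R J₀] [FiniteDimensional K R]
  {t₁ : (P₁ →ₗ[R] I₁) →+ K} {t₀ : (P₀ →ₗ[R] I₀) →+ K}
  {s₁ : (P₁ →ₗ[R] J₁) →+ K} {s₀ : (P₀ →ₗ[R] J₀) →+ K}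

/-- The kernel of a map between partners depends only on the corresponding map of projectives. -/
lemma IsNakayamaAdj.nonempty_ker_equiv (ht₁ : IsNakayamaTrace t₁) (ht₀ : IsNakayamaTrace t₀)
    (hs₁ : IsNakayamaTrace s₁) (hs₀ : IsNakayamaTrace s₀) {d : P₁ →ₗ[R] P₀} {d' : I₁ →ₗ[R] I₀}
    {e' : J₁ →ₗ[R] J₀} (h : IsNakayamaAdj t₁ t₀ d d') (h' : IsNakayamaAdj s₁ s₀ d e') :
    Nonempty (LinearMap.ker d' ≃ₗ[R] LinearMap.ker e') := by
  obtain ⟨u₁, hu₁⟩ := ht₁.exists_adj_right hs₁ LinearMap.id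
  obtain ⟨v₁, hv₁⟩ := hs₁.exists_adj_right ht₁ LinearMap.id
  obtain ⟨u₀, hu₀⟩ := ht₀.exists_adj_right hs₀ LinearMap.id
  obtain ⟨v₀, hv₀⟩ := hs₀.exists_adj_right ht₀ LinearMap.id
  have hvu : ∀ x, v₁ (u₁ x) = x := LinearMap.congr_fun
    ((hu₁.comp hv₁).unique_right ht₁ (IsNakayamaAdj.id t₁))
  have huv : ∀ x, u₁ (v₁ x) = x := LinearMap.congr_fun
    ((hv₁.comp hu₁).unique_right hs₁ (IsNakayamaAdj.id s₁))
  have hu : ∀ x, e' (u₁ x) = u₀ (d' x) := LinearMap.congr_fun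
    ((hu₁.comp h').unique_right hs₀ (h.comp hu₀))
  have hv : ∀ x, d' (v₁ x) = v₀ (e' x) := LinearMap.congr_fun
    ((hv₁.comp h).unique_right ht₀ (h'.comp hv₀))
  exact ⟨LinearEquiv.ofLinear
    (u₁.restrict fun x hx => by
      rw [LinearMap.mem_ker, hu, LinearMap.mem_ker.1 hx, map_zero])
    (v₁.restrict fun x hx => by
      rw [LinearMap.mem_ker, hv, LinearMap.mem_ker.1 hx, map_zero])
    (LinearMap.ext fun x => Subtype.ext (huv x)) (LinearMap.ext fun x => Subtype.ext (hvu x))⟩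

end Uniqueness

lemma IsGI.of_equiv {M N : Type u} [AddCommGroup M] [Module R M] [AddCommGroup N] [Module R N]
    (h : IsGI R K M) (e : N ≃ₗ[R] M) : IsGI R K N := by
  obtain ⟨I, i1, i2, d, h1, h2, h3, h4, ⟨f⟩⟩ := h
  exact ⟨I, i1, i2, d, h1, h2, h3, h4, ⟨e.trans f⟩⟩

lemma IsGP.of_equiv {M N : Type u} [AddCommGroup M] [Module R M] [AddCommGroup N] [Module R N]
    (h : IsGP R M) (e : N ≃ₗ[R] M) : IsGP R N := by
  obtain ⟨I, i1, i2, d, h1, h2, h3, h4, ⟨f⟩⟩ := h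
  exact ⟨I, i1, i2, d, h1, h2, h3, h4, ⟨e.trans f⟩⟩

variable [FiniteDimensional K R]

lemma isGI_of_chain {Z : ℤ → ModuleCat.{u} R} (s : ∀ n : ℤ, GPStep (Z n) (Z (n + 1)))
    {J₁ J₀ : Type u} [AddCommGroup J₁] [Module R J₁] [AddCommGroup J₀] [Module R J₀]
    [Module.Finite R J₁] [Module.Finite R J₀]
    {t₁ : ((s 0).P →ₗ[R] J₁) →+ K} {t₀ : ((s (0 + 1)).P →ₗ[R] J₀) →+ K}
    (ht₁ : IsNakayamaTrace t₁) (ht₀ : IsNakayamaTrace t₀)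
    {d' : J₁ →ₗ[R] J₀} (h : IsNakayamaAdj t₁ t₀ (chainD s 0) d') :
    IsGI R K (LinearMap.ker d') := by
  have hfin := fun n => (s n).finite
  have hproj := fun n => (s n).projective
  choose I hI t ht using fun n => exists_injective_partner R K (s n).P
  choose e he using fun n => (ht n).exists_adj_right (ht (n + 1)) (chainD s n)
  have hD : Module.Injective R (OpDual R K R) := by
    have := finite_opDual R K
    exact (isNakayamaTrace_regularTrace R K).injective
  have hfinD := finite_opDual R K
  have hex : ∀ n, Function.Exact (e n) (e (n + 1)) := fun n =>
    exact_of_hom_self_exact _ _ <| (he n).exact_of_exact (ht _) (ht _) (he (n + 1)) (ht _) R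
      (chainD_hom_exact s n R (s _).extend)
  obtain ⟨u⟩ := h.nonempty_ker_equiv ht₁ ht₀ (ht _) (ht _) (he 0)
  refine ⟨fun n => I n, inferInstance, inferInstance, e, hI, fun n => (ht n).injective, hex,
    fun n => (he n).exact_of_exact (ht _) (ht _) (he (n + 1)) (ht _) _
      (chainD_hom_exact s n _ fun c => ?_),
    ⟨u.trans (LinearEquiv.ofEq _ _ (LinearMap.exact_iff.1 (hex (-1))))⟩⟩
  obtain ⟨g, hg⟩ := hD.out _ (s (n + 1 + 1)).injective c
  exact ⟨g, LinearMap.ext hg⟩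

/-- Gorenstein projectivity of a cokernel passes to Gorenstein injectivity of the kernel of the
corresponding map of injectives. -/
lemma IsStepClosed.isGI_ker {S : ModuleCat.{u} R → Prop} (hS : IsStepClosed S)
    {M : ModuleCat.{u} R} (hM : StAdd S M)
    {P₁ P₀ J₁ J₀ : Type u} [AddCommGroup P₁] [Module R P₁] [AddCommGroup P₀] [Module R P₀]
    [AddCommGroup J₁] [Module R J₁] [AddCommGroup J₀] [Module R J₀]
    [Module.Finite R P₁] [Module.Finite R P₀] [Module.Projective R P₁] [Module.Projective R P₀]
    [Module.Finite R J₁] [Module.Finite R J₀]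
    {t₁ : (P₁ →ₗ[R] J₁) →+ K} {t₀ : (P₀ →ₗ[R] J₀) →+ K}
    (ht₁ : IsNakayamaTrace t₁) (ht₀ : IsNakayamaTrace t₀)
    {d : P₁ →ₗ[R] P₀} {d' : J₁ →ₗ[R] J₀} (h : IsNakayamaAdj t₁ t₀ d d')
    (π : P₀ →ₗ[R] M) (hπ : Surjective π) (hdπ : Function.Exact d π) :
    IsGI R K (LinearMap.ker d') := by
  have h0 := hS.ker (X := ModuleCat.of R P₀) hM π hπ
  let d₁ : P₁ →ₗ[R] LinearMap.ker π := d.codRestrict _ fun x => hdπ.apply_apply_eq_zero x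
  have hd₁ : Surjective d₁ := fun y => by
    obtain ⟨x, hx⟩ := (hdπ y).1 y.2
    exact ⟨x, Subtype.ext hx⟩
  have h1 := hS.ker (X := ModuleCat.of R P₁) h0.2 d₁ hd₁
  let s₀ := GPStep.ofSurjective (X := ModuleCat.of R P₀) π hπ h0.1
  let s₁ := GPStep.ofSurjective (M := ModuleCat.of R (LinearMap.ker π)) (X := ModuleCat.of R P₁)
    d₁ hd₁ h1.1
  obtain ⟨X, ⟨x₀⟩, ⟨x⟩⟩ := exists_ray (fun _ => hS.exists_right) hM
  obtain ⟨Y, ⟨y₀⟩, ⟨y⟩⟩ := exists_ray (β := fun A B => GPStep B A) (fun _ => hS.exists_left) h1.2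
  exact isGI_of_chain (intStep
    (X := consObj _ (consObj _ (consObj _ X))) y₀
    (consStep s₁ (consStep (X := consObj _ X) s₀ (consStep x₀ x))) y) ht₁ ht₀ h

end GorensteinInjective

section Transfer

variable {R : Type u} [Ring R] {K : Type u} [Field K] [Algebra K R]

lemma exists_factor_to_injective {A B L : Type u} [AddCommGroup A] [Module R A] [AddCommGroup B]
    [Module R B] [AddCommGroup L] [Module R L] [hL : Module.Injective R L] (f : A →ₗ[R] B)
    (g : A →ₗ[R] L) (h : ∀ a, f a = 0 → g a = 0) : ∃ k : B →ₗ[R] L, ∀ a, k (f a) = g a := by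
  obtain ⟨k, hk⟩ := exists_factor_of_surjective f.rangeRestrict f.surjective_rangeRestrict g
    fun a ha => h a (congrArg Subtype.val ha)
  obtain ⟨l, hl⟩ := hL.out (LinearMap.range f).subtype Subtype.val_injective k
  exact ⟨l, fun a => (hl (f.rangeRestrict a)).trans (hk a)⟩

lemma hom_self_exact_of_exact {A B C : Type u} [AddCommGroup A] [Module R A] [AddCommGroup B]
    [Module R B] [AddCommGroup C] [Module R C] {f : A →ₗ[R] B} {g : B →ₗ[R] C}
    (h : Function.Exact f g) :
    Function.Exact (fun c : R →ₗ[R] A => f.comp c) (fun c : R →ₗ[R] B => g.comp c) := fun c => by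
  constructor
  · intro hc
    obtain ⟨x, hx⟩ := (h (c 1)).1 (LinearMap.congr_fun hc 1)
    exact ⟨LinearMap.toSpanSingleton R A x, LinearMap.ext_ring (by simpa using hx)⟩
  · rintro ⟨c, rfl⟩
    exact LinearMap.ext fun x => h.apply_apply_eq_zero (c x)

lemma exact_of_hom_dual_exact (K : Type u) [Field K] [Algebra K R] {A B C : Type u}
    [AddCommGroup A] [Module R A] [AddCommGroup B]
    [Module R B] [AddCommGroup C] [Module R C] {f : A →ₗ[R] B} {g : B →ₗ[R] C}
    (h : Function.Exact (fun c : C →ₗ[R] OpDual R K R => c.comp g)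
      (fun c : B →ₗ[R] OpDual R K R => c.comp f)) : Function.Exact f g := fun y => by
  constructor
  · intro hy
    have h0 : (LinearMap.range f).mkQ y = 0 := eq_zero_of_forall_hom_dual R K fun c => by
      obtain ⟨b, hb⟩ := (h (c ∘ₗ (LinearMap.range f).mkQ)).1 (LinearMap.ext fun x => by
        have : (LinearMap.range f).mkQ (f x) = 0 :=
          (Submodule.Quotient.mk_eq_zero _).2 ⟨x, rfl⟩
        change c ((LinearMap.range f).mkQ (f x)) = 0
        rw [this, map_zero])
      have := LinearMap.congr_fun hb y
      exact this.symm.trans ((congrArg b hy).trans (map_zero b))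
    exact (Submodule.Quotient.mk_eq_zero _).1 h0
  · rintro ⟨x, rfl⟩
    exact eq_zero_of_forall_hom_dual R K fun c =>
      LinearMap.congr_fun (h.apply_apply_eq_zero c) x

lemma IsNakayamaAdj.pow {P₁ P₀ I₁ I₀ : Type u} [AddCommGroup P₁] [Module R P₁]
    [AddCommGroup P₀] [Module R P₀] [AddCommGroup I₁] [Module R I₁] [AddCommGroup I₀] [Module R I₀]
    {t₁ : (P₁ →ₗ[R] I₁) →+ K} {t₀ : (P₀ →ₗ[R] I₀) →+ K} {d : P₁ →ₗ[R] P₀} {d' : I₁ →ₗ[R] I₀}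
    (h : IsNakayamaAdj t₁ t₀ d d') (n : ℕ) :
    IsNakayamaAdj (powTrace t₁ n) (powTrace t₀ n)
      (LinearMap.pi fun k => d ∘ₗ LinearMap.proj k)
      (LinearMap.pi fun k => d' ∘ₗ LinearMap.proj k) := fun c => by
  rw [powTrace_apply, powTrace_apply]
  refine Finset.sum_congr rfl fun k _ => ?_
  have h1 := h (LinearMap.proj k ∘ₗ c ∘ₗ LinearMap.single R (fun _ : Fin n => P₀) k)
  have h2 : (LinearMap.pi fun l => d ∘ₗ LinearMap.proj l) ∘ₗ
      LinearMap.single R (fun _ : Fin n => P₁) k =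
      LinearMap.single R (fun _ : Fin n => P₀) k ∘ₗ d := by
    refine LinearMap.ext fun x => funext fun l => ?_
    by_cases hl : l = k
    · subst hl
      simp
    · simp [hl]
  rw [LinearMap.comp_assoc _ _ c, h2]
  exact h1

variable [FiniteDimensional K R]

section Coker

variable {Pa Pb Qa Qb J₀ J₁ L₀ L₁ N C M M' : Type u}
  [AddCommGroup Pa] [Module R Pa] [AddCommGroup Pb] [Module R Pb]
  [AddCommGroup Qa] [Module R Qa] [AddCommGroup Qb] [Module R Qb]
  [AddCommGroup J₀] [Module R J₀] [AddCommGroup J₁] [Module R J₁]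
  [AddCommGroup L₀] [Module R L₀] [AddCommGroup L₁] [Module R L₁]
  [AddCommGroup N] [Module R N] [AddCommGroup C] [Module R C]
  [AddCommGroup M] [Module R M] [AddCommGroup M'] [Module R M']
  [Module.Finite R Pa] [Module.Finite R Pb] [Module.Finite R Qa] [Module.Finite R Qb]
  [Module.Finite R J₀] [Module.Finite R J₁] [Module.Finite R L₀] [Module.Finite R L₁]
  {ta : (Pa →ₗ[R] J₀) →+ K} {tb : (Pb →ₗ[R] J₁) →+ K}
  {sa : (Qa →ₗ[R] L₀) →+ K} {sb : (Qb →ₗ[R] L₁) →+ K}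

/-- If the kernel `N` of `d'` is a direct summand of the kernel `C` of `e'`, then the cokernel `M`
of the map corresponding to `d'` is, up to a projective module, a direct summand of the cokernel
`M'` of the map corresponding to `e'`. -/
lemma IsNakayamaAdj.exists_retract_coker (hta : IsNakayamaTrace ta) (htb : IsNakayamaTrace tb)
    (hsa : IsNakayamaTrace sa) (hsb : IsNakayamaTrace sb)
    {d : Pa →ₗ[R] Pb} {d' : J₀ →ₗ[R] J₁} {e : Qa →ₗ[R] Qb} {e' : L₀ →ₗ[R] L₁}
    (hd : IsNakayamaAdj ta tb d d') (he : IsNakayamaAdj sa sb e e')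
    (j : N →ₗ[R] J₀) (hj : Injective j) (hjd : Function.Exact j d')
    (l : C →ₗ[R] L₀) (hl : Injective l) (hle : Function.Exact l e')
    (i : N →ₗ[R] C) (p : C →ₗ[R] N) (hpi : ∀ x, p (i x) = x)
    (π : Pb →ₗ[R] M) (hπ : Surjective π) (hdπ : Function.Exact d π)
    (π' : Qb →ₗ[R] M') (hπ' : Surjective π') (heπ' : Function.Exact e π') :
    ∃ (u : M →ₗ[R] M' × Pb) (v : M' × Pb →ₗ[R] M), ∀ x, v (u x) = x := by
  have := hta.injective
  have := htb.injective
  have := hsa.injective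
  have := hsb.injective
  obtain ⟨φ₀, hφ₀⟩ := exists_factor_to_injective j (l ∘ₗ i) fun a ha => by
    rw [hj (ha.trans (map_zero j).symm), map_zero]
  obtain ⟨ψ₀, hψ₀⟩ := exists_factor_to_injective l (j ∘ₗ p) fun a ha => by
    rw [hl (ha.trans (map_zero l).symm), map_zero]
  obtain ⟨φ₁, hφ₁⟩ := exists_factor_to_injective d' (e' ∘ₗ φ₀) fun a ha => by
    obtain ⟨a, rfl⟩ := (hjd a).1 ha
    rw [LinearMap.comp_apply, hφ₀]
    exact hle.apply_apply_eq_zero _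
  obtain ⟨ψ₁, hψ₁⟩ := exists_factor_to_injective e' (d' ∘ₗ ψ₀) fun a ha => by
    obtain ⟨a, rfl⟩ := (hle a).1 ha
    rw [LinearMap.comp_apply, hψ₀]
    exact hjd.apply_apply_eq_zero _
  obtain ⟨h', hh'⟩ := exists_factor_to_injective d' (ψ₀ ∘ₗ φ₀ - LinearMap.id) fun a ha => by
    obtain ⟨a, rfl⟩ := (hjd a).1 ha
    rw [LinearMap.sub_apply, LinearMap.comp_apply, hφ₀, LinearMap.comp_apply, hψ₀,
      LinearMap.comp_apply, hpi, LinearMap.id_apply, sub_self]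
  obtain ⟨f₀, hf₀⟩ := hta.exists_adj_left hsa φ₀
  obtain ⟨f₁, hf₁⟩ := htb.exists_adj_left hsb φ₁
  obtain ⟨g₀, hg₀⟩ := hsa.exists_adj_left hta ψ₀
  obtain ⟨g₁, hg₁⟩ := hsb.exists_adj_left htb ψ₁
  obtain ⟨h, hh⟩ := htb.exists_adj_left hta h'
  have ef : f₁ ∘ₗ d = e ∘ₗ f₀ := (hd.comp hf₁).unique_left hta (by
    have : φ₁ ∘ₗ d' = e' ∘ₗ φ₀ := LinearMap.ext hφ₁
    rw [this]
    exact hf₀.comp he)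
  have eg : g₁ ∘ₗ e = d ∘ₗ g₀ := (he.comp hg₁).unique_left hsa (by
    have : ψ₁ ∘ₗ e' = d' ∘ₗ ψ₀ := LinearMap.ext hψ₁
    rw [this]
    exact hg₀.comp hd)
  let k : Pb →ₗ[R] Pb := g₁ ∘ₗ f₁ - LinearMap.id - d ∘ₗ h
  have hk : IsNakayamaAdj tb tb k (ψ₁ ∘ₗ φ₁ - LinearMap.id - d' ∘ₗ h') :=
    ((hf₁.comp hg₁).sub (IsNakayamaAdj.id tb)).sub (hh.comp hd)
  have hkd : k ∘ₗ d = 0 := (hd.comp hk).unique_left hta (by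
    have : (ψ₁ ∘ₗ φ₁ - LinearMap.id - d' ∘ₗ h') ∘ₗ d' = 0 := LinearMap.ext fun x => by
      simp only [LinearMap.comp_apply, LinearMap.sub_apply, LinearMap.id_apply, hφ₁, hψ₁, hh',
        map_sub, LinearMap.zero_apply]
      abel
    rw [this]
    intro c
    rw [LinearMap.comp_zero, LinearMap.zero_comp, map_zero, map_zero])
  obtain ⟨f, hf⟩ := exists_factor_of_surjective π hπ (π' ∘ₗ f₁) fun a ha => by
    obtain ⟨a, rfl⟩ := (hdπ a).1 ha
    rw [LinearMap.comp_apply, ← LinearMap.comp_apply f₁ d, ef]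
    exact heπ'.apply_apply_eq_zero _
  obtain ⟨g, hg⟩ := exists_factor_of_surjective π' hπ' (π ∘ₗ g₁) fun a ha => by
    obtain ⟨a, rfl⟩ := (heπ' a).1 ha
    rw [LinearMap.comp_apply, ← LinearMap.comp_apply g₁ e, eg]
    exact hdπ.apply_apply_eq_zero _
  obtain ⟨w, hw⟩ := exists_factor_of_surjective π hπ k fun a ha => by
    obtain ⟨a, rfl⟩ := (hdπ a).1 ha
    exact LinearMap.congr_fun hkd a
  refine ⟨f.prod w, g.coprod (-π), fun x => ?_⟩
  obtain ⟨x, rfl⟩ := hπ x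
  change g (f (π x)) + -π (w (π x)) = π x
  rw [hf, hw, LinearMap.comp_apply, hg]
  change π (g₁ (f₁ x)) + -π (g₁ (f₁ x) - x - d (h x)) = π x
  rw [map_sub, map_sub, hdπ.apply_apply_eq_zero]
  abel

end Coker

/-- If the kernel `N` of `d'` lies in the additive closure of a Gorenstein injective module, then
the cokernel of the map corresponding to `d'` is stably in a class closed under steps. -/
lemma IsGI.exists_stAdd {C : Type u} [AddCommGroup C] [Module R C] (hC : IsGI R K C)
    {N : Type u} [AddCommGroup N] [Module R N] (hN : InAdd R C N)
    {Pa Pb J₀ J₁ M : Type u} [AddCommGroup Pa] [Module R Pa] [AddCommGroup Pb] [Module R Pb]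
    [AddCommGroup J₀] [Module R J₀] [AddCommGroup J₁] [Module R J₁]
    [AddCommGroup M] [Module R M]
    [Module.Finite R Pa] [Module.Finite R Pb] [Module.Projective R Pb]
    [Module.Finite R J₀] [Module.Finite R J₁]
    {ta : (Pa →ₗ[R] J₀) →+ K} {tb : (Pb →ₗ[R] J₁) →+ K}
    (hta : IsNakayamaTrace ta) (htb : IsNakayamaTrace tb)
    {d : Pa →ₗ[R] Pb} {d' : J₀ →ₗ[R] J₁} (hd : IsNakayamaAdj ta tb d d')
    (j : N →ₗ[R] J₀) (hj : Injective j) (hjd : Function.Exact j d')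
    (π : Pb →ₗ[R] M) (hπ : Surjective π) (hdπ : Function.Exact d π) :
    ∃ S : ModuleCat.{u} R → Prop, IsStepClosed S ∧ StAdd S (ModuleCat.of R M) := by
  obtain ⟨n, i, p, hip⟩ := hN
  obtain ⟨I, _, _, e', hfin, hinj, hex, hhom, ⟨eC⟩⟩ := hC
  have := finite_opDual R K
  generalize (-1 : ℤ) = m at eC
  choose Q hQ hQ' t ht using fun n => exists_projective_partner R K (I n)
  choose e he using fun n => (ht n).exists_adj_left (ht (n + 1)) (e' n)
  have hQex : ∀ n, Function.Exact (e n) (e (n + 1)) := fun n =>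
    exact_of_hom_dual_exact K ((he n).exact_of_exact' (ht _) (ht _) (he (n + 1)) (ht _) _ (hhom n))
  have hS := isStepClosed_of_complex e hQ hQ' hQex fun n =>
    (he n).exact_of_exact' (ht _) (ht _) (he (n + 1)) (ht _) R (hom_self_exact_of_exact (hex n))
  refine ⟨_, hS, ?_⟩
  let l : C →ₗ[R] I (m + 1) := (LinearMap.range (e' m)).subtype ∘ₗ eC.toLinearMap
  have hl : Injective l := Subtype.val_injective.comp eC.injective
  have hle : Function.Exact l (e' (m + 1)) := fun y => by
    refine (hex m y).trans ⟨fun hy => ⟨eC.symm ⟨y, hy⟩, ?_⟩, ?_⟩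
    · simp [l]
    · rintro ⟨x, rfl⟩
      exact (eC x).2
  have hcomp := hQex (m + 1)
  let π₁ : Q (m + 1 + 1) →ₗ[R] LinearMap.range (e (m + 1 + 1)) := (e (m + 1 + 1)).rangeRestrict
  obtain ⟨u, v, huv⟩ := hd.exists_retract_coker hta htb ((ht (m + 1)).pow n) ((ht (m + 1 + 1)).pow n)
    ((he (m + 1)).pow n) j hj hjd (LinearMap.pi fun k => l ∘ₗ LinearMap.proj k)
    (fun x y h => funext fun k => hl (congrFun h k))
    (fun y => ⟨fun h => ⟨fun k => ((hle (y k)).1 (congrFun h k)).choose,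
      funext fun k => ((hle (y k)).1 (congrFun h k)).choose_spec⟩, by
      rintro ⟨x, rfl⟩
      exact funext fun k => hle.apply_apply_eq_zero (x k)⟩)
    i p (LinearMap.congr_fun hip) π hπ hdπ
    (LinearMap.pi fun k => π₁ ∘ₗ LinearMap.proj k)
    (fun y => ⟨fun k => ((e (m + 1 + 1)).surjective_rangeRestrict (y k)).choose,
      funext fun k => ((e (m + 1 + 1)).surjective_rangeRestrict (y k)).choose_spec⟩)
    (fun y => ⟨fun h => ⟨fun k => ((hcomp (y k)).1 (congrArg Subtype.val (congrFun h k))).choose,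
      funext fun k => ((hcomp (y k)).1 (congrArg Subtype.val (congrFun h k))).choose_spec⟩, by
      rintro ⟨x, rfl⟩
      exact funext fun k => Subtype.ext (hcomp.apply_apply_eq_zero (x k))⟩)
  exact ⟨ModuleCat.of R (LinearMap.range (e (m + 1 + 1))), n, ModuleCat.of R Pb,
    ⟨m + 1, ⟨LinearEquiv.refl R _⟩⟩, inferInstance, inferInstance, u, v, huv⟩

end Transfer

section ProjectiveCover

variable {R : Type u} [Ring R] [IsArtinianRing R]

/-- Finitely generated modules over artinian rings have projective covers. -/
lemma exists_projective_cover (L : Type u) [AddCommGroup L] [Module R L] [Module.Finite R L] :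
    ∃ (P : ModuleCat.{u} R) (θ : P →ₗ[R] L), Module.Finite R P ∧ Module.Projective R P ∧
      Surjective θ ∧ ∀ Q : Submodule R P, Q.map θ = ⊤ → Q = ⊤ := by
  have : IsNoetherianRing R := inferInstance
  obtain ⟨n, θ, hθ⟩ := Module.Finite.exists_fin' R L
  have : IsArtinian R (Fin n → R) := inferInstance
  obtain ⟨_, ⟨e, rfl, he⟩, hmin⟩ := IsArtinian.set_has_minimal
    {S : Submodule R (Fin n → R) | ∃ e : (Fin n → R) →ₗ[R] (Fin n → R),
      LinearMap.range e = S ∧ θ ∘ₗ e = θ} ⟨_, LinearMap.id, rfl, rfl⟩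
  have he' : ∀ x, θ (e x) = θ x := LinearMap.congr_fun he
  have hmin' : ∀ g : (Fin n → R) →ₗ[R] (Fin n → R), θ ∘ₗ g = θ →
      LinearMap.range g ≤ LinearMap.range e → LinearMap.range g = LinearMap.range e :=
    fun g hg hle => by_contra fun hne => hmin _ ⟨g, rfl, hg⟩ (lt_of_le_of_ne hle hne)
  let r : LinearMap.range e →ₗ[R] LinearMap.range e := e.rangeRestrict ∘ₗ (LinearMap.range e).subtype
  have hr : Surjective r := by
    have h2 := hmin' (e ∘ₗ e) (by rw [← LinearMap.comp_assoc, he, he]) (LinearMap.range_comp_le_range e e)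
    rintro ⟨x, hx⟩
    rw [← h2] at hx
    obtain ⟨y, rfl⟩ := hx
    exact ⟨⟨e y, y, rfl⟩, rfl⟩
  have hri : Injective r := IsNoetherian.injective_of_surjective_endomorphism r hr
  have hproj : Module.Projective R (LinearMap.range e) := by
    refine Module.Projective.of_split (LinearMap.range e).subtype
      ((LinearEquiv.ofBijective r ⟨hri, hr⟩).symm.toLinearMap ∘ₗ e.rangeRestrict) ?_
    exact LinearMap.ext fun x => (LinearEquiv.ofBijective r ⟨hri, hr⟩).symm_apply_apply x
  refine ⟨ModuleCat.of R (LinearMap.range e), θ ∘ₗ (LinearMap.range e).subtype,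
    inferInstanceAs (Module.Finite R (LinearMap.range e)),
    hproj, fun y => ?_, fun Q hQ => ?_⟩
  · obtain ⟨x, rfl⟩ := hθ y
    exact ⟨⟨e x, x, rfl⟩, he' x⟩
  · change Submodule R (LinearMap.range e) at Q
    obtain ⟨g, hg⟩ := Module.projective_lifting_property
      ((θ ∘ₗ (LinearMap.range e).subtype) ∘ₗ Q.subtype) θ (by
        intro y
        obtain ⟨x, hx, rfl⟩ : y ∈ Q.map (θ ∘ₗ (LinearMap.range e).subtype) := hQ ▸ Submodule.mem_top
        exact ⟨⟨x, hx⟩, rfl⟩)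
    have h3 := hmin' ((LinearMap.range e).subtype ∘ₗ Q.subtype ∘ₗ g) hg (by
      rintro _ ⟨x, rfl⟩
      exact (g x).1.2)
    refine Submodule.eq_top_iff'.2 fun x => ?_
    obtain ⟨y, hy⟩ : x.1 ∈ LinearMap.range ((LinearMap.range e).subtype ∘ₗ Q.subtype ∘ₗ g) :=
      h3.ge x.2
    have : x = (g y).1 := Subtype.ext hy.symm
    rw [this]
    exact (g y).2

end ProjectiveCover

section Presentation

variable {R : Type u} [Ring R] [IsArtinianRing R] {T F : ModuleCat.{u} R → Prop}

/-- A minimal presentation of an Ext-projective object induces surjections on maps to torsion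
modules. -/
lemma IsTorsionPair.exists_comp_eq (h : IsTorsionPair R T F)
    {P₁ P₀ L M : Type u} [AddCommGroup P₁] [Module R P₁] [AddCommGroup P₀] [Module R P₀]
    [AddCommGroup L] [Module R L] [AddCommGroup M] [Module R M] [Module.Projective R P₀]
    (i : L →ₗ[R] P₀) (hi : Injective i) (π : P₀ →ₗ[R] M) (hπ : Surjective π)
    (hiπ : Function.Exact i π) (θ : P₁ →ₗ[R] L) (hθ : Surjective θ)
    (hθ' : ∀ Q : Submodule R P₁, Q.map θ = ⊤ → Q = ⊤)
    (hM : ∀ (Y : Type u) [AddCommGroup Y] [Module R Y], T (ModuleCat.of R Y) →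
        Ext1Vanishes R M Y)
    (Y : Type u) [AddCommGroup Y] [Module R Y] (hY : T (ModuleCat.of R Y)) (a : P₁ →ₗ[R] Y) :
    ∃ c : P₀ →ₗ[R] Y, c ∘ₗ i ∘ₗ θ = a := by
  have := ((h.torsion_iff Y).1 hY).1
  have : IsArtinian R Y := inferInstance
  obtain ⟨_, ⟨c, rfl⟩, hmin⟩ := IsArtinian.set_has_minimal
    {S : Submodule R Y | ∃ c : P₀ →ₗ[R] Y, LinearMap.range (a - c ∘ₗ i ∘ₗ θ) = S} ⟨_, 0, rfl⟩
  set a' := a - c ∘ₗ i ∘ₗ θ with ha'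
  set S := (LinearMap.ker θ).map a' with hS
  obtain ⟨g, hg⟩ := exists_factor_of_surjective θ hθ (S.mkQ ∘ₗ a') fun x hx =>
    (Submodule.Quotient.mk_eq_zero S).2 ⟨x, hx, rfl⟩
  obtain ⟨b', hb'⟩ := (hM (Y ⧸ S) (h.torsion_of_surjective hY S.mkQ
    (Submodule.mkQ_surjective S))).extend i π hi hπ hiπ g
  obtain ⟨b, hb⟩ := Module.projective_lifting_property S.mkQ b' (Submodule.mkQ_surjective S)
  have hmem : ∀ x, (a' - b ∘ₗ i ∘ₗ θ) x ∈ S := fun x => by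
    rw [← Submodule.Quotient.mk_eq_zero S]
    change S.mkQ (a' x - b (i (θ x))) = 0
    rw [map_sub, sub_eq_zero]
    refine (hg x).symm.trans ?_
    rw [← hb', ← hb]
    rfl
  have hle : S ≤ LinearMap.range a' := by
    rintro _ ⟨x, -, rfl⟩
    exact ⟨x, rfl⟩
  have hrange : LinearMap.range a' ≤ S := by
    by_contra hne
    refine hmin (LinearMap.range (a' - b ∘ₗ i ∘ₗ θ)) ⟨c + b, ?_⟩
      (lt_of_le_of_lt (b := S) ?_ (lt_of_le_not_ge hle hne))
    · rw [ha', LinearMap.add_comp, sub_sub]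
    · rintro _ ⟨x, rfl⟩
      exact hmem x
  have h0 : LinearMap.ker a' = ⊤ := by
    refine hθ' _ (Submodule.eq_top_iff'.2 fun y => ?_)
    obtain ⟨x, rfl⟩ := hθ y
    obtain ⟨z, hz, hzx⟩ := hrange ⟨x, rfl⟩
    refine ⟨x - z, ?_, ?_⟩
    · change a' (x - z) = 0
      rw [map_sub, hzx, sub_self]
    · rw [map_sub, LinearMap.mem_ker.1 hz, sub_zero]
  exact ⟨c, (sub_eq_zero.1 (LinearMap.ker_eq_top.1 h0)).symm⟩

lemma ext1Vanishes_ker {R : Type u} [Ring R] {J₁ J₀ Y : Type u} [AddCommGroup J₁] [Module R J₁] [AddCommGroup J₀]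
    [Module R J₀] [AddCommGroup Y] [Module R Y] [Module.Injective R J₁] (δ : J₁ →ₗ[R] J₀)
    (hδ : ∀ g : Y →ₗ[R] J₀, ∃ b : Y →ₗ[R] J₁, δ ∘ₗ b = g) :
    Ext1Vanishes R Y (LinearMap.ker δ) := by
  refine .of_retraction fun E _ _ i p hi hp hip => ?_
  obtain ⟨u, hu⟩ := Module.Injective.out i hi (LinearMap.ker δ).subtype
  obtain ⟨v, hv⟩ := exists_factor_of_surjective p hp (δ ∘ₗ u) fun x hx => by
    obtain ⟨y, rfl⟩ := (hip x).1 hx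
    rw [LinearMap.comp_apply, hu]
    exact y.2
  obtain ⟨b, hb⟩ := hδ v
  refine ⟨(u - b ∘ₗ p).codRestrict (LinearMap.ker δ) fun x => ?_, LinearMap.ext fun x =>
    Subtype.ext ?_⟩
  · change δ (u x - b (p x)) = 0
    rw [map_sub, sub_eq_zero]
    exact (hv x).symm.trans (LinearMap.congr_fun hb (p x)).symm
  · change u (i x) - b (p (i x)) = x
    rw [hu, hip.apply_apply_eq_zero, map_zero, sub_zero]
    rfl

end Presentation

section ProdAdjoint

variable {R : Type u} [Ring R] {K : Type u} [Field K] [Algebra K R]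
  {P₁ P₀ J₁ J₀ P₁' P₀' J₁' J₀' : Type u} [AddCommGroup P₁] [Module R P₁]
  [AddCommGroup P₀] [Module R P₀] [AddCommGroup J₁] [Module R J₁]
  [AddCommGroup J₀] [Module R J₀] [AddCommGroup P₁'] [Module R P₁']
  [AddCommGroup P₀'] [Module R P₀'] [AddCommGroup J₁'] [Module R J₁']
  [AddCommGroup J₀'] [Module R J₀']
  {t₁ : (P₁ →ₗ[R] J₁) →+ K} {t₀ : (P₀ →ₗ[R] J₀) →+ K}
  {t₁' : (P₁' →ₗ[R] J₁') →+ K} {t₀' : (P₀' →ₗ[R] J₀') →+ K}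

lemma IsNakayamaAdj.prodMap {d : P₁ →ₗ[R] P₀} {d' : J₁ →ₗ[R] J₀} {e : P₁' →ₗ[R] P₀'}
    {e' : J₁' →ₗ[R] J₀'} (h : IsNakayamaAdj t₁ t₀ d d') (h' : IsNakayamaAdj t₁' t₀' e e') :
    IsNakayamaAdj (prodTrace t₁ t₁') (prodTrace t₀ t₀') (d.prodMap e) (d'.prodMap e') := by
  intro c
  rw [prodTrace_apply, prodTrace_apply]
  congr 1
  · refine Eq.trans ?_ (h (LinearMap.fst R J₁ J₁' ∘ₗ c ∘ₗ LinearMap.inl R P₀ P₀'))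
    congr 1
    ext x
    simp
  · refine Eq.trans ?_ (h' (LinearMap.snd R J₁ J₁' ∘ₗ c ∘ₗ LinearMap.inr R P₀ P₀'))
    congr 1
    ext x
    simp

lemma isNakayamaAdj_inl (t₁ : (P₁ →ₗ[R] J₁) →+ K) (t₁' : (P₁' →ₗ[R] J₁') →+ K) :
    IsNakayamaAdj t₁ (prodTrace t₁ t₁') (LinearMap.inl R P₁ P₁') (LinearMap.inl R J₁ J₁') := by
  intro c
  rw [prodTrace_apply]
  have e : LinearMap.snd R J₁ J₁' ∘ₗ (LinearMap.inl R J₁ J₁' ∘ₗ c) ∘ₗ LinearMap.inr R P₁ P₁' = 0 :=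
    rfl
  rw [e, map_zero, add_zero]
  rfl

end ProdAdjoint

section GeneratorData

variable {R : Type u} [Ring R] {K : Type u} [Field K] [Algebra K R] [FiniteDimensional K R]
  {T F : ModuleCat.{u} R → Prop}

/-- A projective presentation of an Ext-projective generator of `T` whose image under the
Nakayama functor is an injective copresentation of an Ext-injective cogenerator of `F`. -/
lemma IsTorsionPair.exists_extProjGen_extInjCogen (h : IsTorsionPair R T F)
    (hcov : CovariantlyFinite R T) :
    ∃ P₁ P₀ J₁ J₀ M N : ModuleCat.{u} R, Module.Finite R P₁ ∧ Module.Finite R P₀ ∧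
      Module.Finite R J₁ ∧ Module.Finite R J₀ ∧ Module.Projective R P₁ ∧ Module.Projective R P₀ ∧
      ∃ (t₁ : (P₁ →ₗ[R] J₁) →+ K) (t₀ : (P₀ →ₗ[R] J₀) →+ K) (d : P₁ →ₗ[R] P₀) (d' : J₁ →ₗ[R] J₀)
        (π : P₀ →ₗ[R] M) (j : N →ₗ[R] J₁), IsNakayamaTrace t₁ ∧ IsNakayamaTrace t₀ ∧
        IsNakayamaAdj t₁ t₀ d d' ∧ Surjective π ∧ Function.Exact d π ∧ Injective j ∧
        Function.Exact j d' ∧ IsExtProjGen T M ∧ IsExtInjCogen F N := by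
  have : IsArtinianRing R := IsArtinianRing.of_finite K R
  have : IsNoetherianRing R := IsNoetherianRing.of_finite K R
  have := finite_opDual R K
  obtain ⟨M, f, hM, happ, hExt⟩ := h.exists_extProjective_approximation hcov
  have hMf : Module.Finite R M := ((h.torsion_iff M).1 hM).1
  obtain ⟨n, π, hπ⟩ := Module.Finite.exists_fin' R M
  obtain ⟨P, θ, hPf, hPp, hθ, hθ'⟩ := exists_projective_cover (R := R) (LinearMap.ker π)
  set d : P →ₗ[R] (Fin n → R) := (LinearMap.ker π).subtype ∘ₗ θ with hd
  have hdπ : Function.Exact d π := fun x => by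
    constructor
    · intro hx
      obtain ⟨y, hy⟩ := hθ ⟨x, hx⟩
      exact ⟨y, congrArg Subtype.val hy⟩
    · rintro ⟨y, rfl⟩
      exact (θ y).2
  have hsurj : ∀ (Y : Type u) [AddCommGroup Y] [Module R Y], T (ModuleCat.of R Y) →
      ∀ a : P →ₗ[R] Y, ∃ c : (Fin n → R) →ₗ[R] Y, c ∘ₗ d = a := fun Y _ _ hY a =>
    h.exists_comp_eq (LinearMap.ker π).subtype Subtype.val_injective π hπ
      (LinearMap.exact_subtype_ker_map π) θ hθ hθ' hExt Y hY a
  have hinj : ∀ (Y : Type u) [AddCommGroup Y] [Module R Y], F (ModuleCat.of R Y) →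
      ∀ c : (Fin n → R) →ₗ[R] Y, c ∘ₗ d = 0 → c = 0 := fun Y _ _ hY c hc => by
    obtain ⟨k, hk⟩ := exists_factor_of_surjective π hπ c fun x hx => by
      obtain ⟨y, rfl⟩ := (hdπ x).1 hx
      exact LinearMap.congr_fun hc y
    refine LinearMap.ext fun x => ?_
    rw [← hk]
    exact h.hom_eq_zero hM hY k _
  obtain ⟨f', hf'⟩ := Module.projective_lifting_property π f hπ
  obtain ⟨I₁, hI₁, t₁, ht₁⟩ := exists_injective_partner R K P
  obtain ⟨I₀, hI₀, t₀, ht₀⟩ := exists_injective_partner R K (Fin n → R)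
  obtain ⟨d', hd'⟩ := ht₁.exists_adj_right ht₀ d
  have hsR := isNakayamaTrace_regularTrace R K
  have ht₁R := ht₁.prod hsR
  obtain ⟨e', he'⟩ := ht₁R.exists_adj_right ht₀ (d.coprod f')
  have he_inl : e' ∘ₗ LinearMap.inl R I₁ (OpDual R K R) = d' := by
    refine IsNakayamaAdj.unique_right ht₀ (d := d) ?_ hd'
    have := (isNakayamaAdj_inl t₁ (regularTrace R K)).comp he'
    rwa [LinearMap.coprod_inl] at this
  have he_apply : ∀ x, e' (x, 0) = d' x := LinearMap.congr_fun he_inl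
  have hI₁inj : Module.Injective R I₁ := ht₁.injective
  have hI₁Rinj : Module.Injective R (I₁ × OpDual R K R) := ht₁R.injective
  let q := (LinearMap.range f).mkQ
  have hq : Surjective q := Submodule.mkQ_surjective _
  have hfq : Function.Exact f q := LinearMap.exact_map_mkQ_range f
  have hlift : ∀ (Y : Type u) [AddCommGroup Y] [Module R Y], F (ModuleCat.of R Y) →
      ∀ g : Y →ₗ[R] I₀, ∃ b : Y →ₗ[R] I₁, d' ∘ₗ b = g := fun Y _ _ hY g => by
    have := ((h.torsionFree_iff Y).1 hY).1
    exact hd'.exists_lift_of_injective ht₁ ht₀ (hinj Y hY) g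
  have hFker : F (ModuleCat.of R (LinearMap.ker e')) := by
    refine (h.torsionFree_iff _).2 ⟨inferInstance, fun Y _ _ hY g => ?_⟩
    have := ((h.torsion_iff Y).1 hY).1
    have h0 := he'.eq_zero_of_surjective ht₁R (fun a => ?_) ((LinearMap.ker e').subtype ∘ₗ g)
      (LinearMap.ext fun y => (g y).2)
    · exact LinearMap.ext fun y => Subtype.ext (LinearMap.congr_fun h0 y)
    · obtain ⟨c, hc⟩ := hsurj Y hY (a ∘ₗ LinearMap.inl R P R)
      obtain ⟨k, hk⟩ := happ Y hY (a ∘ₗ LinearMap.inr R P R - c ∘ₗ f')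
      refine ⟨c + k ∘ₗ π, LinearMap.prod_ext ?_ ?_⟩
      · rw [LinearMap.comp_assoc, LinearMap.coprod_inl, LinearMap.add_comp, hc,
          LinearMap.comp_assoc, hdπ.linearMap_comp_eq_zero, LinearMap.comp_zero, add_zero]
      · rw [LinearMap.comp_assoc, LinearMap.coprod_inr, LinearMap.add_comp,
          LinearMap.comp_assoc, hf', hk, add_sub_cancel]
  refine ⟨ModuleCat.of R (P × P × R), ModuleCat.of R ((Fin n → R) × (Fin n → R)),
    ModuleCat.of R (I₁ × I₁ × OpDual R K R), ModuleCat.of R (I₀ × I₀),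
    ModuleCat.of R (M × M ⧸ LinearMap.range f),
    ModuleCat.of R (LinearMap.ker d' × LinearMap.ker e'),
    inferInstanceAs (Module.Finite R (P × P × R)),
    inferInstanceAs (Module.Finite R ((Fin n → R) × (Fin n → R))),
    inferInstanceAs (Module.Finite R (I₁ × I₁ × OpDual R K R)),
    inferInstanceAs (Module.Finite R (I₀ × I₀)),
    inferInstanceAs (Module.Projective R (P × P × R)),
    inferInstanceAs (Module.Projective R ((Fin n → R) × (Fin n → R))),
    prodTrace t₁ (prodTrace t₁ (regularTrace R K)), prodTrace t₀ t₀,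
    d.prodMap (d.coprod f'), d'.prodMap e', π.prodMap (q ∘ₗ π),
    (LinearMap.ker d').subtype.prodMap (LinearMap.ker e').subtype, ht₁.prod ht₁R, ht₀.prod ht₀,
    hd'.prodMap he', hπ.prodMap (hq.comp hπ), ?_,
    Injective.prodMap Subtype.val_injective Subtype.val_injective, ?_,
    h.isExtProjGen K f q hq hfq hM happ hExt, ?_⟩
  · rintro ⟨x, y⟩
    constructor
    · intro hxy
      obtain ⟨hx, hy⟩ := Prod.ext_iff.1 hxy
      obtain ⟨u, hu⟩ := (hdπ x).1 hx
      obtain ⟨r, hr⟩ := (hfq (π y)).1 hy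
      obtain ⟨v, hv⟩ := (hdπ (y - f' r)).1 (by
        rw [map_sub, sub_eq_zero, ← hr]
        exact (LinearMap.congr_fun hf' r).symm)
      refine ⟨(u, v, r), Prod.ext hu ?_⟩
      change d v + f' r = y
      rw [hv, sub_add_cancel]
    · rintro ⟨⟨u, v, r⟩, hu⟩
      rw [← hu]
      refine Prod.ext (hdπ.apply_apply_eq_zero u) ?_
      change q (π (d v + f' r)) = 0
      rw [map_add, hdπ.apply_apply_eq_zero, zero_add]
      exact (congrArg q (LinearMap.congr_fun hf' r)).trans (hfq.apply_apply_eq_zero r)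
  · rintro ⟨x, y⟩
    constructor
    · intro hxy
      obtain ⟨hx, hy⟩ := Prod.ext_iff.1 hxy
      exact ⟨(⟨x, hx⟩, ⟨y, hy⟩), rfl⟩
    · rintro ⟨⟨x', y'⟩, hx⟩
      rw [← hx]
      exact Prod.ext x'.2 y'.2
  · refine h.isExtInjCogen K
      ((LinearMap.inl R I₁ (OpDual R K R)).restrict (p := LinearMap.ker d') (q := LinearMap.ker e')
        fun x hx => (he_apply x).trans hx)
      (LinearMap.snd R I₁ (OpDual R K R) ∘ₗ (LinearMap.ker e').subtype) ?_ ?_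
      (fun Y _ _ y hy => eq_zero_of_forall_hom_dual R K hy) hFker (fun Y _ _ hY g => ?_)
      (fun Y _ _ hY => ext1Vanishes_ker e' fun g => ?_)
      (fun Y _ _ hY => ext1Vanishes_ker d' (hlift Y hY))
    · intro x y hxy
      exact Subtype.ext (congrArg (fun z => z.1.1) hxy)
    · rintro ⟨⟨x, y⟩, hxy⟩
      constructor
      · intro hy
        obtain rfl : y = 0 := hy
        exact ⟨⟨x, (he_apply x).symm.trans hxy⟩, rfl⟩
      · rintro ⟨z, hz⟩
        rw [← hz]
        rfl
    · obtain ⟨b, hb⟩ := hlift Y hY (e' ∘ₗ LinearMap.inr R I₁ (OpDual R K R) ∘ₗ g)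
      refine ⟨((-b).prod g).codRestrict (LinearMap.ker e') fun y => ?_, rfl⟩
      have e : ((-b).prod g) y = (0, g y) - (b y, 0) := by simp
      rw [LinearMap.mem_ker, e, map_sub, he_apply, sub_eq_zero]
      exact (LinearMap.congr_fun hb y).symm
    · obtain ⟨b, hb⟩ := hlift Y hY g
      refine ⟨LinearMap.inl R I₁ (OpDual R K R) ∘ₗ b, ?_⟩
      rw [← LinearMap.comp_assoc, he_inl, hb]

end GeneratorData

section MainProof

variable {R : Type u} [Ring R] {K : Type u} [Field K] [Algebra K R] [FiniteDimensional K R]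

/-- Finitely generated modules embed into finite powers of the dual of the regular module. -/
lemma exists_embedding_opDual_pow (R K : Type u) [Ring R] [Field K] [Algebra K R]
    [FiniteDimensional K R] (C : Type u) [AddCommGroup C] [Module R C] [Module.Finite R C] :
    ∃ (n : ℕ) (j : C →ₗ[R] (Fin n → OpDual R K R)), Injective j := by
  have := finite_opDual R K
  obtain ⟨n, φ, -, hφ⟩ := exists_finite_generating_maps (R := R) K C (OpDual R K R)
  refine ⟨n, LinearMap.pi φ,
    LinearMap.ker_eq_bot.1 (LinearMap.ker_eq_bot'.2 fun x hx => ?_)⟩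
  refine eq_zero_of_forall_hom_dual R K fun g => ?_
  obtain ⟨c, hc⟩ := hφ g
  rw [hc]
  exact Finset.sum_eq_zero fun k _ => by rw [show φ k x = 0 from congrFun hx k, map_zero]

lemma IsGI.of_inAdd {N C : Type u} [AddCommGroup N] [Module R N] [AddCommGroup C] [Module R C]
    [Module.Finite R C] (hN : IsGI R K N) (hC : InAdd R N C) : IsGI R K C := by
  have := finite_opDual R K
  obtain ⟨n, j, hj⟩ := exists_embedding_opDual_pow R K C
  obtain ⟨m, l, hl⟩ := exists_embedding_opDual_pow R K ((Fin n → OpDual R K R) ⧸ LinearMap.range j)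
  have htn := (isNakayamaTrace_regularTrace R K).pow n
  have htm := (isNakayamaTrace_regularTrace R K).pow m
  have hjl : Function.Exact j (l ∘ₗ (LinearMap.range j).mkQ) := fun x => by
    rw [LinearMap.comp_apply, LinearMap.map_eq_zero_iff l hl]
    exact LinearMap.exact_map_mkQ_range j x
  obtain ⟨d, hd⟩ := htn.exists_adj_left htm (l ∘ₗ (LinearMap.range j).mkQ)
  obtain ⟨S, hS, hSM⟩ := hN.exists_stAdd hC htn htm hd j hj hjl (LinearMap.range d).mkQ
    (Submodule.mkQ_surjective _) (LinearMap.exact_map_mkQ_range d)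
  refine (hS.isGI_ker hSM htn htm hd (LinearMap.range d).mkQ
    (Submodule.mkQ_surjective _) (LinearMap.exact_map_mkQ_range d)).of_equiv ?_
  exact (LinearEquiv.ofInjective j hj).trans (LinearEquiv.ofEq _ _ hjl.linearMap_ker_eq.symm)

lemma IsGP.of_inAdd {G M : Type u} [AddCommGroup G] [Module R G] [AddCommGroup M] [Module R M]
    (hG : IsGP R G) (hM : InAdd R G M) : IsGP R M := by
  obtain ⟨S, hS, hSG⟩ := exists_isStepClosed hG
  exact hS.isGP (StAdd.of_inAdd hSG hM)

section Copresentation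

variable {P₁ P₀ J₁ J₀ M N : Type u} [AddCommGroup P₁] [Module R P₁]
  [AddCommGroup P₀] [Module R P₀] [AddCommGroup J₁] [Module R J₁] [AddCommGroup J₀] [Module R J₀]
  [AddCommGroup M] [Module R M] [AddCommGroup N] [Module R N]
  [Module.Finite R P₁] [Module.Finite R P₀] [Module.Finite R J₁] [Module.Finite R J₀]
  [Module.Projective R P₀]
  {t₁ : (P₁ →ₗ[R] J₁) →+ K} {t₀ : (P₀ →ₗ[R] J₀) →+ K}
  {d : P₁ →ₗ[R] P₀} {d' : J₁ →ₗ[R] J₀} {π : P₀ →ₗ[R] M} {j : N →ₗ[R] J₁}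

lemma IsNakayamaAdj.isGI_of_isGP [Module.Projective R P₁] (ht₁ : IsNakayamaTrace t₁)
    (ht₀ : IsNakayamaTrace t₀)
    (h : IsNakayamaAdj t₁ t₀ d d') (hπ : Surjective π) (hdπ : Function.Exact d π)
    (hj : Injective j) (hjd : Function.Exact j d') (hM : IsGP R M) : IsGI R K N := by
  obtain ⟨S, hS, hSG⟩ := exists_isStepClosed hM
  have hM' : InAdd R M M := InAdd.refl M
  exact (hS.isGI_ker (StAdd.of_inAdd hSG hM') ht₁ ht₀ h π hπ hdπ).of_equiv
    ((LinearEquiv.ofInjective j hj).trans (LinearEquiv.ofEq _ _ hjd.linearMap_ker_eq.symm))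

lemma IsNakayamaAdj.isGP_of_isGI (ht₁ : IsNakayamaTrace t₁) (ht₀ : IsNakayamaTrace t₀)
    (h : IsNakayamaAdj t₁ t₀ d d') (hπ : Surjective π) (hdπ : Function.Exact d π)
    (hj : Injective j) (hjd : Function.Exact j d') (hN : IsGI R K N) : IsGP R M := by
  obtain ⟨S, hS, hSM⟩ := hN.exists_stAdd (InAdd.refl N) ht₁ ht₀ h j hj hjd π hπ hdπ
  exact hS.isGP hSM

lemma IsNakayamaAdj.injective_of_projective (ht₁ : IsNakayamaTrace t₁) (ht₀ : IsNakayamaTrace t₀)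
    (h : IsNakayamaAdj t₁ t₀ d d') (hπ : Surjective π) (hdπ : Function.Exact d π)
    (hj : Injective j) (hjd : Function.Exact j d') [Module.Projective R M] :
    Module.Injective R N := by
  have := ht₁.injective
  obtain ⟨σ, hσ⟩ := Module.projective_lifting_property π LinearMap.id hπ
  obtain ⟨s, hs⟩ := Module.projective_lifting_property d.rangeRestrict
    ((LinearMap.id - σ ∘ₗ π).codRestrict (LinearMap.range d) fun x => (hdπ _).1 (by
      change π (x - σ (π x)) = 0
      rw [map_sub, sub_eq_zero]
      exact (LinearMap.congr_fun hσ (π x)).symm)) d.surjective_rangeRestrict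
  have hs' : ∀ x, d (s x) = x - σ (π x) := fun x => congrArg Subtype.val (LinearMap.congr_fun hs x)
  obtain ⟨s', hss'⟩ := ht₀.exists_adj_right ht₁ s
  have h1 : d ∘ₗ s ∘ₗ d = d := LinearMap.ext fun x => by
    rw [LinearMap.comp_apply, LinearMap.comp_apply, hs', hdπ.apply_apply_eq_zero, map_zero,
      sub_zero]
  have h2 : d' ∘ₗ s' ∘ₗ d' = d' := by
    refine IsNakayamaAdj.unique_right ht₀ (d := d) ?_ h
    have h3 := (h.comp hss').comp h
    rwa [h1] at h3
  obtain ⟨r, hr⟩ := exists_factor_of_injective j hj (LinearMap.id - s' ∘ₗ d') fun x =>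
    (hjd _).1 (by
      change d' (x - s' (d' x)) = 0
      rw [map_sub, sub_eq_zero]
      exact (LinearMap.congr_fun h2 x).symm)
  refine injective_of_retract j r fun x => hj ?_
  rw [hr]
  change j x - s' (d' (j x)) = j x
  rw [hjd.apply_apply_eq_zero, map_zero, sub_zero]

lemma IsNakayamaAdj.projective_of_injective (ht₁ : IsNakayamaTrace t₁) (ht₀ : IsNakayamaTrace t₀)
    (h : IsNakayamaAdj t₁ t₀ d d') (hπ : Surjective π) (hdπ : Function.Exact d π)
    (hj : Injective j) (hjd : Function.Exact j d') [hN : Module.Injective R N] :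
    Module.Projective R M := by
  have := ht₁.injective
  obtain ⟨r, hr⟩ := hN.out j hj LinearMap.id
  obtain ⟨s', hs'⟩ := exists_factor_to_injective d' (LinearMap.id - j ∘ₗ r) fun x hx => by
    obtain ⟨y, rfl⟩ := (hjd x).1 hx
    change j y - j (r (j y)) = 0
    rw [hr, LinearMap.id_apply, sub_self]
  obtain ⟨s, hss'⟩ := ht₀.exists_adj_left ht₁ s'
  have h1 : d' ∘ₗ s' ∘ₗ d' = d' := LinearMap.ext fun x => by
    change d' (s' (d' x)) = d' x
    rw [hs']
    change d' (x - j (r x)) = d' x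
    rw [map_sub, hjd.apply_apply_eq_zero, sub_zero]
  have h2 : d ∘ₗ s ∘ₗ d = d := by
    refine IsNakayamaAdj.unique_left ht₁ (d' := d') ?_ h
    have h3 := (h.comp hss').comp h
    rwa [h1] at h3
  obtain ⟨σ, hσ⟩ := exists_factor_of_surjective π hπ (LinearMap.id - d ∘ₗ s) fun x hx => by
    obtain ⟨y, rfl⟩ := (hdπ x).1 hx
    exact sub_eq_zero.2 (LinearMap.congr_fun h2 y).symm
  refine Module.Projective.of_split σ π (LinearMap.ext fun m => ?_)
  obtain ⟨x, rfl⟩ := hπ m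
  rw [LinearMap.comp_apply, hσ]
  change π (x - d (s x)) = π x
  rw [map_sub, hdπ.apply_apply_eq_zero, sub_zero]

end Copresentation

end MainProof

/-- Let `(T, F)` be a functorially finite torsion pair. Then:
(1) the basic Ext-projective generator of `T` is Gorenstein projective iff the
basic Ext-injective cogenerator of `F` is Gorenstein injective; (2) the basic
Ext-projective generator of `T` is projective iff every Ext-injective object
of `F` is injective. -/
theorem gorenstein_torsion_pair_generator_cogenerator (K R : Type u) [Field K] [Ring R]
    [Algebra K R] [FiniteDimensional K R]
    (T F : ModuleCat.{u} R → Prop)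
    (htp : IsTorsionPair R T F) (hff : FunctoriallyFinite R T) :
    ((∀ G : ModuleCat.{u} R, IsBasicExtProjGen R T G → IsGP R G) ↔
      (∀ C : ModuleCat.{u} R, IsBasicExtInjCogen R F C → IsGI R K C)) ∧
    ((∀ G : ModuleCat.{u} R, IsBasicExtProjGen R T G → Module.Projective R G) ↔
      (∀ X : ModuleCat.{u} R, F X →
        (∀ Y : ModuleCat.{u} R, F Y → Ext1Vanishes R Y X) → Module.Injective R X)) := by
  have : IsArtinianRing R := IsArtinianRing.of_finite K R
  have : IsNoetherianRing R := IsNoetherianRing.of_finite K R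
  obtain ⟨P₁, P₀, J₁, J₀, M, N, _, _, _, _, _, _, t₁, t₀, d, d', π, j, ht₁, ht₀, hd, hπ, hdπ, hj,
    hjd, hM, hN⟩ := htp.exists_extProjGen_extInjCogen (K := K) hff.1
  refine ⟨⟨fun hGP C hC => ?_, fun hGI G hG => ?_⟩, fun hproj X hX hXF => ?_,
    fun hinj G hG => ?_⟩
  · obtain ⟨G, hG⟩ := hM.exists_basic htp
    have : Module.Finite R C := ((htp.torsionFree_iff C).1 hC.1).1
    exact (hd.isGI_of_isGP ht₁ ht₀ hπ hdπ hj hjd ((hGP G hG).of_inAdd (hM.inAdd hG).2)).of_inAdd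
      (hN.inAdd hC).1
  · obtain ⟨C, hC⟩ := hN.exists_basic htp
    have : Module.Finite R N := ((htp.torsionFree_iff N).1 hN.1).1
    exact (hd.isGP_of_isGI ht₁ ht₀ hπ hdπ hj hjd ((hGI C hC).of_inAdd (hN.inAdd hC).2)).of_inAdd
      (hM.inAdd hG).1
  · obtain ⟨G, hG⟩ := hM.exists_basic htp
    have := hproj G hG
    have : Module.Projective R M := (hM.inAdd hG).2.projective
    have : Module.Injective R N := hd.injective_of_projective ht₁ ht₀ hπ hdπ hj hjd
    exact (hN.2.2.2 X hX fun Y _ _ hY => hXF (ModuleCat.of R Y) hY).injective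
  · have : Module.Injective R N := hinj N hN.1 fun Y hY => hN.2.1 Y hY
    have : Module.Projective R M := hd.projective_of_injective ht₁ ht₀ hπ hdπ hj hjd
    exact (hM.inAdd hG).1.projective

end GPTau
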